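/- Let X ⊂ ℝ² be a compact, simply connected, locally connected set and let f : X → Y ⊂ ℝ² be a homeomorphism onto its image isotopic to the identity on X. If X ∩ Y is connected and f has no fixed points, then the non-escaping set of f is empty: { x ∈ X : fⁿ(x) ∈ X ∩ Y for all n ∈ ℕ } = ∅. -/

import Mathlib

open Set Filter Topology

noncomputable section

/-- The real plane. -/
abbrev Plane : Type := EuclideanSpace ℝ (Fin 2)

/-- `f` restricted to `X` is a homeomorphism onto its image `Y`
(for compact `X`, a continuous injection is a homeomorphism onto its image). -/
def IsHomeoOnto (f : Plane → Plane) (X Y : Set Plane) : Prop :=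
  ContinuousOn f X ∧ Set.InjOn f X ∧ f '' X = Y

/-- `f : X → f(X)` is isotopic to the identity on `X`: there is a continuous family
of homeomorphisms (continuous injections, `X` being compact in applications)
`h_t : X → h_t(X)`, `t ∈ [0,1]`, with `h_0 = id_X` and `h_1 = f`. -/
def IsotopicToIdOn (f : Plane → Plane) (X : Set Plane) : Prop :=
  ∃ H : ℝ → Plane → Plane,
    ContinuousOn (fun p : ℝ × Plane => H p.1 p.2) (Set.Icc (0:ℝ) 1 ×ˢ X) ∧
    (∀ x ∈ X, H 0 x = x) ∧
    (∀ x ∈ X, H 1 x = f x) ∧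
    (∀ t ∈ Set.Icc (0:ℝ) 1, Set.InjOn (H t) X)

/-- A Jordan domain: a subset of the plane homeomorphic to the closed unit disk. -/
def IsJordanDomain (D : Set Plane) : Prop :=
  Nonempty (↥D ≃ₜ ↥(Metric.closedBall (0:Plane) 1))

/-- A self-homeomorphism of the plane is orientation-preserving iff it is isotopic to
the identity through homeomorphisms of the plane (note that a continuous bijection of the
plane is automatically a homeomorphism, by invariance of domain). -/
def IsOrientationPreservingPlaneHomeo (F : Plane ≃ₜ Plane) : Prop :=
  ∃ H : ℝ → Plane → Plane,
    Continuous (fun p : ℝ × Plane => H p.1 p.2) ∧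
    (∀ x, H 0 x = x) ∧
    (∀ x, H 1 x = F x) ∧
    (∀ t ∈ Set.Icc (0:ℝ) 1, Function.Bijective (H t))

/-- A homeomorphism between planar sets (here: the restriction of `f` to `X`) is
orientation-preserving if it extends to an orientation-preserving homeomorphism of the plane. -/
def OrientationPreservingOn (f : Plane → Plane) (X : Set Plane) : Prop :=
  ∃ F : Plane ≃ₜ Plane, IsOrientationPreservingPlaneHomeo F ∧ Set.EqOn f (⇑F) X

/-- A Jordan curve: the image of a topological embedding of the circle
(a continuous injection of the compact circle, hence an embedding). -/
def IsJordanCurve (C : Set Plane) : Prop :=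
  ∃ γ : Plane → Plane, ContinuousOn γ (Metric.sphere (0:Plane) 1) ∧
    Set.InjOn γ (Metric.sphere (0:Plane) 1) ∧
    γ '' Metric.sphere (0:Plane) 1 = C

lemma exp_eq_exp_of_norm_sub_lt {a b : ℂ} (h : Complex.exp a = Complex.exp b)
    (hab : ‖a - b‖ < 2 * Real.pi) : a = b := by
  obtain ⟨n, hn⟩ := Complex.exp_eq_exp_iff_exists_int.1 h
  have h1 : a - b = n * (2 * Real.pi * Complex.I) := by rw [hn]; ring
  rw [h1] at hab
  have h2 : ‖(n : ℂ) * (2 * Real.pi * Complex.I)‖ = |(n : ℝ)| * (2 * Real.pi) := by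
    simp [abs_of_pos Real.pi_pos]
  rw [h2] at hab
  have h3 : |(n : ℝ)| < 1 := by
    by_contra h4
    nlinarith [Real.pi_pos]
  have h4 : n = 0 := by
    rw [← Int.cast_abs] at h3
    have : |n| < 1 := by exact_mod_cast h3
    exact Int.abs_lt_one_iff.1 this
  simpa [h4] using hn

lemma isDiscrete_exp_eq_one : IsDiscrete {w : ℂ | Complex.exp w = 1} := by
  refine IsDiscrete.of_nhdsWithin fun x hx => ?_
  have : Metric.ball x (2 * Real.pi) ∩ {w : ℂ | Complex.exp w = 1} ∈ 𝓝[{w : ℂ | Complex.exp w = 1}] x :=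
    inter_mem (mem_nhdsWithin_of_mem_nhds (Metric.ball_mem_nhds _ (by positivity))) self_mem_nhdsWithin
  refine (le_principal_iff.2 this).trans ?_
  rw [← principal_singleton, principal_mono]
  rintro w ⟨hw, hw'⟩
  rw [Metric.mem_ball, dist_eq_norm] at hw
  exact exp_eq_exp_of_norm_sub_lt (hw'.trans (Eq.symm hx)) hw

/-- Two continuous logarithms of a function on a preconnected set differ by a constant. -/
lemma IsPreconnected.sub_eq_sub_of_exp_eq {T : Type*} [TopologicalSpace T] {S : Set T}
    (hS : IsPreconnected S) {g g' : T → ℂ} (hg : ContinuousOn g S) (hg' : ContinuousOn g' S)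
    (h : ∀ x ∈ S, Complex.exp (g x) = Complex.exp (g' x)) {x y : T} (hx : x ∈ S) (hy : y ∈ S) :
    g x - g' x = g y - g' y := by
  refine hS.constant_of_mapsTo isDiscrete_exp_eq_one (hg.sub hg') (fun z hz => ?_) hx hy
  show Complex.exp (g z - g' z) = 1
  rw [Complex.exp_sub, h z hz, div_self (Complex.exp_ne_zero _)]

/-- Every continuous nonvanishing function on `S` has a continuous logarithm. -/
def HasLogs {T : Type*} [TopologicalSpace T] (S : Set T) : Prop :=
  ∀ k : T → ℂ, ContinuousOn k S → (∀ x ∈ S, k x ≠ 0) →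
    ∃ L : T → ℂ, ContinuousOn L S ∧ ∀ x ∈ S, Complex.exp (L x) = k x

/-- Continuous logarithms extend along homotopies. -/
lemma exists_log_homotopy {T : Type*} [TopologicalSpace T] {S : Set T} {Q : ℝ → T → ℂ}
    (hQ : ContinuousOn (fun p : ℝ × T => Q p.1 p.2) (Icc 0 1 ×ˢ S))
    (h0 : ∀ s ∈ Icc (0 : ℝ) 1, ∀ x ∈ S, Q s x ≠ 0) {L0 : T → ℂ} (hL0 : ContinuousOn L0 S)
    (hQL : ∀ x ∈ S, Complex.exp (L0 x) = Q 0 x) :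
    ∃ L : ℝ → T → ℂ, ContinuousOn (fun p : ℝ × T => L p.1 p.2) (Icc 0 1 ×ˢ S) ∧
      (∀ s ∈ Icc (0 : ℝ) 1, ∀ x ∈ S, Complex.exp (L s x) = Q s x) ∧ ∀ x ∈ S, L 0 x = L0 x := by
  classical
  let H : C(unitInterval × S, {z : ℂ // z ≠ 0}) :=
    ⟨fun p => ⟨Q p.1 p.2, h0 _ p.1.2 _ p.2.2⟩, by
      refine Continuous.subtype_mk ?_ _
      exact hQ.comp_continuous (f := fun p : unitInterval × S => ((p.1 : ℝ), (p.2 : T)))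
        (by fun_prop) fun p => ⟨p.1.2, p.2.2⟩⟩
  let f : C(S, ℂ) := ⟨S.domRestrict L0, continuousOn_iff_continuous_domRestrict.1 hL0⟩
  have cov := Complex.isCoveringMap_exp
  have H0 : ∀ a : S, H (0, a) = (⟨_, (f a).exp_ne_zero⟩ : {z : ℂ // z ≠ 0}) := by
    intro a
    apply Subtype.ext
    exact (hQL a a.2).symm
  let G := cov.liftHomotopy H f H0
  have hG : ∀ p, Complex.exp (G p) = Q p.1 p.2 := fun p =>
    congrArg Subtype.val (congrFun (cov.liftHomotopy_lifts H f H0) p)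
  have hG0 : ∀ a, G (0, a) = f a := cov.liftHomotopy_zero H f H0
  refine ⟨fun s x => if h : s ∈ Icc (0 : ℝ) 1 ∧ x ∈ S then G (⟨s, h.1⟩, ⟨x, h.2⟩) else 0, ?_, ?_, ?_⟩
  · rw [continuousOn_iff_continuous_domRestrict]
    have : (Icc (0 : ℝ) 1 ×ˢ S).domRestrict (fun p : ℝ × T =>
        if h : p.1 ∈ Icc (0 : ℝ) 1 ∧ p.2 ∈ S then G (⟨p.1, h.1⟩, ⟨p.2, h.2⟩) else 0) =
        fun p : (Icc (0 : ℝ) 1 ×ˢ S : Set (ℝ × T)) => G (⟨p.1.1, p.2.1⟩, ⟨p.1.2, p.2.2⟩) := by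
      funext p
      simp only [domRestrict_apply]
      rw [dif_pos ⟨p.2.1, p.2.2⟩]
    rw [this]
    exact G.continuous.comp (by fun_prop)
  · intro s hs x hx
    simp only [dif_pos (And.intro hs hx)]
    exact hG (⟨s, hs⟩, ⟨x, hx⟩)
  · intro x hx
    have h00 : (0 : ℝ) ∈ Icc (0 : ℝ) 1 := ⟨le_rfl, zero_le_one⟩
    simp only [dif_pos (And.intro h00 hx)]
    exact hG0 ⟨x, hx⟩

/-- A continuous logarithm of a constant function is constant. -/
lemma IsPreconnected.eq_of_exp_eq {T : Type*} [TopologicalSpace T] {S : Set T}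
    (hS : IsPreconnected S) {g g' : T → ℂ} (hg : ContinuousOn g S) (hg' : ContinuousOn g' S)
    (h : ∀ x ∈ S, Complex.exp (g x) = Complex.exp (g' x)) {x y : T} (hx : x ∈ S) (hy : y ∈ S)
    (hxy : g x = g' x) : g y = g' y := by
  have := hS.sub_eq_sub_of_exp_eq hg hg' h hx hy
  rw [hxy, sub_self] at this
  exact (sub_eq_zero.1 this.symm)

section

/-- A retraction `r` of a neighbourhood `N` of `X`, with a deformation `R` along its fibres. -/
structure RetractionData (X N N' V V' : Set ℂ) (r : ℂ → ℂ) (R : ℝ → ℂ → ℂ) : Prop where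
  compact : IsCompact X
  sub : X ⊆ N'
  sub' : N' ⊆ N
  isOpen : IsOpen N
  isOpen' : IsOpen N'
  cont : ContinuousOn r N
  maps : MapsTo r N X
  fix : ∀ x ∈ X, r x = x
  contR : ContinuousOn (fun p : ℝ × ℂ => R p.1 p.2) (Icc 0 1 ×ˢ N)
  zero : ∀ w ∈ N, R 0 w = w
  one : ∀ w ∈ N, R 1 w = r w
  fibre : ∀ s ∈ Icc (0 : ℝ) 1, ∀ w ∈ N, r (R s w) = r w
  mapsR : ∀ s ∈ Icc (0 : ℝ) 1, ∀ w ∈ N', R s w ∈ N'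
  subV : V' ⊆ V
  subX : V ⊆ X
  conn : IsPreconnected V
  path : ∀ a ∈ V', ∀ b ∈ V', ∃ γ : ℝ → ℂ, ContinuousOn γ (Icc 0 1) ∧ MapsTo γ (Icc 0 1) V' ∧
    γ 0 = a ∧ γ 1 = b
  log : ∀ k : ℂ → ℂ, ContinuousOn k N → (∀ w ∈ N, k w ≠ 0) →
    ∃ L : ℂ → ℂ, ContinuousOn L N ∧ ∀ w ∈ N, Complex.exp (L w) = k w

/-- A continuous injection `f` of `X` without fixed points near `X`, together with a continuous
determination of the logarithm of `(f y - f x) / (y - x)`. -/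
structure FreeMap (X N N' V V' : Set ℂ) (r : ℂ → ℂ) (f : ℂ → ℂ) : Prop where
  cont : ContinuousOn f X
  inj : InjOn f X
  mapsV : MapsTo f V N
  mapsV' : MapsTo f V' N'
  source : ∀ x ∈ X, f x ∈ N' → x ∈ V
  free : ∀ x ∈ X, f x ∈ N → r (f x) ≠ x
  rot : ∃ W : ℂ → ℂ → ℂ,
    ContinuousOn (fun p : ℂ × ℂ => W p.1 p.2) {p | p.1 ∈ X ∧ p.2 ∈ N ∧ r p.2 ≠ p.1} ∧
    (∀ x ∈ X, ∀ w ∈ N, r w ≠ x → Complex.exp (W x w) = (f (r w) - f x) / (w - x)) ∧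
    ∀ x ∈ X, ∀ y ∈ X, x ≠ y → W x y = W y x

/-- A small perturbation of the identity supported in `N'`. -/
structure IsPush (N' : Set ℂ) (φ : ℂ → ℂ) : Prop where
  cont : Continuous φ
  lt : ∀ u v, u ≠ v → ‖φ u - φ v - (u - v)‖ < ‖u - v‖
  supp : ∀ z, z ∉ N' → φ z = z
  maps : MapsTo φ N' N'

variable {X N N' V V' : Set ℂ} {r : ℂ → ℂ} {R : ℝ → ℂ → ℂ} {f φ : ℂ → ℂ}

lemma IsPush.injective (h : IsPush N' φ) : Function.Injective φ := by
  intro u v huv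
  by_contra hne
  have := h.lt u v hne
  rw [huv, sub_self, zero_sub, norm_neg] at this
  exact lt_irrefl _ this

lemma IsPush.mem_iff (h : IsPush N' φ) (z : ℂ) : φ z ∈ N' ↔ z ∈ N' := by
  refine ⟨fun hz => ?_, fun hz => h.maps hz⟩
  by_contra hn
  rw [h.supp z hn] at hz
  exact hn hz

lemma FreeMap.push (D : RetractionData X N N' V V' r R) (F : FreeMap X N N' V V' r f)
    (h : IsPush N' φ) (hfree : ∀ x ∈ X, φ (f x) ∈ N → r (φ (f x)) ≠ x) :
    FreeMap X N N' V V' r (fun x => φ (f x)) := by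
  have hN : ∀ z ∈ N, φ z ∈ N := by
    intro z hz
    by_cases hz' : z ∈ N'
    · exact D.sub' (h.maps hz')
    · rwa [h.supp z hz']
  refine ⟨h.cont.comp_continuousOn F.cont, fun x hx y hy hxy => F.inj hx hy (h.injective hxy),
    fun x hx => hN _ (F.mapsV hx), fun x hx => h.maps (F.mapsV' hx),
    fun x hx hfx => F.source x hx ((h.mem_iff _).1 hfx), hfree, ?_⟩
  obtain ⟨W, hWc, hWe, hWs⟩ := F.rot
  have hne : ∀ x ∈ X, ∀ w ∈ N, r w ≠ x → f (r w) ≠ f x := fun x hx w hw hwx he =>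
    hwx (F.inj (D.maps hw) hx he)
  have key : ∀ a b : ℂ, a ≠ b → ‖(φ a - φ b) / (a - b) - 1‖ < 1 := by
    intro a b hab
    have hab' : a - b ≠ 0 := sub_ne_zero.2 hab
    rw [div_sub_one hab', norm_div, div_lt_one (norm_pos_iff.2 hab')]
    exact h.lt a b hab
  have slit : ∀ a b : ℂ, a ≠ b → (φ a - φ b) / (a - b) ∈ Complex.slitPlane := by
    intro a b hab
    have := Complex.mem_slitPlane_of_norm_lt_one (key a b hab)
    simpa using this
  refine ⟨fun x w => W x w + Complex.log ((φ (f (r w)) - φ (f x)) / (f (r w) - f x)), ?_, ?_, ?_⟩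
  · have h1 : ContinuousOn (fun p : ℂ × ℂ => f (r p.2)) {p | p.1 ∈ X ∧ p.2 ∈ N ∧ r p.2 ≠ p.1} :=
      F.cont.comp (D.cont.comp continuousOn_snd fun p hp => hp.2.1) fun p hp => D.maps hp.2.1
    have h2 : ContinuousOn (fun p : ℂ × ℂ => f p.1) {p | p.1 ∈ X ∧ p.2 ∈ N ∧ r p.2 ≠ p.1} :=
      F.cont.comp continuousOn_fst fun p hp => hp.1
    refine hWc.add (ContinuousOn.clog ?_ fun p hp => slit _ _ (hne _ hp.1 _ hp.2.1 hp.2.2))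
    refine ContinuousOn.div ?_ (h1.sub h2) fun p hp =>
      sub_ne_zero.2 (hne _ hp.1 _ hp.2.1 hp.2.2)
    exact (h.cont.comp_continuousOn h1).sub (h.cont.comp_continuousOn h2)
  · intro x hx w hw hwx
    have h0 := hne x hx w hw hwx
    have h0' : f (r w) - f x ≠ 0 := sub_ne_zero.2 h0
    rw [Complex.exp_add, hWe x hx w hw hwx, Complex.exp_log (Complex.slitPlane_ne_zero (slit _ _ h0))]
    field_simp
  · intro x hx y hy hxy
    simp only
    rw [hWs x hx y hy hxy, D.fix x hx, D.fix y hy, ← neg_sub (φ (f x)), ← neg_sub (f x), neg_div_neg_eq]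

/-- A free map has no orbit of period two. -/
lemma FreeMap.no_two_cycle (D : RetractionData X N N' V V' r R) (F : FreeMap X N N' V V' r f)
    {x y : ℂ} (hx : x ∈ V) (hy : y ∈ V) (hxy : f x = y) (hyx : f y = x) : False := by
  obtain ⟨W, hWc, hWe, hWs⟩ := F.rot
  have hXN : X ⊆ N := D.sub.trans D.sub'
  have hk : ∀ w ∈ N, f (r w) - w ≠ 0 := by
    intro w hw h0
    have h1 : f (r w) = w := sub_eq_zero.1 h0
    exact F.free (r w) (D.maps hw) (by rwa [h1]) (by rw [h1])
  obtain ⟨L, hLc, hLe⟩ := D.log (fun w => f (r w) - w)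
    ((F.cont.comp D.cont D.maps).sub continuousOn_id) hk
  have hfr : ∀ z ∈ V, r (f z) ≠ z := fun z hz => F.free z (D.subX hz) (F.mapsV hz)
  have hmc : ContinuousOn (fun z => L (f z) - L z - W z (f z)) V := by
    have hfV : ContinuousOn f V := F.cont.mono D.subX
    refine ((hLc.comp hfV F.mapsV).sub (hLc.mono (D.subX.trans hXN))).sub ?_
    exact hWc.comp (continuousOn_id.prodMk hfV) fun z hz => ⟨D.subX hz, F.mapsV hz, hfr z hz⟩
  have hme : ∀ z ∈ V, Complex.exp (L (f z) - L z - W z (f z)) = 1 := by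
    intro z hz
    have hzX := D.subX hz
    have h1 : f z - z ≠ 0 := by
      have := hk z (hXN hzX)
      rwa [D.fix z hzX] at this
    have h2 : f (r (f z)) - f z ≠ 0 := hk _ (F.mapsV hz)
    rw [Complex.exp_sub, Complex.exp_sub, hLe _ (F.mapsV hz), hLe _ (hXN hzX),
      hWe z hzX _ (F.mapsV hz) (hfr z hz), D.fix z hzX]
    field_simp
  have hconst : L (f x) - L x - W x (f x) = L (f y) - L y - W y (f y) := by
    refine D.conn.constant_of_mapsTo (T := {w : ℂ | Complex.exp w = 1})
      isDiscrete_exp_eq_one hmc (fun z hz => hme z hz) hx hy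
  have hne : x ≠ y := by
    intro h
    have := hfr x hx
    rw [hxy, D.fix y (D.subX hy)] at this
    exact this h.symm
  rw [hxy, hyx, hWs x (D.subX hx) y (D.subX hy) hne] at hconst
  have hL : L x = L y := by linear_combination (-1 / 2) * hconst
  have e1 := hLe x (hXN (D.subX hx))
  have e2 := hLe y (hXN (D.subX hy))
  rw [D.fix x (D.subX hx), hxy] at e1
  rw [D.fix y (D.subX hy), hyx, ← hL, e1] at e2
  apply hne
  linear_combination (-1 / 2) * e2

end

section

/-- The elementary push of the ball of radius `ρ` around `c`, moving `c` to `c + v`. -/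
def ballPush (c : ℂ) (ρ : ℝ) (v z : ℂ) : ℂ := z + ((max 0 (1 - ‖z - c‖ / ρ) : ℝ) : ℂ) * v

variable {X N N' V V' : Set ℂ} {r : ℂ → ℂ} {R : ℝ → ℂ → ℂ} {f φ : ℂ → ℂ} {c v z : ℂ} {ρ : ℝ}

lemma ballPush_center : ballPush c ρ v c = c + v := by simp [ballPush]

lemma ballPush_of_le (hρ : 0 < ρ) (h : ρ ≤ ‖z - c‖) : ballPush c ρ v z = z := by
  have : 1 - ‖z - c‖ / ρ ≤ 0 := by
    rw [sub_nonpos, one_le_div hρ]; exact h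
  simp [ballPush, max_eq_left this]

lemma ballPush_mem_ball (hv : ‖v‖ < ρ) (h : ‖z - c‖ < ρ) : ‖ballPush c ρ v z - c‖ < ρ := by
  have hρ : 0 < ρ := (norm_nonneg v).trans_lt hv
  have h1 : 0 < 1 - ‖z - c‖ / ρ := by rw [sub_pos, div_lt_one hρ]; exact h
  have h2 : ballPush c ρ v z - c = (z - c) + ((1 - ‖z - c‖ / ρ : ℝ) : ℂ) * v := by
    rw [ballPush, max_eq_right h1.le]; ring
  rw [h2]
  refine (norm_add_le _ _).trans_lt ?_
  rw [norm_mul, Complex.norm_real, Real.norm_of_nonneg h1.le]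
  have h3 : (1 - ‖z - c‖ / ρ) * ‖v‖ < (1 - ‖z - c‖ / ρ) * ρ := mul_lt_mul_of_pos_left hv h1
  have h4 : (1 - ‖z - c‖ / ρ) * ρ = ρ - ‖z - c‖ := by field_simp
  linarith

lemma isPush_ballPush (hv : ‖v‖ < ρ) (hc : Metric.ball c ρ ⊆ N') : IsPush N' (ballPush c ρ v) := by
  have hρ : 0 < ρ := (norm_nonneg v).trans_lt hv
  refine ⟨by unfold ballPush; fun_prop, fun a b hab => ?_, fun z hz => ?_, fun z hz => ?_⟩
  · have h1 : ballPush c ρ v a - ballPush c ρ v b - (a - b) =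
        ((max 0 (1 - ‖a - c‖ / ρ) - max 0 (1 - ‖b - c‖ / ρ) : ℝ) : ℂ) * v := by
      simp only [ballPush]; push_cast; ring
    have h0 : 0 < ‖a - b‖ := norm_pos_iff.2 (sub_ne_zero.2 hab)
    have h2 : |max 0 (1 - ‖a - c‖ / ρ) - max 0 (1 - ‖b - c‖ / ρ)| ≤ ‖a - b‖ / ρ := by
      refine (abs_max_sub_max_le_max _ _ _ _).trans ?_
      rw [sub_self, abs_zero, max_eq_right (abs_nonneg _)]
      have : 1 - ‖a - c‖ / ρ - (1 - ‖b - c‖ / ρ) = (‖b - c‖ - ‖a - c‖) / ρ := by ring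
      rw [this, abs_div, abs_of_pos hρ]
      gcongr
      refine (abs_norm_sub_norm_le _ _).trans ?_
      rw [norm_sub_rev]
      apply le_of_eq; congr 1; ring
    rw [h1, norm_mul, Complex.norm_real, Real.norm_eq_abs]
    calc _ ≤ ‖a - b‖ / ρ * ‖v‖ := by gcongr
      _ < ‖a - b‖ / ρ * ρ := by gcongr
      _ = ‖a - b‖ := by field_simp
  · apply ballPush_of_le hρ
    by_contra h
    exact hz (hc (by rw [Metric.mem_ball, dist_eq_norm]; exact not_le.1 h))
  · by_cases h : ‖z - c‖ < ρ
    · exact hc (by rw [Metric.mem_ball, dist_eq_norm]; exact ballPush_mem_ball hv h)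
    · rwa [ballPush_of_le hρ (not_lt.1 h)]

/-- Pushing the values of a free map along a path that always moves forward. -/
lemma FreeMap.push_path (D : RetractionData X N N' V V' r R) (F : FreeMap X N N' V V' r f)
    {T : ℝ} (hT : 0 ≤ T) {β : ℝ → ℂ} (hβ : ContinuousOn β (Icc 0 T))
    (hm : MapsTo β (Icc 0 T) N')
    (hfwd : ∀ u ∈ Icc 0 T, ∀ v ∈ Icc 0 u, f (r (β u)) ≠ β v) {K : Set ℂ} (hK : K.Finite)
    (hKβ : ∀ u ∈ Icc 0 T, β u ∉ K) :
    ∃ f', FreeMap X N N' V V' r f' ∧ (∀ x ∈ X, f x = β 0 → f' x = β T) ∧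
      ∀ x ∈ X, f x ∈ K → f' x = f x := by
  have hB : IsCompact (β '' Icc 0 T) := isCompact_Icc.image_of_continuousOn hβ
  have hfr : ContinuousOn (fun w => f (r w)) N := F.cont.comp D.cont D.maps
  have hN := D.isOpen
  obtain ⟨c, hc, hcle⟩ : ∃ c > 0, ∀ u ∈ Icc 0 T, ∀ v ∈ Icc 0 u, c ≤ ‖f (r (β u)) - β v‖ := by
    have hS : IsCompact {p : ℝ × ℝ | p.1 ∈ Icc 0 T ∧ p.2 ∈ Icc 0 T ∧ p.2 ≤ p.1} := by
      have : {p : ℝ × ℝ | p.1 ∈ Icc 0 T ∧ p.2 ∈ Icc 0 T ∧ p.2 ≤ p.1} =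
          (Icc 0 T ×ˢ Icc 0 T) ∩ {p | p.2 ≤ p.1} := by
        ext p; simp only [mem_ofPred_eq, mem_inter_iff, mem_prod]; tauto
      rw [this]
      exact (isCompact_Icc.prod isCompact_Icc).inter_right
        (isClosed_le continuous_snd continuous_fst)
    have hcont : ContinuousOn (fun p : ℝ × ℝ => ‖f (r (β p.1)) - β p.2‖)
        {p : ℝ × ℝ | p.1 ∈ Icc 0 T ∧ p.2 ∈ Icc 0 T ∧ p.2 ≤ p.1} := by
      refine ContinuousOn.norm (ContinuousOn.sub ?_ ?_)
      · exact (hfr.comp hβ fun u hu => D.sub' (hm hu)).comp continuousOn_fst fun p hp => hp.1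
      · exact hβ.comp continuousOn_snd fun p hp => hp.2.1
    obtain ⟨p, hp, hmin⟩ := hS.exists_isMinOn
      ⟨(0, 0), ⟨left_mem_Icc.2 hT, left_mem_Icc.2 hT, le_refl _⟩⟩ hcont
    refine ⟨_, norm_pos_iff.2 (sub_ne_zero.2 (hfwd p.1 hp.1 p.2 ⟨hp.2.1.1, hp.2.2⟩)), ?_⟩
    intro u hu v hv
    exact hmin (show (u, v) ∈ _ from ⟨hu, ⟨hv.1, hv.2.trans hu.2⟩, hv.2⟩)
  obtain ⟨ρ, hρ, hρN, hρK, hρc, hρu⟩ : ∃ ρ > 0, (∀ u ∈ Icc 0 T, Metric.ball (β u) ρ ⊆ N') ∧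
      (∀ u ∈ Icc 0 T, ∀ k ∈ K, ρ ≤ ‖k - β u‖) ∧ ρ ≤ c / 2 ∧
      ∀ u ∈ Icc 0 T, ∀ w, ‖w - β u‖ < ρ → ‖f (r w) - f (r (β u))‖ < c / 2 := by
    obtain ⟨ρ1, h1, h1'⟩ := hB.exists_thickening_subset_open (D.isOpen'.inter hK.isClosed.isOpen_compl)
      (by rintro _ ⟨u, hu, rfl⟩; exact ⟨hm hu, hKβ u hu⟩)
    have hu := hB.uniformContinuousAt_of_continuousAt (fun w => f (r w))
      (by rintro _ ⟨u, hu, rfl⟩; exact hfr.continuousAt (hN.mem_nhds (D.sub' (hm hu))))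
      (Metric.dist_mem_uniformity (half_pos hc))
    obtain ⟨ρ2, h2, h2'⟩ := Metric.mem_uniformity_dist.1 hu
    have hball : ∀ u ∈ Icc 0 T, Metric.ball (β u) ρ1 ⊆ N' ∩ Kᶜ := fun u hu =>
      (Metric.ball_subset_thickening (mem_image_of_mem β hu) _).trans h1'
    refine ⟨min (min ρ1 ρ2) (c / 2), by positivity, fun u hu => ?_, fun u hu k hk => ?_,
      min_le_right _ _, fun u hu w hw => ?_⟩
    · exact (Metric.ball_subset_ball ((min_le_left _ _).trans (min_le_left _ _))).trans
        ((hball u hu).trans inter_subset_left)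
    · by_contra! h
      have : k ∈ Metric.ball (β u) ρ1 := by
        rw [Metric.mem_ball, dist_eq_norm]
        exact h.trans_le ((min_le_left _ _).trans (min_le_left _ _))
      exact (hball u hu this).2 hk
    · have h3 : dist (β u) w < ρ2 := by
        rw [dist_comm, dist_eq_norm]
        exact hw.trans_le ((min_le_left _ _).trans (min_le_right _ _))
      have := h2' h3 (mem_image_of_mem β hu)
      simp only [mem_ofPred_eq] at this
      rwa [dist_comm, dist_eq_norm] at this
  have huc := isCompact_Icc.uniformContinuousOn_of_continuous hβ
  obtain ⟨δ, hδ, hδu⟩ := Metric.uniformContinuousOn_iff.1 huc ρ hρ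
  obtain ⟨n, hn⟩ := exists_nat_gt (T / δ)
  have hn0 : (0 : ℝ) < n := (div_nonneg hT hδ.le).trans_lt hn
  set t : ℕ → ℝ := fun i => i * (T / n) with ht
  have htm : Monotone t := fun i j hij => by
    simp only [ht]; gcongr
  have htI : ∀ i ≤ n, t i ∈ Icc 0 T := fun i hi => by
    refine ⟨by positivity, (htm hi).trans_eq ?_⟩
    simp only [ht]; field_simp
  have main : ∀ i ≤ n, ∃ Φ : ℂ → ℂ, FreeMap X N N' V V' r (fun x => Φ (f x)) ∧
      Φ (β 0) = β (t i) ∧ (∀ k ∈ K, Φ k = k) ∧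
      ∀ z, Φ z = z ∨ ∃ b ∈ Icc 0 (t i), ∃ a ∈ Icc 0 b, ‖z - β a‖ < ρ ∧ ‖Φ z - β b‖ < ρ := by
    intro i
    induction i with
    | zero =>
      intro _
      exact ⟨id, F, by simp [ht], fun _ _ => rfl, fun z => Or.inl rfl⟩
    | succ i ih =>
      intro hi
      obtain ⟨Φ, h1, h2, h3, h4⟩ := ih (by omega)
      have hti := htI i (by omega)
      have hti' := htI (i + 1) hi
      have hle : t i ≤ t (i + 1) := htm (Nat.le_succ i)
      have hv : ‖β (t (i + 1)) - β (t i)‖ < ρ := by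
        rw [← dist_eq_norm]
        apply hδu _ hti' _ hti
        rw [Real.dist_eq]
        have : t (i + 1) - t i = T / n := by simp only [ht]; push_cast; ring
        rw [this, abs_of_nonneg (by positivity), div_lt_iff₀ hn0]
        rw [div_lt_iff₀ hδ] at hn
        linarith
      have hpush : IsPush N' (ballPush (β (t i)) ρ (β (t (i + 1)) - β (t i))) :=
        isPush_ballPush hv (hρN _ hti)
      have h5 : ∀ z, ballPush (β (t i)) ρ (β (t (i + 1)) - β (t i)) (Φ z) = z ∨
          ∃ b ∈ Icc 0 (t (i + 1)), ∃ a ∈ Icc 0 b, ‖z - β a‖ < ρ ∧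
            ‖ballPush (β (t i)) ρ (β (t (i + 1)) - β (t i)) (Φ z) - β b‖ < ρ := by
        intro z
        by_cases hz : ‖Φ z - β (t i)‖ < ρ
        · right
          refine ⟨t i, ⟨hti.1, hle⟩, ?_⟩
          have := ballPush_mem_ball hv hz
          rcases h4 z with h | ⟨b, hb, a, ha, h6, -⟩
          · rw [h] at hz this ⊢
            exact ⟨t i, right_mem_Icc.2 hti.1, hz, this⟩
          · exact ⟨a, ⟨ha.1, ha.2.trans hb.2⟩, h6, this⟩
        · rw [ballPush_of_le hρ (not_lt.1 hz)]
          rcases h4 z with h | ⟨b, hb, h⟩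
          · exact Or.inl h
          · exact Or.inr ⟨b, ⟨hb.1, hb.2.trans hle⟩, h⟩
      refine ⟨fun z => ballPush (β (t i)) ρ (β (t (i + 1)) - β (t i)) (Φ z),
        h1.push D hpush ?_, ?_, ?_, h5⟩
      · intro x hx hN' hr
        rcases h5 (f x) with h | ⟨b, hb, a, ha, h6, h7⟩
        · rw [h] at hN' hr
          exact F.free x hx hN' hr
        · have hbT : b ∈ Icc 0 T := ⟨hb.1, hb.2.trans hti'.2⟩
          have h8 := hρu b hbT _ h7
          rw [hr] at h8
          have h9 := hcle b hbT a ha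
          have : f (r (β b)) - β a = (f x - β a) - (f x - f (r (β b))) := by ring
          rw [this] at h9
          have := norm_sub_le (f x - β a) (f x - f (r (β b)))
          linarith
      · simp only [h2, ballPush_center]; ring
      · intro k hk
        simp only [h3 k hk]
        rw [ballPush_of_le hρ (hρK _ hti k hk)]
  obtain ⟨Φ, h1, h2, h3, -⟩ := main n le_rfl
  refine ⟨_, h1, fun x hx h => ?_, fun x hx h => h3 _ h⟩
  have : t n = T := by simp only [ht]; field_simp
  rw [h, h2, this]

end

section

/-- A path in `U` such that `G` sends no point of it to an earlier one. -/
structure ForwardPath (U : Set ℂ) (G : ℂ → ℂ) (T : ℝ) (β : ℝ → ℂ) : Prop where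
  nonneg : 0 ≤ T
  cont : ContinuousOn β (Icc 0 T)
  maps : MapsTo β (Icc 0 T) U
  fwd : ∀ u ∈ Icc 0 T, ∀ v ∈ Icc 0 u, G (β u) ≠ β v

lemma ForwardPath.trans {U : Set ℂ} {G : ℂ → ℂ} {S T : ℝ} {α β : ℝ → ℂ}
    (hα : ForwardPath U G S α) (hβ : ForwardPath U G T β) (h : α S = β 0)
    (hc : ∀ u ∈ Icc 0 T, ∀ v ∈ Icc 0 S, G (β u) ≠ α v) :
    ∃ c, ForwardPath U G (S + T) c ∧ c 0 = α 0 ∧ c (S + T) = β T ∧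
      ∀ u ∈ Icc 0 (S + T), (∃ s ∈ Icc 0 S, c u = α s) ∨ ∃ s ∈ Icc 0 T, c u = β s := by
  have hS := hα.nonneg
  have hT := hβ.nonneg
  have e1 : ∀ u, u ≤ S → (if u ≤ S then α u else β (u - S)) = α u := fun u hu => if_pos hu
  have e2 : ∀ u, S ≤ u → (if u ≤ S then α u else β (u - S)) = β (u - S) := by
    intro u hu
    split_ifs with h1
    · rw [le_antisymm h1 hu, h, sub_self]
    · rfl
  refine ⟨fun u => if u ≤ S then α u else β (u - S), ⟨by positivity, ?_, ?_, ?_⟩, e1 _ hS, ?_, ?_⟩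
  · have h1 : Icc 0 (S + T) = Icc 0 S ∪ Icc S (S + T) := (Icc_union_Icc_eq_Icc hS (by linarith)).symm
    rw [h1]
    refine ContinuousOn.union_of_isClosed ?_ ?_ isClosed_Icc isClosed_Icc
    · exact hα.cont.congr fun u hu => e1 u hu.2
    · refine ContinuousOn.congr (f := fun u => β (u - S)) ?_ fun u hu => e2 u hu.1
      exact hβ.cont.comp (by fun_prop) fun u hu => ⟨by linarith [hu.1], by linarith [hu.2]⟩
  · intro u hu
    rcases le_total u S with h1 | h1
    · simp only [e1 u h1]; exact hα.maps ⟨hu.1, h1⟩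
    · simp only [e2 u h1]; exact hβ.maps ⟨by linarith, by linarith [hu.2]⟩
  · intro u hu v hv
    rcases le_total u S with h1 | h1
    · simp only [e1 u h1, e1 v (hv.2.trans h1)]
      exact hα.fwd u ⟨hu.1, h1⟩ v hv
    · have hu' : u - S ∈ Icc 0 T := ⟨by linarith, by linarith [hu.2]⟩
      simp only [e2 u h1]
      rcases le_total v S with h2 | h2
      · simp only [e1 v h2]
        exact hc _ hu' v ⟨hv.1, h2⟩
      · simp only [e2 v h2]
        exact hβ.fwd _ hu' _ ⟨by linarith, by linarith [hv.2]⟩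
  · simp only [e2 (S + T) (by linarith)]
    congr 1; ring
  · intro u hu
    rcases le_total u S with h1 | h1
    · exact Or.inl ⟨u, ⟨hu.1, h1⟩, e1 u h1⟩
    · exact Or.inr ⟨u - S, ⟨by linarith, by linarith [hu.2]⟩, e2 u h1⟩

variable {X N N' V V' : Set ℂ} {r : ℂ → ℂ} {R : ℝ → ℂ → ℂ} {f : ℂ → ℂ}

/-- The points `z 0, …, z (n - 1)` of `V'` form a periodic orbit of `f`. -/
structure IsCycleIn (V' : Set ℂ) (f : ℂ → ℂ) (n : ℕ) (z : ℕ → ℂ) : Prop where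
  mem : ∀ i < n, z i ∈ V'
  step : ∀ i, i + 1 < n → f (z i) = z (i + 1)
  last : f (z (n - 1)) = z 0

/-- Closing up an orbit segment along a forward path. -/
lemma FreeMap.exists_cycle (D : RetractionData X N N' V V' r R) (F : FreeMap X N N' V V' r f)
    {T : ℝ} {β : ℝ → ℂ} (hβ : ForwardPath N' (fun w => f (r w)) T β) {n : ℕ} (hn : 0 < n)
    {z : ℕ → ℂ} (hz : ∀ i < n, z i ∈ V') (hs : ∀ i, i + 1 < n → f (z i) = z (i + 1))
    (h0 : f (z (n - 1)) = β 0) (hT : β T = z 0) :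
    ∃ f' m y, FreeMap X N N' V V' r f' ∧ 0 < m ∧ m ≤ n ∧ IsCycleIn V' f' m y := by
  have hZ : (z '' Iio n).Finite := (finite_Iio n).image _
  have hS : IsCompact (Icc 0 T ∩ β ⁻¹' (z '' Iio n)) :=
    isCompact_Icc.of_isClosed_subset
      (hβ.cont.preimage_isClosed_of_isClosed isClosed_Icc hZ.isClosed) inter_subset_left
  obtain ⟨u, hu, hmin⟩ := hS.exists_isLeast
    ⟨T, right_mem_Icc.2 hβ.nonneg, by rw [mem_preimage, hT]; exact ⟨0, hn, rfl⟩⟩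
  have hk' : ∃ k < n, β u = z k ∧ ∀ j < n, k < j → β u ≠ z j := by
    classical
    obtain ⟨k0, hk0, hk0'⟩ := hu.2
    have hne : ((Finset.range n).filter fun k => β u = z k).Nonempty :=
      ⟨k0, by simp only [Finset.mem_filter, Finset.mem_range]; exact ⟨hk0, hk0'.symm⟩⟩
    have h1 := Finset.max'_mem _ hne
    rw [Finset.mem_filter, Finset.mem_range] at h1
    refine ⟨_, h1.1, h1.2, fun j hj hlt he => ?_⟩
    exact absurd hlt (not_lt.2 (Finset.le_max' _ _ (by
      rw [Finset.mem_filter, Finset.mem_range]; exact ⟨hj, he⟩)))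
  obtain ⟨k, hk, hku, hkm⟩ := hk'
  have hsub : Icc 0 u ⊆ Icc 0 T := Icc_subset_Icc_right hu.1.2
  obtain ⟨f', F', h1, h2⟩ := F.push_path D hu.1.1 (hβ.cont.mono hsub) (hβ.maps.mono_left hsub)
    (fun a ha b hb => hβ.fwd a (hsub ha) b hb) (K := z '' Ioo k n) ((finite_Ioo k n).image _) (by
      rintro a ha ⟨j, hj, hja⟩
      have h3 : u ≤ a := hmin ⟨hsub ha, by rw [mem_preimage, ← hja]; exact ⟨j, hj.2, rfl⟩⟩
      have h4 : a = u := le_antisymm ha.2 h3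
      subst h4
      exact hkm j hj.2 hj.1 hja.symm)
  have hX : ∀ i < n, z i ∈ X := fun i hi => D.subX (D.subV (hz i hi))
  refine ⟨f', n - k, fun i => z (k + i), F', by omega, by omega, fun i hi => hz _ (by omega), ?_, ?_⟩
  · intro i hi
    have h3 : f (z (k + i)) = z (k + (i + 1)) := hs (k + i) (by omega)
    rw [← h3]
    apply h2 _ (hX _ (by omega))
    rw [h3]
    exact ⟨_, ⟨by omega, by omega⟩, rfl⟩
  · have h3 : k + (n - k - 1) = n - 1 := by omega
    simp only [h3, add_zero, ← hku]
    exact h1 _ (hX _ (by omega)) h0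

lemma ForwardPath.of_const {U : Set ℂ} {G : ℂ → ℂ} {β : ℝ → ℂ} {y : ℂ}
    (hβ : ContinuousOn β (Icc 0 1)) (hm : MapsTo β (Icc 0 1) U) (h : ∀ u ∈ Icc (0 : ℝ) 1, G (β u) = y)
    (hy : ∀ u ∈ Icc (0 : ℝ) 1, y ≠ β u) : ForwardPath U G 1 β :=
  ⟨zero_le_one, hβ, hm, fun u hu v hv => by rw [h u hu]; exact hy v ⟨hv.1, hv.2.trans hu.2⟩⟩

/-- A chain `γ a ↦ x ↦ γ b` of two steps, up to fibres of `r`, with both ends on an arc whose only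
hits involve its endpoint, can be closed up to an orbit of period two. -/
lemma FreeMap.no_two_chain (D : RetractionData X N N' V V' r R) (F : FreeMap X N N' V V' r f)
    {t : ℝ} {γ : ℝ → ℂ} (hγ : ContinuousOn γ (Icc 0 t)) (hγV : MapsTo γ (Icc 0 t) V')
    (hit : ∀ u ∈ Icc 0 t, ∀ v ∈ Icc 0 t, r (f (γ u)) = γ v → u = t ∨ v = t)
    {a b : ℝ} (ha : a ∈ Icc 0 t) (hb : b ∈ Icc 0 t) {x : ℂ} (hx : r (f (γ a)) = x)
    {J : ℝ → ℂ} (hJ : ContinuousOn J (Icc 0 1)) (hJN : MapsTo J (Icc 0 1) N')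
    (hJ0 : J 0 = f x) (hJ1 : J 1 = γ b) (hJr : ∀ s ∈ Icc (0 : ℝ) 1, r (J s) = γ b)
    (hJf : ∀ u ∈ Icc 0 t, ∀ s ∈ Icc (0 : ℝ) 1, f (γ u) = J s → f (γ u) = f x) : False := by
  have h01 : (0 : ℝ) ∈ Icc (0 : ℝ) 1 := left_mem_Icc.2 zero_le_one
  have h11 : (1 : ℝ) ∈ Icc (0 : ℝ) 1 := right_mem_Icc.2 zero_le_one
  have hγX : ∀ u ∈ Icc 0 t, γ u ∈ X := fun u hu => D.subX (D.subV (hγV hu))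
  have hfγ : ∀ u ∈ Icc 0 t, f (γ u) ∈ N' := fun u hu => F.mapsV' (hγV hu)
  have hrγ : ∀ u ∈ Icc 0 t, r (γ u) = γ u := fun u hu => D.fix _ (hγX u hu)
  have hfree : ∀ u ∈ Icc 0 t, r (f (γ u)) ≠ γ u := fun u hu =>
    F.free _ (hγX u hu) (D.sub' (hfγ u hu))
  have hxX : x ∈ X := hx ▸ D.maps (D.sub' (hfγ a ha))
  have hfx : f x ∈ N' := hJ0 ▸ hJN h01
  have hrx : r (f x) = γ b := hJ0 ▸ hJr 0 h01
  have hbx : γ b ≠ x := hrx ▸ F.free x hxX (D.sub' hfx)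
  have hax : γ a ≠ x := fun h => hfree a ha (hx.trans h.symm)
  have hcx : ∀ c ∈ uIcc b a, γ c ≠ x := by
    intro c hc h
    have hcI : c ∈ Icc 0 t := by
      rw [mem_uIcc] at hc
      constructor
      · rcases hc with hc | hc
        · exact hb.1.trans hc.1
        · exact ha.1.trans hc.1
      · rcases hc with hc | hc
        · exact hc.2.trans ha.2
        · exact hc.2.trans hb.2
    have h1 := hit a ha c hcI (hx.trans h.symm)
    have h2 := hit c hcI b hb (by rw [h, hrx])
    have h3 : c = a ∨ c = b := by
      rw [mem_uIcc] at hc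
      by_contra! h4
      have h5 : c < t := by
        rcases hc with hc | hc
        · exact (lt_of_le_of_ne hc.2 h4.1).trans_le ha.2
        · exact (lt_of_le_of_ne hc.2 h4.2).trans_le hb.2
      have h6 : a = t := h1.resolve_right h5.ne
      have h7 : b = t := h2.resolve_left h5.ne
      rcases hc with hc | hc
      · exact absurd hc.1 (not_le.2 (h7 ▸ h5))
      · exact absurd hc.1 (not_le.2 (h6 ▸ h5))
    rcases h3 with rfl | rfl
    · exact hax h
    · exact hbx h
  have hinj : ∀ c ∈ Icc 0 t, f (γ c) = f x → γ c = x := fun c hc h => F.inj (hγX c hc) hxX h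
  have hline : ∀ u ∈ Icc (0 : ℝ) 1, b + u * (a - b) ∈ uIcc b a := by
    intro u hu
    rw [mem_uIcc]
    rcases le_total b a with h | h
    · left; constructor <;> nlinarith [hu.1, hu.2]
    · right; constructor <;> nlinarith [hu.1, hu.2]
  have hsub : uIcc b a ⊆ Icc 0 t := uIcc_subset_Icc hb ha
  have P1 : ForwardPath N' (fun w => f (r w)) 1 J := by
    refine ForwardPath.of_const hJ hJN (y := f (γ b)) (fun u hu => by rw [hJr u hu]) fun u hu h => ?_
    exact hbx (hinj b hb (hJf b hb u hu h))
  have P2 : ForwardPath N' (fun w => f (r w)) 1 (fun u => γ (b + u * (a - b))) := by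
    refine ⟨zero_le_one, hγ.comp (by fun_prop) fun u hu => hsub (hline u hu),
      fun u hu => D.sub (hγX _ (hsub (hline u hu))), fun u hu v hv h => ?_⟩
    have hv1 : v ∈ Icc (0 : ℝ) 1 := ⟨hv.1, hv.2.trans hu.2⟩
    have hc := hline u hu
    have hd := hline v hv1
    simp only [hrγ _ (hsub hc)] at h
    have hh : r (f (γ (b + u * (a - b)))) = γ (b + v * (a - b)) := by rw [h, hrγ _ (hsub hd)]
    rcases le_total b a with hba | hba
    · have h1 : b + u * (a - b) = t := by
        have hle : b + v * (a - b) ≤ b + u * (a - b) := by nlinarith [hv.2]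
        rcases hit _ (hsub hc) _ (hsub hd) hh with h1 | h1
        · exact h1
        · exact le_antisymm (hsub hc).2 (h1 ▸ hle)
      have h2 : b + u * (a - b) = a := by
        rw [uIcc_of_le hba] at hc
        exact le_antisymm hc.2 (h1 ▸ ha.2)
      rw [h2, hx] at hh
      exact hcx _ hd hh.symm
    · have h1 : b + v * (a - b) = t := by
        have hle : b + u * (a - b) ≤ b + v * (a - b) := by nlinarith [hv.2]
        rcases hit _ (hsub hc) _ (hsub hd) hh with h1 | h1
        · exact le_antisymm (hsub hd).2 (h1 ▸ hle)
        · exact h1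
      have h2 : b + v * (a - b) = b := by
        rw [uIcc_of_ge hba] at hd
        exact le_antisymm hd.2 (h1 ▸ hb.2)
      rw [h2, ← hJ1] at h
      exact hcx _ hc (hinj _ (hsub hc) (hJf _ (hsub hc) 1 h11 h))
  obtain ⟨β, hβ, hβ0, hβ1, hβm⟩ := P1.trans P2 (by simp [hJ1]) (by
    intro u hu v hv h
    have hc := hline u hu
    simp only [hrγ _ (hsub hc)] at h
    exact hcx _ hc (hinj _ (hsub hc) (hJf _ (hsub hc) v hv h)))
  obtain ⟨f', F', h1, h2⟩ := F.push_path D hβ.nonneg hβ.cont hβ.maps hβ.fwd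
    (finite_singleton (f (γ a))) (by
      intro u hu h
      rw [mem_singleton_iff] at h
      rcases hβm u hu with ⟨s, hs, h'⟩ | ⟨s, hs, h'⟩
      · exact hax (hinj a ha (hJf a ha s hs (h.symm.trans h')))
      · have h3 := h.symm.trans h'
        have hc := hline s hs
        have : r (f (γ a)) = γ (b + s * (a - b)) := by rw [h3, hrγ _ (hsub hc)]
        exact hcx _ hc (this.symm.trans hx))
  have e1 : f' x = γ a := by
    rw [h1 x hxX (hJ0.symm.trans hβ0.symm), hβ1]; congr 1; ring
  have e2 : f' (γ a) = f (γ a) := h2 _ (hγX a ha) rfl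
  have hw := D.sub' (hfγ a ha)
  have hRN : ∀ u ∈ Icc (0 : ℝ) 1, R u (f (γ a)) ∈ N' := fun u hu => D.mapsR u hu _ (hfγ a ha)
  have hne : ∀ u ∈ Icc (0 : ℝ) 1, γ a ≠ R u (f (γ a)) := by
    intro u hu h
    have := D.fibre u hu _ hw
    rw [← h, hrγ a ha, hx] at this
    exact hax this
  have P3 : ForwardPath N' (fun w => f' (r w)) 1 (fun u => R u (f (γ a))) := by
    refine ForwardPath.of_const (D.contR.comp (f := fun u => (u, f (γ a))) (by fun_prop) fun u hu => ⟨hu, hw⟩)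
      hRN (y := γ a) (fun u hu => ?_) hne
    simp only [D.fibre u hu _ hw, hx, e1]
  obtain ⟨f'', F'', h3, h4⟩ := F'.push_path D P3.nonneg P3.cont P3.maps P3.fwd
    (finite_singleton (γ a)) (fun u hu h => hne u hu (mem_singleton_iff.1 h).symm)
  refine F''.no_two_cycle D (F.source x hxX hfx) (D.subV (hγV ha)) ((h4 x hxX e1).trans e1) ?_
  rw [h3 _ (hγX a ha) (by rw [e2, D.zero _ hw]), D.one _ hw, hx]

end

section

variable {X N N' V V' : Set ℂ} {r : ℂ → ℂ} {R : ℝ → ℂ → ℂ} {f : ℂ → ℂ}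

lemma IsCompact.setOf_eq {A B : Type*} [TopologicalSpace A] [T2Space A] [TopologicalSpace B]
    [T2Space B] {S : Set A} (hS : IsCompact S) {g h : A → B} (hg : ContinuousOn g S)
    (hh : ContinuousOn h S) : IsCompact {x | x ∈ S ∧ g x = h x} :=
  hS.of_isClosed_subset ((hg.prodMk hh).preimage_isClosed_of_isClosed hS.isClosed isClosed_diagonal)
    fun _ hx => hx.1

/-- A point of `V'` is joined to its image by a forward path. -/
lemma FreeMap.exists_forwardPath (D : RetractionData X N N' V V' r R)
    (F : FreeMap X N N' V V' r f) {x : ℂ} (hxV : x ∈ V') (hyV : f x ∈ V') :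
    ∃ T β, ForwardPath N' (fun w => f (r w)) T β ∧ β 0 = x ∧ β T = f x := by
  obtain ⟨γ, hγ, hγV, hγ0, hγ1⟩ := D.path x hxV (f x) hyV
  have hγX : ∀ u ∈ Icc (0 : ℝ) 1, γ u ∈ X := fun u hu => D.subX (D.subV (hγV hu))
  have hfγ : ∀ u ∈ Icc (0 : ℝ) 1, f (γ u) ∈ N' := fun u hu => F.mapsV' (hγV hu)
  have hfγc : ContinuousOn (fun u => f (γ u)) (Icc 0 1) := F.cont.comp hγ hγX
  have hrfγc : ContinuousOn (fun u => r (f (γ u))) (Icc 0 1) :=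
    D.cont.comp hfγc fun u hu => D.sub' (hfγ u hu)
  have hrγ : ∀ u ∈ Icc (0 : ℝ) 1, r (γ u) = γ u := fun u hu => D.fix _ (hγX u hu)
  have hH : IsCompact {p : ℝ × ℝ | p ∈ Icc (0 : ℝ) 1 ×ˢ Icc (0 : ℝ) 1 ∧ r (f (γ p.1)) = γ p.2} :=
    (isCompact_Icc.prod isCompact_Icc).setOf_eq (hrfγc.comp continuousOn_fst fun p hp => hp.1)
      (hγ.comp continuousOn_snd fun p hp => hp.2)
  obtain ⟨⟨p0, q⟩, ⟨⟨hp0, hq⟩, hpq0⟩, hmin⟩ := hH.exists_isMinOn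
    (f := fun p : ℝ × ℝ => max p.1 p.2)
    ⟨(0, 1), ⟨⟨left_mem_Icc.2 zero_le_one, right_mem_Icc.2 zero_le_one⟩, by
      simp only [hγ0, hγ1]; exact D.fix _ (D.subX (D.subV hyV))⟩⟩ (by fun_prop)
  simp only at hp0 hq hpq0
  set t := max p0 q with htdef
  have ht1 : t ≤ 1 := max_le hp0.2 hq.2
  have hsub : Icc 0 t ⊆ Icc (0 : ℝ) 1 := Icc_subset_Icc_right ht1
  have hp0t : p0 ∈ Icc 0 t := ⟨hp0.1, le_max_left _ _⟩
  have hqt : q ∈ Icc 0 t := ⟨hq.1, le_max_right _ _⟩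
  have hit : ∀ u ∈ Icc 0 t, ∀ v ∈ Icc 0 t, r (f (γ u)) = γ v → u = t ∨ v = t := by
    intro u hu v hv h
    have h1 : t ≤ max u v := hmin (show (u, v) ∈ _ from ⟨⟨hsub hu, hsub hv⟩, h⟩)
    rcases le_max_iff.1 h1 with h2 | h2
    · exact Or.inl (le_antisymm hu.2 h2)
    · exact Or.inr (le_antisymm hv.2 h2)
  have hw := D.sub' (hfγ p0 hp0)
  set w := f (γ p0) with hwdef
  have hRc : ContinuousOn (fun s => R s w) (Icc 0 1) :=
    D.contR.comp (f := fun s => (s, w)) (by fun_prop) fun s hs => ⟨hs, hw⟩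
  have hS : IsCompact (Icc 0 1 ∩ (fun s => R s w) ⁻¹' ((fun u => f (γ u)) '' Icc 0 t)) :=
    isCompact_Icc.of_isClosed_subset (hRc.preimage_isClosed_of_isClosed isClosed_Icc
      (isCompact_Icc.image_of_continuousOn (hfγc.mono hsub)).isClosed) inter_subset_left
  obtain ⟨σ, ⟨hσ, ⟨p, hp, hpσ⟩⟩, hσmax⟩ := hS.exists_isGreatest
    ⟨0, left_mem_Icc.2 zero_le_one, p0, hp0t, (D.zero w hw).symm⟩
  simp only at hpσ
  have hpq : r (f (γ p)) = γ q := by rw [hpσ, D.fibre σ hσ w hw, hpq0]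
  have hpqt := hit p hp q hqt hpq
  obtain ⟨J, hJ⟩ : ∃ J : ℝ → ℂ, J = fun s => R (σ + s * (1 - σ)) w := ⟨_, rfl⟩
  have hlin : ∀ s ∈ Icc (0 : ℝ) 1, σ + s * (1 - σ) ∈ Icc (0 : ℝ) 1 := by
    intro s hs
    constructor <;> nlinarith [hs.1, hs.2, hσ.1, hσ.2]
  have hJc : ContinuousOn J (Icc 0 1) := by
    rw [hJ]; exact hRc.comp (f := fun s => σ + s * (1 - σ)) (by fun_prop) hlin
  have hJN : MapsTo J (Icc 0 1) N' := by
    intro s hs; rw [hJ]; exact D.mapsR _ (hlin s hs) _ (hfγ p0 hp0)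
  have hJ0 : J 0 = f (γ p) := by simp [hJ, hpσ]
  have hJ1 : J 1 = γ q := by simp [hJ, D.one w hw, hpq0]
  have hJr : ∀ s ∈ Icc (0 : ℝ) 1, r (J s) = γ q := by
    intro s hs; rw [hJ]; simp only [D.fibre _ (hlin s hs) w hw, hpq0]
  have hJf : ∀ u ∈ Icc 0 t, ∀ s ∈ Icc (0 : ℝ) 1, f (γ u) = J s → ∀ s' ∈ Icc 0 s, J s' = J s := by
    intro u hu s hs h s' hs'
    have h1 : σ + s * (1 - σ) ≤ σ := hσmax ⟨hlin s hs, u, hu, by rw [hJ] at h; exact h⟩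
    have h2 : s' * (1 - σ) = s * (1 - σ) := by nlinarith [hs'.1, hs'.2, hs.1, hσ.2]
    simp only [hJ, h2]
  have hJf0 : ∀ u ∈ Icc 0 t, ∀ s ∈ Icc (0 : ℝ) 1, f (γ u) = J s → γ u = γ p := by
    intro u hu s hs h
    have h1 := hJf u hu s hs h 0 ⟨le_rfl, hs.1⟩
    rw [← h, hJ0] at h1
    exact F.inj (hγX u (hsub hu)) (hγX p (hsub hp)) h1.symm
  have hfree : ∀ u ∈ Icc 0 t, r (f (γ u)) ≠ γ u := fun u hu =>
    F.free _ (hγX u (hsub hu)) (D.sub' (hfγ u (hsub hu)))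
  have hγt := hγ.mono hsub
  have hγVt : MapsTo γ (Icc 0 t) V' := hγV.mono_left hsub
  -- two steps whose second step ends on the arc
  have chain : ∀ a ∈ Icc 0 t, ∀ d ∈ Icc 0 t, f (r (f (γ a))) ≠ γ d := by
    intro a ha d hd h
    exact F.no_two_chain D hγt hγVt hit ha hd rfl (J := fun _ => γ d) continuousOn_const
      (fun _ _ => D.sub (hγX d (hsub hd))) h.symm rfl (fun _ _ => hrγ d (hsub hd))
      fun u hu s hs h' => h'.trans h.symm
  have chainJ : ∀ a ∈ Icc 0 t, ∀ s ∈ Icc (0 : ℝ) 1, f (r (f (γ a))) ≠ J s := by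
    intro a ha s hs h
    have hlin' : ∀ τ ∈ Icc (0 : ℝ) 1, s + τ * (1 - s) ∈ Icc s 1 := by
      intro τ hτ
      constructor <;> nlinarith [hs.1, hs.2, hτ.1, hτ.2]
    have hlin2 : ∀ τ ∈ Icc (0 : ℝ) 1, s + τ * (1 - s) ∈ Icc (0 : ℝ) 1 := fun τ hτ =>
      ⟨hs.1.trans (hlin' τ hτ).1, (hlin' τ hτ).2⟩
    refine F.no_two_chain D hγt hγVt hit ha hqt rfl (J := fun τ => J (s + τ * (1 - s)))
      (hJc.comp (by fun_prop) hlin2) (fun τ hτ => hJN (hlin2 τ hτ)) (by simp [h]) (by simp [hJ1])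
      (fun τ hτ => hJr _ (hlin2 τ hτ)) fun u hu τ hτ h' => ?_
    have h1 := hJf u hu _ (hlin2 τ hτ) h' s ⟨hs.1, (hlin' τ hτ).1⟩
    rw [h', ← h1, h]
  have hqI : ∀ s ∈ Icc (0 : ℝ) 1, s * q ∈ Icc 0 t := fun s hs =>
    ⟨mul_nonneg hs.1 hqt.1, (mul_le_of_le_one_left hqt.1 hs.2).trans hqt.2⟩
  have hrev : ∀ s ∈ Icc (0 : ℝ) 1, 1 - s ∈ Icc (0 : ℝ) 1 := fun s hs =>
    ⟨by linarith [hs.2], by linarith [hs.1]⟩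
  have hpI : ∀ s ∈ Icc (0 : ℝ) 1, (1 - s) * p ∈ Icc 0 t := fun s hs =>
    ⟨mul_nonneg (hrev s hs).1 hp.1, (mul_le_of_le_one_left hp.1 (hrev s hs).2).trans hp.2⟩
  have P1 : ForwardPath N' (fun w => f (r w)) 1 (fun s => γ (s * q)) := by
    refine ⟨zero_le_one, hγt.comp (by fun_prop) hqI, fun s hs => D.sub (hγX _ (hsub (hqI s hs))),
      fun u hu v hv h => ?_⟩
    have hv1 : v ∈ Icc (0 : ℝ) 1 := ⟨hv.1, hv.2.trans hu.2⟩
    simp only [hrγ _ (hsub (hqI u hu))] at h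
    have h1 : u * q = t := by
      have hle : v * q ≤ u * q := mul_le_mul_of_nonneg_right hv.2 hqt.1
      rcases hit _ (hqI u hu) _ (hqI v hv1) (by rw [h, hrγ _ (hsub (hqI v hv1))]) with h1 | h1
      · exact h1
      · exact le_antisymm (hqI u hu).2 (h1 ▸ hle)
    have h2 : u * q = q := le_antisymm (mul_le_of_le_one_left hqt.1 hu.2) (h1 ▸ hqt.2)
    rw [h2, ← hpq] at h
    exact chain p hp _ (hqI v hv1) h
  have P2 : ForwardPath N' (fun w => f (r w)) 1 (fun s => J (1 - s)) := by
    refine ForwardPath.of_const (hJc.comp (by fun_prop) hrev) (fun s hs => hJN (hrev s hs))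
      (y := f (γ q)) (fun s hs => by simp only [hJr _ (hrev s hs)]) fun s hs h => ?_
    have h1 := hJf0 q hqt _ (hrev s hs) h
    have h2 := hfree q hqt
    rw [h1, hpq] at h2
    exact h2 h1
  have P3 : ForwardPath N' (fun w => f (r w)) 1 (fun s => f (γ ((1 - s) * p))) := by
    refine ⟨zero_le_one, hfγc.comp (by fun_prop) fun s hs => hsub (hpI s hs),
      fun s hs => hfγ _ (hsub (hpI s hs)), fun u hu v hv h => ?_⟩
    have hv1 : v ∈ Icc (0 : ℝ) 1 := ⟨hv.1, hv.2.trans hu.2⟩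
    have ha := hpI u hu
    have ha' := hpI v hv1
    have h0 : r (f (γ ((1 - u) * p))) = γ ((1 - v) * p) :=
      F.inj (D.maps (D.sub' (hfγ _ (hsub ha)))) (hγX _ (hsub ha')) h
    have hle : (1 - u) * p ≤ (1 - v) * p :=
      mul_le_mul_of_nonneg_right (by linarith [hv.2]) hp.1
    have h1 : (1 - v) * p = t := by
      rcases hit _ ha _ ha' h0 with h1 | h1
      · exact le_antisymm ha'.2 (h1 ▸ hle)
      · exact h1
    have h2 : (1 - v) * p = p :=
      le_antisymm (mul_le_of_le_one_left hp.1 (hrev v hv1).2) (h1 ▸ hp.2)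
    rw [h0, h2, ← hJ0] at h
    refine chainJ _ ha 0 (left_mem_Icc.2 zero_le_one) ?_
    rw [h0, h2, hJ0]
  obtain ⟨β, hβ, hβ0, hβ1, hβm⟩ := P1.trans P2 (by simp [hJ1]) (by
    intro u hu v hv h
    simp only [hJr _ (hrev u hu), ← hpq] at h
    exact chain p hp _ (hqI v hv) h)
  obtain ⟨β', hβ', hβ0', hβ1', -⟩ := hβ.trans P3 (by simp [hβ1, hJ0]) (by
    intro u hu v hv h
    rcases hβm v hv with ⟨s, hs, h'⟩ | ⟨s, hs, h'⟩
    · exact chain _ (hpI u hu) _ (hqI s hs) (h.trans h')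
    · exact chainJ _ (hpI u hu) _ (hrev s hs) (h.trans h'))
  refine ⟨_, β', hβ', ?_, ?_⟩
  · rw [hβ0', hβ0]; simp [hγ0]
  · rw [hβ1']; simp [hγ0]

/-- A free map has no periodic orbit. -/
theorem FreeMap.no_cycle (D : RetractionData X N N' V V' r R) {n : ℕ} (hn : 0 < n) :
    ∀ {f : ℂ → ℂ}, FreeMap X N N' V V' r f → ∀ {z : ℕ → ℂ}, ¬ IsCycleIn V' f n z := by
  induction n using Nat.strong_induction_on with
  | _ n ih =>
  intro f F z hz
  obtain rfl | hn2 : n = 1 ∨ 2 ≤ n := by omega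
  · have h0 := hz.mem 0 zero_lt_one
    have h1 := hz.last
    simp only [le_refl, tsub_eq_zero_of_le] at h1
    refine F.free _ (D.subX (D.subV h0)) ?_ ?_
    · rw [h1]; exact D.sub' (D.sub (D.subX (D.subV h0)))
    · rw [h1]; exact D.fix _ (D.subX (D.subV h0))
  · have h1 := hz.step 0 (by omega)
    rw [zero_add] at h1
    obtain ⟨T, β, hβ, h2, h3⟩ := F.exists_forwardPath D (hz.mem 0 (by omega))
      (h1 ▸ hz.mem 1 (by omega))
    obtain ⟨f', m, y, F', hm, hmn, hy⟩ := F.exists_cycle D hβ (n := n - 1) (by omega)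
      (z := fun i => z (i + 1)) (fun i hi => hz.mem _ (by omega))
      (fun i hi => hz.step _ (by omega)) (by
        have : n - 1 - 1 + 1 = n - 1 := by omega
        simp only [this]
        rw [hz.last, h2]) (by rw [h3, h1])
    exact ih m (by omega) hm F' hy

end

section

variable {X N N' V V' : Set ℂ} {r : ℂ → ℂ} {R : ℝ → ℂ → ℂ} {f : ℂ → ℂ}

/-- A free map has no infinite orbit in `V'`. -/
theorem FreeMap.exists_iterate_notMem (D : RetractionData X N N' V V' r R)
    (F : FreeMap X N N' V V' r f) (x : ℂ) : ∃ n : ℕ, f^[n] x ∉ V' := by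
  by_contra! hx
  have hX : ∀ n, f^[n] x ∈ X := fun n => D.subX (D.subV (hx n))
  obtain ⟨p, hp, φ, hφ, hlim⟩ := D.compact.tendsto_subseq hX
  have hXN' := D.sub hp
  have hpN := D.sub' hXN'
  have hfp : f p ≠ p := fun h => F.free p hp (by rw [h]; exact hpN) (by rw [h]; exact D.fix p hp)
  set c := ‖f p - p‖ with hc
  have hc0 : 0 < c := norm_pos_iff.2 (sub_ne_zero.2 hfp)
  have hcont : ContinuousAt (fun w => f (r w)) p :=
    (F.cont.comp D.cont D.maps).continuousAt (D.isOpen.mem_nhds hpN)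
  obtain ⟨ρ1, h1, h1'⟩ := Metric.isOpen_iff.1 D.isOpen' p hXN'
  obtain ⟨ρ2, h2, h2'⟩ := Metric.continuousAt_iff.1 hcont (c / 2) (half_pos hc0)
  set ρ := min (min ρ1 ρ2) (c / 2) with hρ
  have hρ0 : 0 < ρ := by positivity
  have hev := hlim.eventually (Metric.ball_mem_nhds p hρ0)
  obtain ⟨n0, hn0⟩ := eventually_atTop.1 hev
  set i := φ n0 with hi
  set j := φ (n0 + 1) with hj
  have hij : i < j := hφ (Nat.lt_succ_self n0)
  have hbi : f^[i] x ∈ Metric.ball p ρ := hn0 n0 le_rfl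
  have hbj : f^[j] x ∈ Metric.ball p ρ := hn0 (n0 + 1) (Nat.le_succ _)
  have hseg : ∀ u ∈ Icc (0 : ℝ) 1, AffineMap.lineMap (f^[j] x) (f^[i] x) u ∈ Metric.ball p ρ :=
    fun u hu => (convex_ball p ρ).segment_subset hbj hbi
      (segment_eq_image_lineMap ℝ (f^[j] x) (f^[i] x) ▸ mem_image_of_mem _ hu)
  have hβ : ForwardPath N' (fun w => f (r w)) 1
      (fun u => AffineMap.lineMap (f^[j] x) (f^[i] x) u) := by
    refine ⟨zero_le_one, AffineMap.lineMap_continuous.continuousOn, fun u hu => h1'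
      (Metric.ball_subset_ball ((min_le_left _ _).trans (min_le_left _ _)) (hseg u hu)), ?_⟩
    intro u hu v hv h
    have h3 := hseg u hu
    have h4 := hseg v ⟨hv.1, hv.2.trans hu.2⟩
    have h5 := h2' ((Metric.mem_ball.1 h3).trans_le ((min_le_left _ _).trans (min_le_right _ _)))
    simp only [h, D.fix p hp] at h5
    have h6 : dist (f p) p < c := by
      calc dist (f p) p ≤ dist (f p) (AffineMap.lineMap (f^[j] x) (f^[i] x) v) +
            dist (AffineMap.lineMap (f^[j] x) (f^[i] x) v) p := dist_triangle _ _ _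
        _ < c / 2 + c / 2 := by
          refine add_lt_add ?_ ?_
          · rw [dist_comm]; exact h5
          · exact (Metric.mem_ball.1 h4).trans_le (min_le_right _ _)
        _ = c := add_halves c
    rw [dist_eq_norm] at h6
    exact lt_irrefl _ h6
  obtain ⟨f', m, y, F', hm, -, hy⟩ := F.exists_cycle D hβ (n := j - i) (by omega)
    (z := fun k => f^[i + k] x) (fun k _ => hx _) (fun k _ => by
      rw [← Function.iterate_succ_apply' f]; rfl) (by
      rw [← Function.iterate_succ_apply' f, AffineMap.lineMap_apply_zero]
      congr 2; omega) (by simp)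
  exact FreeMap.no_cycle D hm F' hy

end

section

/-- A neighbourhood basis `N η` of `X`, with a common retraction `r` onto `X` and a deformation
`R` of the identity to `r` along the fibres of `r`. -/
structure Collar (X : Set ℂ) (N : ℝ → Set ℂ) (r : ℂ → ℂ) (R : ℝ → ℂ → ℂ) : Prop where
  isOpen : ∀ η ∈ Ioo (0 : ℝ) 1, IsOpen (N η)
  sub : ∀ η ∈ Ioo (0 : ℝ) 1, X ⊆ N η
  basis : ∀ U, IsOpen U → X ⊆ U → ∃ η ∈ Ioo (0 : ℝ) 1, N η ⊆ U
  cont : ∀ η ∈ Ioo (0 : ℝ) 1, ContinuousOn r (N η)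
  maps : ∀ η ∈ Ioo (0 : ℝ) 1, MapsTo r (N η) X
  fix : ∀ x ∈ X, r x = x
  contR : ∀ η ∈ Ioo (0 : ℝ) 1, ContinuousOn (fun p : ℝ × ℂ => R p.1 p.2) (Icc 0 1 ×ˢ N η)
  zero : ∀ η ∈ Ioo (0 : ℝ) 1, ∀ w ∈ N η, R 0 w = w
  one : ∀ η ∈ Ioo (0 : ℝ) 1, ∀ w ∈ N η, R 1 w = r w
  fibre : ∀ η ∈ Ioo (0 : ℝ) 1, ∀ s ∈ Icc (0 : ℝ) 1, ∀ w ∈ N η, r (R s w) = r w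
  mapsR : ∀ η ∈ Ioo (0 : ℝ) 1, ∀ s ∈ Icc (0 : ℝ) 1, ∀ w ∈ N η, R s w ∈ N η
  fixR : ∀ s ∈ Icc (0 : ℝ) 1, ∀ x ∈ X, R s x = x

variable {X : Set ℂ} {f : ℂ → ℂ} {H : ℝ → ℂ → ℂ}

lemma exists_rotation {N : Set ℂ} {r : ℂ → ℂ} {R : ℝ → ℂ → ℂ} (hXN : X ⊆ N)
    (hr : ContinuousOn r N) (hrX : MapsTo r N X) (hfix : ∀ x ∈ X, r x = x)
    (hR : ContinuousOn (fun p : ℝ × ℂ => R p.1 p.2) (Icc 0 1 ×ˢ N))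
    (hR0 : ∀ w ∈ N, R 0 w = w) (hR1 : ∀ w ∈ N, R 1 w = r w)
    (hRr : ∀ s ∈ Icc (0 : ℝ) 1, ∀ w ∈ N, r (R s w) = r w)
    (hRX : ∀ s ∈ Icc (0 : ℝ) 1, ∀ x ∈ X, R s x = x)
    (hH : ContinuousOn (fun p : ℝ × ℂ => H p.1 p.2) (Icc 0 1 ×ˢ X))
    (hH0 : ∀ x ∈ X, H 0 x = x) (hH1 : ∀ x ∈ X, H 1 x = f x)
    (hHi : ∀ t ∈ Icc (0 : ℝ) 1, InjOn (H t) X) :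
    ∃ W : ℂ → ℂ → ℂ,
      ContinuousOn (fun p : ℂ × ℂ => W p.1 p.2) {p | p.1 ∈ X ∧ p.2 ∈ N ∧ r p.2 ≠ p.1} ∧
      (∀ x ∈ X, ∀ w ∈ N, r w ≠ x → Complex.exp (W x w) = (f (r w) - f x) / (w - x)) ∧
      ∀ x ∈ X, ∀ y ∈ X, x ≠ y → W x y = W y x := by
  have h01 : (0 : ℝ) ∈ Icc (0 : ℝ) 1 := ⟨le_rfl, zero_le_one⟩
  have h11 : (1 : ℝ) ∈ Icc (0 : ℝ) 1 := ⟨zero_le_one, le_rfl⟩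
  set Λ : Set (ℂ × ℂ) := {p | p.1 ∈ X ∧ p.2 ∈ N ∧ r p.2 ≠ p.1} with hΛ
  have hne : ∀ p ∈ Λ, ∀ s ∈ Icc (0 : ℝ) 1, R s p.2 - p.1 ≠ 0 := by
    rintro ⟨x, w⟩ ⟨hx, hw, hwx⟩ s hs h
    simp only at hx hw hwx h
    rw [sub_eq_zero] at h
    apply hwx
    rw [← hRr s hs w hw, h, hfix x hx]
  have hne0 : ∀ p ∈ Λ, p.2 - p.1 ≠ 0 := by
    intro p hp
    have := hne p hp 0 h01
    rwa [hR0 _ hp.2.1] at this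
  have hden : ContinuousOn (fun p : ℝ × (ℂ × ℂ) => p.2.2 - p.2.1) (Icc 0 1 ×ˢ Λ) := by fun_prop
  obtain ⟨L1, hL1, hL1e, hL10⟩ := exists_log_homotopy (S := Λ)
    (Q := fun s p => (R s p.2 - p.1) / (p.2 - p.1)) (L0 := fun _ => 0)
    (by
      refine ContinuousOn.div (ContinuousOn.sub ?_ (by fun_prop)) hden fun p hp => hne0 _ hp.2
      exact hR.comp (f := fun p : ℝ × (ℂ × ℂ) => (p.1, p.2.2)) (by fun_prop)
        fun p hp => ⟨hp.1, hp.2.2.1⟩)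
    (fun s hs p hp => div_ne_zero (hne p hp s hs) (hne0 p hp)) continuousOn_const
    (fun p hp => by
      simp only [hR0 _ hp.2.1]
      rw [Complex.exp_zero, div_self (hne0 p hp)])
  have hL1c : ∀ s ∈ Icc (0 : ℝ) 1, ContinuousOn (L1 s) Λ := fun s hs =>
    hL1.comp (f := fun p => (s, p)) (by fun_prop) fun p hp => ⟨hs, hp⟩
  obtain ⟨L2, hL2, hL2e, hL20⟩ := exists_log_homotopy (S := Λ)
    (Q := fun s p => (H s (r p.2) - H s p.1) / (p.2 - p.1)) (L0 := L1 1)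
    (by
      refine ContinuousOn.div (ContinuousOn.sub ?_ ?_) hden fun p hp => hne0 _ hp.2
      · exact hH.comp (f := fun p : ℝ × (ℂ × ℂ) => (p.1, r p.2.2))
          (continuousOn_fst.prodMk (hr.comp (by fun_prop) fun p hp => hp.2.2.1))
          fun p hp => ⟨hp.1, hrX hp.2.2.1⟩
      · exact hH.comp (f := fun p : ℝ × (ℂ × ℂ) => (p.1, p.2.1)) (by fun_prop)
          fun p hp => ⟨hp.1, hp.2.1⟩)
    (fun s hs p hp => div_ne_zero (sub_ne_zero.2 fun h => hp.2.2
      (hHi s hs (hrX hp.2.1) hp.1 h)) (hne0 p hp)) (hL1c 1 h11)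
    (fun p hp => by
      rw [hL1e 1 h11 p hp, hR1 _ hp.2.1, hH0 _ (hrX hp.2.1), hH0 _ hp.1])
  refine ⟨fun x w => L2 1 (x, w), ?_, ?_, ?_⟩
  · exact hL2.comp (f := fun p => ((1 : ℝ), p)) (by fun_prop) fun p hp => ⟨h11, hp⟩
  · intro x hx w hw hwx
    rw [hL2e 1 h11 (x, w) ⟨hx, hw, hwx⟩, hH1 _ (hrX hw), hH1 _ hx]
  · intro x hx y hy hxy
    have hΛxy : ∀ a ∈ X, ∀ b ∈ X, a ≠ b → (a, b) ∈ Λ := fun a ha b hb hab =>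
      ⟨ha, hXN hb, by simp only [hfix b hb]; exact hab.symm⟩
    have hcs : ∀ (L : ℝ → ℂ × ℂ → ℂ), ContinuousOn (fun p : ℝ × (ℂ × ℂ) => L p.1 p.2)
        (Icc 0 1 ×ˢ Λ) → ∀ p ∈ Λ, ContinuousOn (fun s => L s p) (Icc 0 1) := fun L hL p hp =>
      hL.comp (f := fun s => (s, p)) (by fun_prop) fun s hs => ⟨hs, hp⟩
    have key : ∀ a ∈ X, ∀ b ∈ X, a ≠ b → L1 1 (a, b) = 0 := by
      intro a ha b hb hab
      have hp := hΛxy a ha b hb hab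
      refine isPreconnected_Icc.eq_of_exp_eq (g := fun s => L1 s (a, b)) (g' := fun _ => 0)
        (hcs L1 hL1 _ hp) continuousOn_const (fun s hs => ?_) h01 h11 (hL10 _ hp)
      rw [hL1e s hs _ hp, Complex.exp_zero]
      simp only [hRX s hs b hb]
      exact div_self (hne0 _ hp)
    have hp := hΛxy x hx y hy hxy
    have hp' := hΛxy y hy x hx hxy.symm
    refine isPreconnected_Icc.eq_of_exp_eq (g := fun s => L2 s (x, y)) (g' := fun s => L2 s (y, x))
        (hcs L2 hL2 _ hp) (hcs L2 hL2 _ hp') (fun s hs => ?_) h01 h11 ?_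
    · rw [hL2e s hs _ hp, hL2e s hs _ hp']
      simp only [hfix x hx, hfix y hy]
      rw [← neg_sub (H s x) (H s y), ← neg_sub x y, neg_div_neg_eq]
    · rw [hL20 _ hp, hL20 _ hp', key x hx y hy hxy, key y hy x hx hxy.symm]

lemma HasLogs.collar {N : Set ℂ} {r : ℂ → ℂ} {R : ℝ → ℂ → ℂ} (hX : HasLogs X) (hXN : X ⊆ N)
    (hr : ContinuousOn r N) (hrX : MapsTo r N X)
    (hR : ContinuousOn (fun p : ℝ × ℂ => R p.1 p.2) (Icc 0 1 ×ˢ N))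
    (hR0 : ∀ w ∈ N, R 0 w = w) (hR1 : ∀ w ∈ N, R 1 w = r w)
    (hRN : ∀ s ∈ Icc (0 : ℝ) 1, ∀ w ∈ N, R s w ∈ N) : HasLogs N := by
  intro k hk hk0
  have h11 : (1 : ℝ) ∈ Icc (0 : ℝ) 1 := ⟨zero_le_one, le_rfl⟩
  obtain ⟨L, hL, hLe⟩ := hX k (hk.mono hXN) fun x hx => hk0 x (hXN hx)
  have hrev : ∀ s ∈ Icc (0 : ℝ) 1, 1 - s ∈ Icc (0 : ℝ) 1 := fun s hs =>
    ⟨by linarith [hs.2], by linarith [hs.1]⟩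
  obtain ⟨M, hM, hMe, -⟩ := exists_log_homotopy (S := N) (Q := fun s w => k (R (1 - s) w))
    (L0 := fun w => L (r w))
    (by
      refine hk.comp ?_ fun p hp => hRN _ (hrev _ hp.1) _ hp.2
      exact hR.comp (f := fun p : ℝ × ℂ => (1 - p.1, p.2)) (by fun_prop)
        fun p hp => ⟨hrev _ hp.1, hp.2⟩)
    (fun s hs w hw => hk0 _ (hRN _ (hrev _ hs) _ hw)) (hL.comp hr hrX)
    (fun w hw => by rw [hLe _ (hrX hw), sub_zero, hR1 w hw])
  refine ⟨M 1, hM.comp (f := fun w => ((1 : ℝ), w)) (by fun_prop) fun w hw => ⟨h11, hw⟩,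
    fun w hw => ?_⟩
  rw [hMe 1 h11 w hw, sub_self, hR0 w hw]

theorem nonescaping_of_collar (hX : IsCompact X) [LocallyPathConnectedSpace X]
    (hlog : HasLogs X) {N : ℝ → Set ℂ} {r : ℂ → ℂ} {R : ℝ → ℂ → ℂ} (C : Collar X N r R)
    (hf : ContinuousOn f X) (hfi : InjOn f X)
    (hH : ContinuousOn (fun p : ℝ × ℂ => H p.1 p.2) (Icc 0 1 ×ˢ X))
    (hH0 : ∀ x ∈ X, H 0 x = x) (hH1 : ∀ x ∈ X, H 1 x = f x)
    (hHi : ∀ t ∈ Icc (0 : ℝ) 1, InjOn (H t) X) (hconn : IsPreconnected (X ∩ f '' X))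
    (hfix : ∀ x ∈ X, f x ≠ x) {x : ℂ} (hx : ∀ n : ℕ, f^[n] x ∈ X) : False := by
  have : CompactSpace X := isCompact_iff_compactSpace.1 hX
  have hx0 : x ∈ X := hx 0
  have hx1 : f x ∈ X := hx 1
  let F : X → ℂ := X.domRestrict f
  have hF : Continuous F := continuousOn_iff_continuous_domRestrict.1 hf
  have hFi : Function.Injective F := fun a b h => Subtype.ext (hfi a.2 b.2 h)
  obtain ⟨c, hc, hcle⟩ : ∃ c > 0, ∀ y ∈ X, c ≤ ‖f y - y‖ := by
    obtain ⟨p, hp, hmin⟩ := hX.exists_isMinOn ⟨x, hx0⟩ (hf.sub continuousOn_id).norm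
    exact ⟨_, norm_pos_iff.2 (sub_ne_zero.2 (hfix p hp)), fun y hy => hmin hy⟩
  have hhalf : (1 / 2 : ℝ) ∈ Ioo (0 : ℝ) 1 := by constructor <;> norm_num
  obtain ⟨η, hη, hηU⟩ := C.basis ((N (1 / 2)) ∩ (fun w => ‖r w - w‖) ⁻¹' Iio c)
    (((C.cont _ hhalf).sub continuousOn_id).norm.isOpen_inter_preimage (C.isOpen _ hhalf) isOpen_Iio)
    (fun y hy => ⟨C.sub _ hhalf hy, by simp [C.fix y hy, hc]⟩)
  let x0 : X := ⟨x, hx0⟩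
  have hC : IsPreconnected (F ⁻¹' X) := by
    have h1 : F ⁻¹' X = F ⁻¹' (X ∩ f '' X) := by
      ext y
      simp only [mem_preimage, mem_inter_iff]
      exact ⟨fun h => ⟨h, mem_image_of_mem _ y.2⟩, fun h => h.1⟩
    rw [h1]
    refine hconn.preimage_of_isClosedMap hFi hF.isClosedMap ?_
    rintro _ ⟨-, y, hy, rfl⟩
    exact ⟨⟨y, hy⟩, rfl⟩
  have hcomp : ∀ U : Set ℂ, X ⊆ U → F ⁻¹' X ⊆ connectedComponentIn (F ⁻¹' U) x0 := fun U hXU =>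
    hC.subset_connectedComponentIn (show F x0 ∈ X from hx1) (preimage_mono hXU)
  set V0 := connectedComponentIn (F ⁻¹' (N η)) x0 with hV0
  have hV0o : IsOpen V0 := ((C.isOpen η hη).preimage hF).connectedComponentIn
  have hout : IsCompact (F '' V0ᶜ) := (hV0o.isClosed_compl.isCompact).image hF
  obtain ⟨η', hη', hηU'⟩ := C.basis (N η ∩ (F '' V0ᶜ)ᶜ)
    ((C.isOpen η hη).inter hout.isClosed.isOpen_compl) (fun y hy => ⟨C.sub η hη hy, by
      rintro ⟨z, hz, rfl⟩
      exact hz (hcomp _ (C.sub η hη) hy)⟩)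
  set V1 := connectedComponentIn (F ⁻¹' (N η')) x0 with hV1
  have hx0' : ∀ U : Set ℂ, X ⊆ U → x0 ∈ F ⁻¹' U := fun U hXU => hXU hx1
  have hV1o : IsOpen V1 := ((C.isOpen η' hη').preimage hF).connectedComponentIn
  have hV1c : IsPathConnected V1 := hV1o.isConnected_iff_isPathConnected.1
    (isConnected_connectedComponentIn_iff.2 (hx0' _ (C.sub η' hη')))
  have hNN : N η' ⊆ N η := hηU'.trans inter_subset_left
  have D : RetractionData X (N η) (N η') (Subtype.val '' V0) (Subtype.val '' V1) r R :=
    { compact := hX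
      sub := C.sub η' hη'
      sub' := hNN
      isOpen := C.isOpen η hη
      isOpen' := C.isOpen η' hη'
      cont := C.cont η hη
      maps := C.maps η hη
      fix := C.fix
      contR := C.contR η hη
      zero := C.zero η hη
      one := C.one η hη
      fibre := C.fibre η hη
      mapsR := C.mapsR η' hη'
      subV := image_mono (connectedComponentIn_mono _ (preimage_mono hNN))
      subX := by rintro _ ⟨y, -, rfl⟩; exact y.2
      conn := isPreconnected_connectedComponentIn.image _ continuous_subtype_val.continuousOn
      path := by
        rintro _ ⟨a, ha, rfl⟩ _ ⟨b, hb, rfl⟩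
        obtain ⟨γ, hγ⟩ := hV1c.joinedIn a ha b hb
        refine ⟨fun t => (γ.extend t : X), (continuous_subtype_val.comp γ.continuous_extend).continuousOn,
          fun t ht => ⟨_, ?_, rfl⟩, by simp, by simp⟩
        rw [γ.extend_apply ht]
        exact hγ _
      log := hlog.collar (C.sub η hη) (C.cont η hη) (C.maps η hη) (C.contR η hη) (C.zero η hη)
        (C.one η hη) (C.mapsR η hη) }
  have G : FreeMap X (N η) (N η') (Subtype.val '' V0) (Subtype.val '' V1) r f :=
    { cont := hf
      inj := hfi
      mapsV := by
        rintro _ ⟨y, hy, rfl⟩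
        exact connectedComponentIn_subset (F ⁻¹' N η) x0 hy
      mapsV' := by
        rintro _ ⟨y, hy, rfl⟩
        exact connectedComponentIn_subset (F ⁻¹' N η') x0 hy
      source := by
        intro y hy hfy
        by_contra h
        exact (hηU' hfy).2 ⟨⟨y, hy⟩, fun h' => h ⟨_, h', rfl⟩, rfl⟩
      free := by
        intro y hy hfy h
        have h1 := (hηU hfy).2
        simp only [mem_preimage, mem_Iio, h] at h1
        rw [norm_sub_rev] at h1
        exact absurd h1 (not_lt.2 (hcle y hy))
      rot := exists_rotation (C.sub η hη) (C.cont η hη) (C.maps η hη) C.fix (C.contR η hη)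
        (C.zero η hη) (C.one η hη) (C.fibre η hη) C.fixR hH hH0 hH1 hHi }
  obtain ⟨n, hn⟩ := G.exists_iterate_notMem D x
  refine hn ⟨⟨f^[n] x, hx n⟩, hcomp _ (C.sub η' hη') ?_, rfl⟩
  show f (f^[n] x) ∈ X
  rw [← Function.iterate_succ_apply' f]
  exact hx (n + 1)

end

/-- Points of a preconnected set are joined by chains of arbitrarily small steps. -/
theorem IsPreconnected.exists_chain {M : Type*} [PseudoMetricSpace M] {S : Set M}
    (hS : IsPreconnected S) {x y : M} (hx : x ∈ S) (hy : y ∈ S) {δ : ℝ} (hδ : 0 < δ) :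
    ∃ (c : ℕ → M) (n : ℕ), c 0 = x ∧ (∀ j, n ≤ j → c j = y) ∧ (∀ j, c j ∈ S) ∧
      ∀ j, dist (c j) (c (j + 1)) < δ := by
  set P : M → Prop := fun y => ∃ (c : ℕ → M) (n : ℕ), c 0 = x ∧ (∀ j, n ≤ j → c j = y) ∧
    (∀ j, c j ∈ S) ∧ ∀ j, dist (c j) (c (j + 1)) < δ with hP
  have hPx : P x := ⟨fun _ => x, 0, rfl, fun _ _ => rfl, fun _ => hx, fun _ => by simpa using hδ⟩
  have step : ∀ z w, P z → w ∈ S → dist z w < δ → P w := by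
    rintro z w ⟨c, n, h0, h1, h2, h3⟩ hw hzw
    refine ⟨fun j => if j ≤ n then c j else w, n + 1, by simpa using h0, fun j hj => ?_,
      fun j => ?_, fun j => ?_⟩
    · simp [show ¬ j ≤ n by omega]
    · dsimp only; split_ifs
      exacts [h2 j, hw]
    · dsimp only
      rcases lt_trichotomy j n with h | h | h
      · rw [if_pos h.le, if_pos (by omega)]; exact h3 j
      · rw [if_pos h.le, if_neg (by omega), h1 j h.ge]; exact hzw
      · rw [if_neg (by omega), if_neg (by omega)]; simpa using hδ
  by_contra hny
  have := hS (⋃ z ∈ {z | z ∈ S ∧ P z}, Metric.ball z δ) (⋃ z ∈ {z | z ∈ S ∧ ¬ P z}, Metric.ball z δ)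
    (isOpen_biUnion fun _ _ => Metric.isOpen_ball) (isOpen_biUnion fun _ _ => Metric.isOpen_ball)
    (fun z hz => by
      by_cases h : P z
      · exact Or.inl (mem_biUnion (show z ∈ {z | z ∈ S ∧ P z} from ⟨hz, h⟩)
          (Metric.mem_ball_self hδ))
      · exact Or.inr (mem_biUnion (show z ∈ {z | z ∈ S ∧ ¬ P z} from ⟨hz, h⟩)
          (Metric.mem_ball_self hδ)))
    ⟨x, hx, mem_biUnion (show x ∈ {z | z ∈ S ∧ P z} from ⟨hx, hPx⟩) (Metric.mem_ball_self hδ)⟩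
    ⟨y, hy, mem_biUnion (show y ∈ {z | z ∈ S ∧ ¬ P z} from ⟨hy, hny⟩) (Metric.mem_ball_self hδ)⟩
  obtain ⟨w, hw, hw1, hw2⟩ := this
  simp only [mem_iUnion₂] at hw1 hw2
  obtain ⟨z, ⟨hz, hPz⟩, hzw⟩ := hw1
  obtain ⟨z', ⟨hz', hPz'⟩, hzw'⟩ := hw2
  refine hPz' (step w z' (step z w hPz hw ?_) hz' hzw')
  rw [dist_comm]; exact hzw

theorem exists_isPreconnected_subset_ball {M : Type*} [MetricSpace M] [CompactSpace M]
    [LocallyConnectedSpace M] {ε : ℝ} (hε : 0 < ε) :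
    ∃ δ > 0, ∀ x y : M, dist x y < δ →
      ∃ K : Set M, IsPreconnected K ∧ x ∈ K ∧ y ∈ K ∧ K ⊆ Metric.ball x ε := by
  obtain ⟨δ, hδ, h⟩ := lebesgue_number_lemma_of_metric (s := (univ : Set M)) isCompact_univ
    (c := fun x : M => connectedComponentIn (Metric.ball x (ε / 2)) x)
    (fun x => Metric.isOpen_ball.connectedComponentIn)
    (fun x _ => mem_iUnion.2 ⟨x, mem_connectedComponentIn (Metric.mem_ball_self (half_pos hε))⟩)
  refine ⟨δ, hδ, fun x y hxy => ?_⟩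
  obtain ⟨i, hi⟩ := h x (mem_univ x)
  refine ⟨_, isPreconnected_connectedComponentIn, hi (Metric.mem_ball_self hδ),
    hi (by rwa [Metric.mem_ball, dist_comm]), fun z hz => ?_⟩
  have h1 := connectedComponentIn_subset _ _ hz
  have h2 := connectedComponentIn_subset _ _ (hi (Metric.mem_ball_self hδ))
  rw [Metric.mem_ball] at *
  linarith [dist_triangle_right z x i]

section

variable {M : Type*} [MetricSpace M]

/-- A finite chain from `x` to `y` with steps smaller than `δ`. -/
def IsChainPath (x y : M) (δ : ℝ) (s : ℕ × (ℕ → M)) : Prop :=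
  0 < s.1 ∧ s.2 0 = x ∧ (∀ j, s.1 ≤ j → s.2 j = y) ∧ ∀ j, dist (s.2 j) (s.2 (j + 1)) < δ

theorem IsChainPath.exists_refinement {x y : M} {δ δ' ε : ℝ} {s : ℕ × (ℕ → M)}
    (h : IsChainPath x y δ s) (hδ' : 0 < δ') (hε : 0 < ε)
    (hK : ∀ x y : M, dist x y < δ →
      ∃ K : Set M, IsPreconnected K ∧ x ∈ K ∧ y ∈ K ∧ K ⊆ Metric.ball x ε) :
    ∃ s' : ℕ × (ℕ → M), IsChainPath x y δ' s' ∧ ∃ k : ℕ, 0 < k ∧ s'.1 = k * s.1 ∧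
      ∀ m, dist (s.2 (m / k)) (s'.2 m) ≤ ε := by
  obtain ⟨N, c⟩ := s
  obtain ⟨hN, h0, h1, h2⟩ := h
  dsimp only at *
  have : ∀ i, ∃ (d : ℕ → M) (n : ℕ), d 0 = c i ∧ (∀ j, n ≤ j → d j = c (i + 1)) ∧
      (∀ j, dist (c i) (d j) ≤ ε) ∧ (∀ j, dist (d j) (d (j + 1)) < δ') ∧
      (N ≤ i → n = 0) := by
    intro i
    by_cases hi : N ≤ i
    · refine ⟨fun _ => y, 0, (h1 i hi).symm, fun j _ => (h1 (i + 1) (by omega)).symm, fun j => ?_,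
        fun j => by simpa using hδ', fun _ => rfl⟩
      rw [h1 i hi]; simpa using hε.le
    · obtain ⟨K, hKc, hxK, hyK, hKb⟩ := hK _ _ (h2 i)
      obtain ⟨d, n, hd0, hd1, hd2, hd3⟩ := hKc.exists_chain hxK hyK hδ'
      refine ⟨d, n, hd0, hd1, fun j => ?_, hd3, fun h => absurd h hi⟩
      have := hKb (hd2 j)
      rw [Metric.mem_ball, dist_comm] at this
      exact this.le
  choose d n hd0 hd1 hd2 hd3 hd4 using this
  set k := (Finset.range N).sup n + 1 with hk
  have hkpos : 0 < k := by omega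
  have hdk : ∀ i, d i k = c (i + 1) := by
    intro i
    apply hd1
    by_cases hi : N ≤ i
    · simp [hd4 i hi]
    · have : n i ≤ (Finset.range N).sup n := Finset.le_sup (by simpa using hi)
      omega
  refine ⟨(k * N, fun m => d (m / k) (m % k)), ⟨by positivity, by simp [hd0, h0], ?_, ?_⟩, k, hkpos,
    rfl, fun m => hd2 _ _⟩
  · intro j hj
    have : N ≤ j / k := by rw [Nat.le_div_iff_mul_le hkpos]; linarith
    dsimp only
    rw [hd1 _ _ (by simp [hd4 _ this]), h1 _ (by omega)]
  · intro m
    dsimp only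
    by_cases hm : m % k + 1 < k
    · have e1 : (m + 1) / k = m / k := by
        rw [Nat.succ_div_of_not_dvd]
        intro hdvd
        have h3 := Nat.add_mod m 1 k
        rw [Nat.mod_eq_zero_of_dvd hdvd, Nat.mod_eq_of_lt (show 1 < k by omega),
          Nat.mod_eq_of_lt hm] at h3
        omega
      have e2 : (m + 1) % k = m % k + 1 := by
        have h3 := Nat.div_add_mod (m + 1) k
        have h4 := Nat.div_add_mod m k
        rw [e1] at h3; omega
      rw [e1, e2]; exact hd3 _ _
    · have hlt := Nat.mod_lt m hkpos
      have h4 := Nat.div_add_mod m k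
      have e0 : m + 1 = k * (m / k + 1) := by rw [mul_add]; omega
      have e1 : (m + 1) / k = m / k + 1 := by rw [e0, Nat.mul_div_cancel_left _ hkpos]
      have e2 : (m + 1) % k = 0 := by rw [e0, Nat.mul_mod_right]
      rw [e1, e2, hd0, ← hdk]
      have e3 : d (m / k) k = d (m / k) (m % k + 1) := congrArg _ (by omega)
      rw [e3]; exact hd3 _ _

theorem abs_natFloor_sub_le {a b : ℝ} (h : |a - b| < 1) :
    ⌊a⌋₊ = ⌊b⌋₊ ∨ ⌊a⌋₊ = ⌊b⌋₊ + 1 ∨ ⌊b⌋₊ = ⌊a⌋₊ + 1 := by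
  rw [abs_lt] at h
  have h1 : ⌊a⌋₊ ≤ ⌊b⌋₊ + 1 := by
    rw [← Nat.lt_add_one_iff, Nat.floor_lt' (by omega)]
    have := Nat.lt_floor_add_one b
    push_cast; linarith
  have h2 : ⌊b⌋₊ ≤ ⌊a⌋₊ + 1 := by
    rw [← Nat.lt_add_one_iff, Nat.floor_lt' (by omega)]
    have := Nat.lt_floor_add_one a
    push_cast; linarith
  omega

theorem exists_path_of_chain [CompactSpace M] {ε : ℝ} (hε : 0 < ε) {δ : ℕ → ℝ}
    (hδ : ∀ n, 0 < δ n) (hδε : ∀ n, δ n ≤ ε * (1 / 2) ^ n)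
    (hK : ∀ n, ∀ x y : M, dist x y < δ n →
      ∃ K : Set M, IsPreconnected K ∧ x ∈ K ∧ y ∈ K ∧ K ⊆ Metric.ball x (ε * (1 / 2) ^ n))
    {x y : M} (hxy : dist x y < δ 0) :
    ∃ g : ℝ → M, Continuous g ∧ g 0 = x ∧ g 1 = y ∧ ∀ t, dist x (g t) ≤ 4 * ε := by
  have hex : ∀ n (s : {s : ℕ × (ℕ → M) // IsChainPath x y (δ n) s}),
      ∃ s' : {s : ℕ × (ℕ → M) // IsChainPath x y (δ (n + 1)) s},
        ∃ k : ℕ, 0 < k ∧ s'.1.1 = k * s.1.1 ∧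
          ∀ m, dist (s.1.2 (m / k)) (s'.1.2 m) ≤ ε * (1 / 2) ^ n := by
    intro n s
    obtain ⟨s', h1, h2⟩ := s.2.exists_refinement (hδ (n + 1)) (by positivity) (hK n)
    exact ⟨⟨s', h1⟩, h2⟩
  choose ref href using hex
  let s0 : {s : ℕ × (ℕ → M) // IsChainPath x y (δ 0) s} :=
    ⟨(1, fun j => if j = 0 then x else y), one_pos, rfl, fun j hj => by
      simp [show j ≠ 0 by omega], fun j => by
        by_cases hj : j = 0
        · simpa [hj] using hxy
        · simpa [hj] using hδ 0⟩
  let σ : ∀ n, {s : ℕ × (ℕ → M) // IsChainPath x y (δ n) s} := fun n => Nat.rec s0 ref n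
  have hσ : ∀ n, σ (n + 1) = ref n (σ n) := fun n => rfl
  let f : ℕ → ℝ → M := fun n t => (σ n).1.2 ⌊((σ n).1.1 : ℝ) * t⌋₊
  have hstep : ∀ t n, dist (f n t) (f (n + 1) t) ≤ ε * (1 / 2) ^ n := by
    intro t n
    obtain ⟨k, hk, hk1, hk2⟩ := href n (σ n)
    have hfl : ⌊((σ n).1.1 : ℝ) * t⌋₊ = ⌊((σ (n + 1)).1.1 : ℝ) * t⌋₊ / k := by
      rw [← Nat.floor_div_natCast, hσ, hk1]
      congr 1
      have : (k : ℝ) ≠ 0 := by positivity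
      push_cast; field_simp
    show dist ((σ n).1.2 _) _ ≤ _
    rw [hfl]
    exact hk2 _
  have hlim : ∀ t, ∃ z, Tendsto (fun n => f n t) atTop (𝓝 z) := fun t =>
    cauchySeq_tendsto_of_complete (cauchySeq_of_le_geometric (1 / 2) ε (by norm_num) (hstep t))
  choose g hg using hlim
  have hd : ∀ t n, dist (f n t) (g t) ≤ 2 * (ε * (1 / 2) ^ n) := by
    intro t n
    have := dist_le_of_le_geometric_of_tendsto (1 / 2) ε (by norm_num) (hstep t) (hg t) n
    refine this.trans (le_of_eq ?_)
    norm_num; ring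
  have hf0 : ∀ n, f n 0 = x := fun n => by
    show (σ n).1.2 _ = x
    simp [(σ n).2.2.1]
  have hf1 : ∀ n, f n 1 = y := fun n => by
    show (σ n).1.2 _ = y
    simpa using (σ n).2.2.2.1 _ le_rfl
  have hg0 : g 0 = x := tendsto_nhds_unique (hg 0) (by simp [hf0])
  have hg1 : g 1 = y := tendsto_nhds_unique (hg 1) (by simp [hf1])
  refine ⟨g, ?_, hg0, hg1, fun t => ?_⟩
  · rw [Metric.continuous_iff]
    intro t e he
    obtain ⟨n, hn⟩ := exists_pow_lt_of_lt_one (show 0 < e / (5 * ε) by positivity)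
      (show (1 / 2 : ℝ) < 1 by norm_num)
    have hn' : 5 * (ε * (1 / 2) ^ n) < e := by
      rw [lt_div_iff₀ (by positivity)] at hn; linarith
    have hNpos : 0 < ((σ n).1.1 : ℝ) := by exact_mod_cast (σ n).2.1
    refine ⟨1 / ((σ n).1.1 : ℝ), by positivity, fun s hs => ?_⟩
    have hfl : |((σ n).1.1 : ℝ) * s - ((σ n).1.1 : ℝ) * t| < 1 := by
      rw [← mul_sub, abs_mul, abs_of_pos hNpos]
      rw [Real.dist_eq, lt_div_iff₀ hNpos] at hs
      linarith
    have hff : dist (f n s) (f n t) ≤ ε * (1 / 2) ^ n := by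
      have hc := (σ n).2.2.2.2
      show dist ((σ n).1.2 _) ((σ n).1.2 _) ≤ _
      rcases abs_natFloor_sub_le hfl with h | h | h
      · rw [h, dist_self]; positivity
      · rw [h, dist_comm]; exact (hc _).le.trans (hδε n)
      · rw [h]; exact (hc _).le.trans (hδε n)
    calc dist (g s) (g t) ≤ dist (g s) (f n s) + dist (f n s) (f n t) + dist (f n t) (g t) :=
          dist_triangle4 _ _ _ _
      _ ≤ 2 * (ε * (1 / 2) ^ n) + ε * (1 / 2) ^ n + 2 * (ε * (1 / 2) ^ n) := by
          rw [dist_comm (g s)]; linarith [hd s n, hd t n]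
      _ < e := by linarith
  · have h1 : dist x (f 0 t) ≤ ε := by
      show dist x ((fun j => if j = 0 then x else y) _) ≤ ε
      dsimp only
      split_ifs
      · simpa using hε.le
      · have := hδε 0
        simp at this; linarith
    have h2 := hd t 0
    simp only [pow_zero, mul_one] at h2
    linarith [dist_triangle x (f 0 t) (g t)]

theorem LocallyConnectedSpace.locallyPathConnectedSpace [CompactSpace M]
    [LocallyConnectedSpace M] : LocallyPathConnectedSpace M := by
  have key : ∀ ε > 0, ∃ δ > 0, ∀ x y : M, dist x y < δ → JoinedIn (Metric.ball x ε) x y := by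
    intro ε hε
    have hε' : 0 < ε / 5 := by positivity
    choose δ hδ hK using fun n : ℕ => exists_isPreconnected_subset_ball (M := M)
      (show 0 < ε / 5 * (1 / 2) ^ n by positivity)
    refine ⟨min (δ 0) (ε / 5), lt_min (hδ 0) hε', fun x y hxy => ?_⟩
    obtain ⟨g, hg, hg0, hg1, hgd⟩ := exists_path_of_chain (M := M) hε'
      (δ := fun n => min (δ n) (ε / 5 * (1 / 2) ^ n))
      (fun n => lt_min (hδ n) (by positivity)) (fun n => min_le_right _ _)
      (fun n x y h => hK n x y (h.trans_le (min_le_left _ _)))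
      (x := x) (y := y) (by simpa using hxy)
    refine ⟨⟨⟨fun t => g t, by fun_prop⟩, by simpa using hg0, by simpa using hg1⟩, fun t => ?_⟩
    rw [Metric.mem_ball, dist_comm]
    exact (hgd t).trans_lt (by linarith)
  refine LocallyPathConnectedSpace.of_bases (p := fun (x : M) (U : Set M) => U ∈ 𝓝 x)
    (s := fun x U => pathComponentIn U x) (fun x => ⟨fun V => ⟨fun hV => ?_, ?_⟩⟩) ?_
  · exact ⟨V, hV, pathComponentIn_subset⟩
  · rintro ⟨U, hU, hUV⟩
    refine mem_of_superset ?_ hUV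
    obtain ⟨ε, hε, hb⟩ := Metric.mem_nhds_iff.1 hU
    obtain ⟨δ, hδ, h⟩ := key ε hε
    refine mem_of_superset (Metric.ball_mem_nhds x hδ) fun y hy => ?_
    exact (h x y (by rwa [dist_comm])).mono hb
  · intro x U hU
    exact isPathConnected_pathComponentIn (mem_of_mem_nhds hU)

end

theorem hasLogs_of_simplyConnectedSpace {X : Set ℂ} [SimplyConnectedSpace X]
    [LocallyPathConnectedSpace X] : HasLogs X := by
  intro k hk hk0
  obtain ⟨a⟩ := (inferInstance : Nonempty X)
  obtain ⟨F, ⟨-, hF⟩, -⟩ := Complex.isCoveringMapOn_exp.existsUnique_continuousMap_lifts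
    (⟨fun x : X => k x, hk.domRestrict⟩ : C(X, ℂ)) (a₀ := a) (e₀ := Complex.log (k a))
    (Complex.exp_log (hk0 a a.2)) (fun x => hk0 x x.2)
  classical
  refine ⟨fun x => if h : x ∈ X then F ⟨x, h⟩ else 0, ?_, fun x hx => ?_⟩
  · rw [continuousOn_iff_continuous_domRestrict]
    refine F.continuous.congr fun x => ?_
    simp
  · simp only [dif_pos hx]; exact congrFun hF ⟨x, hx⟩

theorem StarConvex.hasLogs {S : Set ℂ} {c : ℂ} (hS : StarConvex ℝ c S) (hc : c ∈ S) :
    HasLogs S := by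
  intro k hk hk0
  have hmem : ∀ s ∈ Icc (0 : ℝ) 1, ∀ x ∈ S, c + s • (x - c) ∈ S := fun s hs x hx => by
    have := hS hx (sub_nonneg.2 hs.2) hs.1 (by ring)
    convert this using 1
    module
  obtain ⟨L, hL, hL1, -⟩ := exists_log_homotopy (S := S) (Q := fun s x => k (c + s • (x - c)))
    (L0 := fun _ => Complex.log (k c))
    (hk.comp (f := fun p : ℝ × ℂ => c + p.1 • (p.2 - c)) (by fun_prop)
      fun p hp => hmem _ hp.1 _ hp.2)
    (fun s hs x hx => hk0 _ (hmem s hs x hx)) continuousOn_const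
    (fun x _ => by simp [Complex.exp_log (hk0 c hc)])
  refine ⟨L 1, hL.comp (f := fun x => ((1 : ℝ), x)) (by fun_prop) fun x hx => ⟨by simp, hx⟩,
    fun x hx => ?_⟩
  rw [hL1 1 (by simp) x hx]; simp

theorem not_exists_log_sphere {q : ℂ} {R : ℝ} (hR : 0 < R) {L : ℂ → ℂ}
    (hL : ContinuousOn L (Metric.sphere q R))
    (h : ∀ z ∈ Metric.sphere q R, Complex.exp (L z) = z - q) : False := by
  have hm : ∀ θ : ℝ, q + R * Complex.exp (θ * Complex.I) ∈ Metric.sphere q R := fun θ => by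
    simp [Complex.norm_exp_ofReal_mul_I, abs_of_pos hR]
  have key := (isPreconnected_univ (α := ℝ)).sub_eq_sub_of_exp_eq
    (g := fun θ : ℝ => L (q + R * Complex.exp (θ * Complex.I)))
    (g' := fun θ : ℝ => Real.log R + θ * Complex.I)
    (hL.comp (f := fun θ : ℝ => q + R * Complex.exp (θ * Complex.I)) (by fun_prop)
      fun θ _ => hm θ) (by fun_prop) (fun θ _ => by
      rw [h _ (hm θ), Complex.exp_add, ← Complex.ofReal_exp, Real.exp_log hR]; ring)
    (mem_univ 0) (mem_univ (2 * Real.pi))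
  have h2 : Complex.exp ((2 * Real.pi : ℝ) * Complex.I) = 1 := by
    push_cast; exact Complex.exp_two_pi_mul_I
  simp only [h2, Complex.ofReal_zero, zero_mul, Complex.exp_zero] at key
  have := congrArg Complex.im key
  simp at this
  linarith [Real.pi_pos]

/-- A point is not enclosed by a closed set on which it has a continuous logarithm. -/
theorem false_of_log_of_frontier_subset {T B : Set ℂ} {q : ℂ}
    (hBb : Bornology.IsBounded B) (hq : q ∈ B) (hBT : frontier B ⊆ T) {L : ℂ → ℂ}
    (hL : ContinuousOn L T) (h : ∀ z ∈ T, Complex.exp (L z) = z - q) : False := by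
  classical
  obtain ⟨g, hg⟩ := ContinuousMap.exists_restrict_eq (s := frontier B) isClosed_frontier
    (⟨fun z => L z, (hL.mono hBT).domRestrict⟩ : C(frontier B, ℂ))
  have hg' : ∀ z ∈ frontier B, g z = L z := fun z hz => congrArg (fun f => f ⟨z, hz⟩) hg
  have hk : Continuous (B.piecewise (fun z => Complex.exp (g z)) fun z => z - q) := by
    refine Continuous.piecewise (fun z hz => ?_) (by fun_prop) (by fun_prop)
    rw [hg' z hz, h z (hBT hz)]
  have hk0 : ∀ z, B.piecewise (fun z => Complex.exp (g z)) (fun z => z - q) z ≠ 0 := by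
    intro z
    by_cases hz : z ∈ B
    · rw [piecewise_eq_of_mem _ _ _ hz]; exact Complex.exp_ne_zero _
    · rw [piecewise_eq_of_notMem _ _ _ hz, sub_ne_zero]
      rintro rfl; exact hz hq
  obtain ⟨R, hR, hBR⟩ := hBb.subset_ball_lt 0 q
  obtain ⟨M, hM, hM1⟩ := ((convex_closedBall q R).starConvex
    (Metric.mem_closedBall_self hR.le)).hasLogs (Metric.mem_closedBall_self hR.le) _
    hk.continuousOn fun z _ => hk0 z
  refine not_exists_log_sphere hR (hM.mono Metric.sphere_subset_closedBall) fun z hz => ?_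
  rw [hM1 z (Metric.sphere_subset_closedBall hz), piecewise_eq_of_notMem]
  intro hzB
  have := hBR hzB
  rw [Metric.mem_ball] at this
  exact this.ne hz

theorem isPreconnected_compl_closedBall (R : ℝ) :
    IsPreconnected (Metric.closedBall (0 : ℂ) R)ᶜ := by
  have : (Metric.closedBall (0 : ℂ) R)ᶜ =
      (fun p : ℝ × ℝ => (p.1 : ℂ) * Complex.exp (p.2 * Complex.I)) ''
        ((Ioi (max R 0)) ×ˢ (univ : Set ℝ) ∪ (Ici 0 ∩ Ioi R) ×ˢ univ) := by
    ext z
    simp only [mem_compl_iff, Metric.mem_closedBall, dist_zero_right, not_le, mem_image]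
    constructor
    · intro h
      exact ⟨(‖z‖, z.arg), Or.inr ⟨⟨norm_nonneg z, h⟩, mem_univ _⟩, Complex.norm_mul_exp_arg_mul_I z⟩
    · rintro ⟨p, hp, rfl⟩
      rw [norm_mul, Complex.norm_exp_ofReal_mul_I, mul_one, Complex.norm_real, Real.norm_eq_abs]
      rcases hp with hp | hp
      · exact (lt_of_le_of_lt (le_max_left _ _) hp.1).trans_le (le_abs_self _)
      · exact hp.1.2.trans_le (le_abs_self _)
  rw [this]
  refine IsPreconnected.image ?_ _ (by fun_prop)
  rw [← union_prod]
  refine IsPreconnected.prod ?_ isPreconnected_univ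
  have : Ioi (max R 0) ∪ Ici 0 ∩ Ioi R = Ici 0 ∩ Ioi R := by
    refine union_eq_right.2 fun x hx => ?_
    have hx' : max R 0 < x := hx
    exact ⟨((le_max_right R 0).trans_lt hx').le, (le_max_left R 0).trans_lt hx'⟩
  rw [this]
  exact (ordConnected_Ici.inter ordConnected_Ioi).isPreconnected

theorem HasLogs.isPreconnected_compl {X : Set ℂ} (hX : IsCompact X) (h : HasLogs X) :
    IsPreconnected Xᶜ := by
  obtain ⟨R, hR⟩ := hX.isBounded.subset_closedBall 0
  set D := (Metric.closedBall (0 : ℂ) R)ᶜ with hD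
  have hDX : D ⊆ Xᶜ := compl_subset_compl.2 hR
  have hDne : ∃ d, d ∈ D := by
    refine ⟨((|R| + 1 : ℝ) : ℂ), ?_⟩
    rw [hD, mem_compl_iff, mem_closedBall_zero_iff, Complex.norm_real, Real.norm_eq_abs,
      abs_of_pos (by positivity), not_le]
    linarith [le_abs_self R]
  obtain ⟨d, hd⟩ := hDne
  have key : ∀ q ∈ Xᶜ, d ∈ connectedComponentIn Xᶜ q := by
    intro q hq
    by_contra hdq
    set B := connectedComponentIn Xᶜ q with hB
    have hBo : IsOpen B := hX.isClosed.isOpen_compl.connectedComponentIn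
    have hBD : Disjoint B D := by
      rw [Set.disjoint_left]
      intro z hz hzD
      apply hdq
      rw [hB, connectedComponentIn_eq hz]
      exact (isPreconnected_compl_closedBall R).subset_connectedComponentIn hzD hDX hd
    have hBb : Bornology.IsBounded B := by
      refine Metric.isBounded_closedBall.subset (t := Metric.closedBall (0 : ℂ) R) fun z hz => ?_
      by_contra hc
      exact Set.disjoint_left.1 hBD hz hc
    have hqX : ∀ z ∈ X, z - q ≠ 0 := fun z hz h => hq (by rw [← sub_eq_zero.1 h]; exact hz)
    obtain ⟨L, hL, hL1⟩ := h (fun z => z - q) (by fun_prop) hqX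
    refine false_of_log_of_frontier_subset hBb (mem_connectedComponentIn hq) ?_ hL hL1
    intro z hz
    by_contra hzX
    have hzC : z ∈ connectedComponentIn Xᶜ z := mem_connectedComponentIn hzX
    have : (connectedComponentIn Xᶜ z ∩ B).Nonempty :=
      mem_closure_iff.1 hz.1 _ hX.isClosed.isOpen_compl.connectedComponentIn hzC
    obtain ⟨y, hy1, hy2⟩ := this
    have e : connectedComponentIn Xᶜ z = B := by
      rw [connectedComponentIn_eq hy1, hB, connectedComponentIn_eq hy2]
    rw [hBo.frontier_eq] at hz
    exact hz.2 (e ▸ hzC)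
  refine isPreconnected_of_forall d fun q hq => ⟨connectedComponentIn Xᶜ q,
    connectedComponentIn_subset _ _, key q hq, mem_connectedComponentIn hq,
    isPreconnected_connectedComponentIn⟩

theorem exists_log_div_of_chain {c : ℕ → ℂ} {n : ℕ} {K : Set ℂ}
    (h : ∀ z ∈ K, ∀ j, ‖c j - c (j + 1)‖ < ‖z - c (j + 1)‖) (h0 : ∀ z ∈ K, z ≠ c 0) :
    ∃ L : ℂ → ℂ, ContinuousOn L K ∧ ∀ z ∈ K, Complex.exp (L z) = (z - c 0) / (z - c n) := by
  have hne : ∀ z ∈ K, ∀ j, z - c j ≠ 0 := by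
    intro z hz j
    cases j with
    | zero => exact sub_ne_zero.2 (h0 z hz)
    | succ j => exact norm_pos_iff.1 ((norm_nonneg _).trans_lt (h z hz j))
  have hslit : ∀ z ∈ K, ∀ j, (z - c j) / (z - c (j + 1)) ∈ Complex.slitPlane := by
    intro z hz j
    have e : (z - c j) / (z - c (j + 1)) = 1 + (-((c j - c (j + 1)) / (z - c (j + 1)))) := by
      field_simp [hne z hz (j + 1)]; ring
    rw [e]
    apply Complex.mem_slitPlane_of_norm_lt_one
    rw [norm_neg, norm_div, div_lt_one (norm_pos_iff.2 (hne z hz _))]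
    exact h z hz j
  refine ⟨fun z => ∑ j ∈ Finset.range n, Complex.log ((z - c j) / (z - c (j + 1))), ?_, ?_⟩
  · refine continuousOn_finsetSum _ fun j _ => ContinuousOn.clog ?_ fun z hz => hslit z hz j
    exact ContinuousOn.div (by fun_prop) (by fun_prop) fun z hz => hne z hz _
  · intro z hz
    rw [Complex.exp_sum, Finset.prod_congr rfl fun j _ =>
      Complex.exp_log (Complex.slitPlane_ne_zero (hslit z hz j))]
    clear hslit
    induction n with
    | zero => simp [div_self (hne z hz 0)]
    | succ n ih => rw [Finset.prod_range_succ, ih, div_mul_div_cancel₀ (hne z hz n)]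

theorem exists_log_div {C U : Set ℂ} (hC : IsPreconnected C) (hCc : IsClosed C) (hU : IsOpen U)
    (hUc : IsPreconnected U) (hUC : U ⊆ Cᶜ) {a b : ℂ} (ha : a ∈ C) (hb : b ∈ C) :
    ∃ L : ℂ → ℂ, ContinuousOn L U ∧ ∀ z ∈ U, Complex.exp (L z) = (z - a) / (z - b) := by
  rcases U.eq_empty_or_nonempty with rfl | ⟨z0, hz0⟩
  · exact ⟨fun _ => 0, by simp, by simp⟩
  set K : ℕ → Set ℂ := fun n => {z | ∀ c ∈ C, 1 / ((n : ℝ) + 1) ≤ ‖z - c‖} with hK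
  have hmono : ∀ {n m}, n ≤ m → K n ⊆ K m := fun {n m} hnm z hz c hc =>
    (one_div_le_one_div_of_le (by positivity) (by exact_mod_cast Nat.succ_le_succ hnm)).trans
      (hz c hc)
  have hLK : ∀ n, ∃ L : ℂ → ℂ, ContinuousOn L (K n) ∧
      ∀ z ∈ K n, Complex.exp (L z) = (z - a) / (z - b) := by
    intro n
    obtain ⟨c, m, h0, h1, h2, h3⟩ := hC.exists_chain ha hb (show 0 < 1 / ((n : ℝ) + 1) by positivity)
    have := exists_log_div_of_chain (c := c) (n := m) (K := K n)
      (fun z hz j => ((dist_eq_norm _ _).symm.trans_lt (h3 j)).trans_le (hz _ (h2 _)))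
      (fun z hz h => by
        have := hz (c 0) (h2 0)
        rw [h, sub_self, norm_zero] at this
        exact absurd this (not_le.2 (by positivity)))
    rwa [h0, h1 m le_rfl] at this
  choose L0 hL0 hL0e using hLK
  have hcompact : ∀ W : Set ℂ, IsCompact W → W ⊆ U → ∃ N, W ⊆ K N := by
    intro W hW hWU
    obtain ⟨δ, hδ, h⟩ := hW.exists_thickening_subset_open hCc.isOpen_compl (hWU.trans hUC)
    obtain ⟨N, hN⟩ := exists_nat_one_div_lt hδ
    refine ⟨N, fun z hz c hc => ?_⟩
    by_contra hlt
    refine h (Metric.mem_thickening_iff.2 ⟨z, hz, ?_⟩) hc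
    rw [dist_comm, dist_eq_norm]
    exact (not_le.1 hlt).trans hN
  obtain ⟨N0, hN0⟩ := hcompact {z0} isCompact_singleton (singleton_subset_iff.2 hz0)
  have hz0K : ∀ n, N0 ≤ n → z0 ∈ K n := fun n hn => hmono hn (hN0 rfl)
  set L : ℕ → ℂ → ℂ := fun n z => L0 n z - L0 n z0 + L0 N0 z0 with hLdef
  have hLc : ∀ n, ContinuousOn (L n) (K n) := fun n => ((hL0 n).sub continuousOn_const).add
    continuousOn_const
  have hLe : ∀ n, N0 ≤ n → ∀ z ∈ K n, Complex.exp (L n z) = (z - a) / (z - b) := by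
    intro n hn z hz
    simp only [hLdef]
    rw [Complex.exp_add, Complex.exp_sub, hL0e n z hz, hL0e n z0 (hz0K n hn),
      hL0e N0 z0 (hz0K N0 le_rfl), div_mul_cancel₀]
    rw [← hL0e n z0 (hz0K n hn)]; exact Complex.exp_ne_zero _
  have hLz0 : ∀ n, L n z0 = L0 N0 z0 := fun n => by simp [hLdef]
  have hUp : IsPathConnected U := (hU.isConnected_iff_isPathConnected).1 ⟨⟨z0, hz0⟩, hUc⟩
  have hloc : ∀ z ∈ U, ∃ (N : ℕ) (r : ℝ), 0 < r ∧ Metric.closedBall z r ⊆ K N ∧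
      ∀ n, N ≤ n → ∀ w ∈ Metric.closedBall z r, L n w = L N w := by
    intro z hz
    obtain ⟨r, hr, hrU⟩ := Metric.nhds_basis_closedBall.mem_iff.1 (hU.mem_nhds hz)
    obtain ⟨γ, hγ⟩ := hUp.joinedIn z0 hz0 z hz
    set W := range γ ∪ Metric.closedBall z r with hW
    have hWc : IsCompact W := (isCompact_range γ.continuous).union (isCompact_closedBall z r)
    have hWp : IsPreconnected W := IsPreconnected.union z ⟨1, by simp⟩
      (Metric.mem_closedBall_self hr.le) (isPreconnected_range γ.continuous)
      (convex_closedBall z r).isPreconnected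
    obtain ⟨N1, hN1⟩ := hcompact W hWc (union_subset (range_subset_iff.2 hγ) hrU)
    have hWK : W ⊆ K (max N0 N1) := hN1.trans (hmono (le_max_right _ _))
    refine ⟨max N0 N1, r, hr, subset_union_right.trans hWK, fun n hn w hw => ?_⟩
    have hWn := hWK.trans (hmono hn)
    refine hWp.eq_of_exp_eq ((hLc n).mono hWn) ((hLc _).mono hWK) (fun x hx => ?_)
      (x := z0) (Or.inl ⟨0, by simp⟩) (Or.inr hw) (by rw [hLz0, hLz0])
    rw [hLe n ((le_max_left _ _).trans hn) x (hWn hx), hLe _ (le_max_left _ _) x (hWK hx)]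
  choose! N r hr hrK hN using hloc
  have heq : ∀ z ∈ U, ∀ w ∈ U, w ∈ Metric.closedBall z (r z) → L (N w) w = L (N z) w := by
    intro z hz w hw hwz
    rw [← hN z hz (max (N z) (N w)) (le_max_left _ _) w hwz,
      ← hN w hw (max (N z) (N w)) (le_max_right _ _) w (Metric.mem_closedBall_self (hr w hw).le)]
  refine ⟨fun z => L (N z) z, fun z hz => ?_, fun z hz => ?_⟩
  · refine ContinuousWithinAt.congr_of_eventuallyEq (f := L (N z)) ?_ ?_ rfl
    · refine ((hLc (N z)).mono (hrK z hz)).continuousAt ?_ |>.continuousWithinAt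
      exact Metric.closedBall_mem_nhds z (hr z hz)
    · filter_upwards [self_mem_nhdsWithin,
        mem_nhdsWithin_of_mem_nhds (Metric.closedBall_mem_nhds z (hr z hz))] with w hw hw'
      exact heq z hz w hw hw'
  · have hzK := hrK z hz (Metric.mem_closedBall_self (hr z hz).le)
    show Complex.exp (L (N z) z) = _
    rw [← hN z hz (max N0 (N z)) (le_max_right _ _) z (Metric.mem_closedBall_self (hr z hz).le)]
    exact hLe _ (le_max_left _ _) z (hmono (le_max_right _ _) hzK)

/-- A compact set carrying a branched double cover of a connected set is connected. -/
theorem IsCompact.isPreconnected_of_involution {Q : Set ℂ} (hQ : IsCompact Q) {j ι : ℂ → ℂ}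
    (hj : ContinuousOn j Q) (hι : ContinuousOn ι Q) (hιQ : MapsTo ι Q Q)
    (hιι : ∀ x ∈ Q, ι (ι x) = x) (hjι : ∀ x ∈ Q, ∀ y ∈ Q, j x = j y → y = x ∨ y = ι x)
    {x0 : ℂ} (hx0 : x0 ∈ Q) (hιx0 : ι x0 = x0) (hjQ : IsPreconnected (j '' Q)) :
    IsPreconnected Q := by
  rw [isPreconnected_closed_iff]
  have main : ∀ A B : Set ℂ, IsClosed A → IsClosed B → Q ⊆ A ∪ B → x0 ∈ A → (Q ∩ B).Nonempty →
      (Q ∩ (A ∩ B)).Nonempty := by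
    intro A B hA hB hAB hx0A ⟨b, hbQ, hbB⟩
    by_contra hne
    have hdis : ∀ x ∈ Q, x ∈ A → x ∉ B := fun x hx hxA hxB => hne ⟨x, hx, hxA, hxB⟩
    have hpre : ∀ T : Set ℂ, IsClosed T → IsCompact (Q ∩ ι ⁻¹' T) := fun T hT =>
      hQ.of_isClosed_subset (hι.preimage_isClosed_of_isClosed hQ.isClosed hT) inter_subset_left
    have hD : IsCompact (Q ∩ B ∪ Q ∩ ι ⁻¹' B) := (hQ.inter_right hB).union (hpre B hB)
    have hE : IsCompact (Q ∩ A ∩ (Q ∩ ι ⁻¹' A)) := (hQ.inter_right hA).inter (hpre A hA)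
    have hDj := hD.image_of_continuousOn (hj.mono (union_subset inter_subset_left inter_subset_left))
    have hEj := hE.image_of_continuousOn (hj.mono (inter_subset_left.trans inter_subset_left))
    obtain ⟨w, -, ⟨x, hx, hxw⟩, ⟨y, hy, hyw⟩⟩ := isPreconnected_closed_iff.1 hjQ _ _ hDj.isClosed
      hEj.isClosed (by
        rintro - ⟨x, hx, rfl⟩
        by_cases h1 : x ∈ B
        · exact Or.inl ⟨x, Or.inl ⟨hx, h1⟩, rfl⟩
        by_cases h2 : ι x ∈ B
        · exact Or.inl ⟨x, Or.inr ⟨hx, h2⟩, rfl⟩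
        · exact Or.inr ⟨x, ⟨⟨hx, (hAB hx).resolve_right h1⟩, hx,
            (hAB (hιQ hx)).resolve_right h2⟩, rfl⟩)
      ⟨j b, mem_image_of_mem _ hbQ, b, Or.inl ⟨hbQ, hbB⟩, rfl⟩
      ⟨j x0, mem_image_of_mem _ hx0, x0, ⟨⟨hx0, hx0A⟩, hx0, by rwa [mem_preimage, hιx0]⟩, rfl⟩
    have hxQ : x ∈ Q := hx.elim (fun h => h.1) fun h => h.1
    have hyA : y ∈ A := hy.1.2
    have hyA' : ι y ∈ A := hy.2.2
    have hyQ : y ∈ Q := hy.1.1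
    rcases hjι x hxQ y hyQ (hxw.trans hyw.symm) with rfl | rfl
    · rcases hx with hx | hx
      · exact hdis _ hyQ hyA hx.2
      · exact hdis _ (hιQ hyQ) hyA' hx.2
    · rw [hιι x hxQ] at hyA'
      rcases hx with hx | hx
      · exact hdis _ hxQ hyA' hx.2
      · exact hdis _ hyQ hyA hx.2
  intro A B hA hB hAB hneA hneB
  rcases hAB hx0 with h | h
  · exact main A B hA hB hAB h hneB
  · rw [inter_comm A B]
    exact main B A hB hA (by rwa [union_comm]) h hneA

theorem IsPreconnected.union_of_frontier_subset {Q O : Set ℂ} (hQ : IsPreconnected Q)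
    (hO : IsPreconnected O) (hOn : O.Nonempty) (hOu : O ≠ univ) (hf : frontier O ⊆ Q) :
    IsPreconnected (Q ∪ O) := by
  obtain ⟨p, hp⟩ := nonempty_frontier_iff.2 ⟨hOn, hOu⟩
  have : Q ∪ O = Q ∪ closure O := by
    rw [closure_eq_self_union_frontier, union_comm O, ← union_assoc, union_eq_left.2 hf]
  rw [this]
  exact hQ.union p (hf hp) (frontier_subset_closure hp) hO.closure

/-- Mutually inverse holomorphic maps between two plane sets. -/
structure Biholo (U V : Set ℂ) (f g : ℂ → ℂ) : Prop where
  df : DifferentiableOn ℂ f U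
  dg : DifferentiableOn ℂ g V
  mf : MapsTo f U V
  mg : MapsTo g V U
  gf : ∀ z ∈ U, g (f z) = z
  fg : ∀ w ∈ V, f (g w) = w

theorem Biholo.trans {U V W : Set ℂ} {f g f' g' : ℂ → ℂ} (h : Biholo U V f g)
    (h' : Biholo V W f' g') : Biholo U W (f' ∘ f) (g ∘ g') where
  df := h'.df.comp h.df h.mf
  dg := h.dg.comp h'.dg h'.mg
  mf := h'.mf.comp h.mf
  mg := h.mg.comp h'.mg
  gf z hz := by simp [h'.gf _ (h.mf hz), h.gf z hz]
  fg z hz := by simp [h.fg _ (h'.mg hz), h'.fg z hz]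

/-- A connected open subset of the unit disc whose complement in the closed disc is connected. -/
structure DiscDomain (V : Set ℂ) : Prop where
  isOpen : IsOpen V
  isPreconnected : IsPreconnected V
  sub : V ⊆ Metric.ball 0 1
  compl : IsPreconnected (Metric.closedBall 0 1 \ V)

/-- The Möbius automorphism of the disc sending `a` to `0`. -/
def mob (a z : ℂ) : ℂ := (z - a) / (1 - (starRingEnd ℂ) a * z)

theorem mob_denom_ne_zero {a z : ℂ} (ha : ‖a‖ < 1) (hz : ‖z‖ ≤ 1) :
    1 - (starRingEnd ℂ) a * z ≠ 0 := by
  intro h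
  have h1 : (starRingEnd ℂ) a * z = 1 := (sub_eq_zero.1 h).symm
  have h2 : ‖a‖ * ‖z‖ = 1 := by rw [← Complex.norm_conj a, ← norm_mul, h1, norm_one]
  nlinarith [norm_nonneg a, norm_nonneg z]

theorem normSq_mob_denom_sub (a z : ℂ) :
    ‖1 - (starRingEnd ℂ) a * z‖ ^ 2 - ‖z - a‖ ^ 2 = (1 - ‖a‖ ^ 2) * (1 - ‖z‖ ^ 2) := by
  simp only [Complex.sq_norm, Complex.normSq_apply, Complex.sub_re, Complex.sub_im,
    Complex.one_re, Complex.one_im, Complex.mul_re, Complex.mul_im, Complex.conj_re,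
    Complex.conj_im]
  ring

theorem norm_mob_le {a z : ℂ} (ha : ‖a‖ < 1) (hz : ‖z‖ ≤ 1) : ‖mob a z‖ ≤ 1 := by
  rw [mob, norm_div, div_le_one (norm_pos_iff.2 (mob_denom_ne_zero ha hz))]
  have := normSq_mob_denom_sub a z
  have h1 : 0 ≤ (1 - ‖a‖ ^ 2) * (1 - ‖z‖ ^ 2) :=
    mul_nonneg (by nlinarith [norm_nonneg a]) (by nlinarith [norm_nonneg z])
  exact le_of_sq_le_sq (by linarith) (norm_nonneg _)

theorem norm_mob_lt {a z : ℂ} (ha : ‖a‖ < 1) (hz : ‖z‖ < 1) : ‖mob a z‖ < 1 := by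
  rw [mob, norm_div, div_lt_one (norm_pos_iff.2 (mob_denom_ne_zero ha hz.le))]
  have := normSq_mob_denom_sub a z
  have h1 : 0 < (1 - ‖a‖ ^ 2) * (1 - ‖z‖ ^ 2) :=
    mul_pos (by nlinarith [norm_nonneg a]) (by nlinarith [norm_nonneg z])
  exact lt_of_pow_lt_pow_left₀ 2 (norm_nonneg _) (by linarith)

theorem mob_neg_mob {a z : ℂ} (ha : ‖a‖ < 1) (hz : ‖z‖ ≤ 1) : mob (-a) (mob a z) = z := by
  have h := mob_denom_ne_zero ha hz
  have h' : 1 - (starRingEnd ℂ) a * a ≠ 0 := mob_denom_ne_zero ha ha.le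
  have h3 := mob_denom_ne_zero (a := -a) (by simpa using ha) (norm_mob_le ha hz)
  have h4 : mob a z * (1 - (starRingEnd ℂ) a * z) = z - a := div_mul_cancel₀ _ h
  rw [show mob (-a) (mob a z) = (mob a z - -a) / (1 - (starRingEnd ℂ) (-a) * mob a z) from rfl,
    div_eq_iff h3, map_neg]
  linear_combination h4

theorem hasDerivAt_mob {a z : ℂ} (ha : ‖a‖ < 1) (hz : ‖z‖ ≤ 1) :
    HasDerivAt (mob a) ((1 - ‖a‖ ^ 2) / (1 - (starRingEnd ℂ) a * z) ^ 2) z := by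
  have h := mob_denom_ne_zero ha hz
  have h1 : HasDerivAt (fun z => z - a) 1 z := (hasDerivAt_id z).sub_const a
  have h2 : HasDerivAt (fun z => 1 - (starRingEnd ℂ) a * z) (-(starRingEnd ℂ) a) z := by
    simpa using ((hasDerivAt_id z).const_mul ((starRingEnd ℂ) a)).const_sub 1
  have := h1.fun_div h2 h
  refine this.congr_deriv ?_
  rw [← Complex.mul_conj']
  ring

theorem differentiableOn_mob {a : ℂ} (ha : ‖a‖ < 1) :
    DifferentiableOn ℂ (mob a) (Metric.closedBall 0 1) := fun z hz =>
  (hasDerivAt_mob ha (by simpa using hz)).differentiableAt.differentiableWithinAt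

theorem DiscDomain.mob {V : Set ℂ} (hV : DiscDomain V) {a : ℂ} (ha : ‖a‖ < 1) :
    DiscDomain (mob a '' V) ∧ Biholo V (mob a '' V) (mob a) (mob (-a)) := by
  have ha' : ‖-a‖ < 1 := by simpa using ha
  have hinv : ∀ z, ‖z‖ ≤ 1 → _root_.mob a (_root_.mob (-a) z) = z := fun z hz => by
    have := mob_neg_mob ha' hz
    rwa [neg_neg] at this
  have hVn : ∀ z ∈ V, ‖z‖ < 1 := fun z hz => by simpa using hV.sub hz
  have him : _root_.mob a '' V = Metric.ball 0 1 ∩ _root_.mob (-a) ⁻¹' V := by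
    ext w
    constructor
    · rintro ⟨z, hz, rfl⟩
      refine ⟨by simpa using norm_mob_lt ha (hVn z hz), ?_⟩
      rw [mem_preimage, mob_neg_mob ha (hVn z hz).le]; exact hz
    · rintro ⟨hw, hw'⟩
      exact ⟨_, hw', hinv w (by simpa using (Metric.ball_subset_closedBall hw))⟩
  have hsub : _root_.mob a '' V ⊆ Metric.ball 0 1 := him ▸ inter_subset_left
  refine ⟨⟨?_, ?_, hsub, ?_⟩, ?_⟩
  · rw [him]
    exact ((differentiableOn_mob ha').continuousOn.mono
      Metric.ball_subset_closedBall).isOpen_inter_preimage Metric.isOpen_ball hV.isOpen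
  · exact hV.isPreconnected.image _ ((differentiableOn_mob ha).continuousOn.mono
      (hV.sub.trans Metric.ball_subset_closedBall))
  · have : Metric.closedBall 0 1 \ _root_.mob a '' V =
        _root_.mob a '' (Metric.closedBall 0 1 \ V) := by
      ext w
      constructor
      · rintro ⟨hw, hw'⟩
        have hw1 : ‖w‖ ≤ 1 := by simpa using hw
        refine ⟨_root_.mob (-a) w, ⟨by simpa using norm_mob_le ha' hw1, fun h => hw' ?_⟩,
          hinv w hw1⟩
        exact ⟨_, h, hinv w hw1⟩
      · rintro ⟨z, ⟨hz, hzV⟩, rfl⟩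
        have hz1 : ‖z‖ ≤ 1 := by simpa using hz
        refine ⟨by simpa using norm_mob_le ha hz1, ?_⟩
        rintro ⟨z', hz', h⟩
        have := congrArg (_root_.mob (-a)) h
        rw [mob_neg_mob ha hz1, mob_neg_mob ha (hVn z' hz').le] at this
        exact hzV (this ▸ hz')
    rw [this]
    exact hV.compl.image _ ((differentiableOn_mob ha).continuousOn.mono sdiff_subset)
  · exact {
      df := (differentiableOn_mob ha).mono (hV.sub.trans Metric.ball_subset_closedBall)
      dg := (differentiableOn_mob ha').mono (hsub.trans Metric.ball_subset_closedBall)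
      mf := mapsTo_image _ _
      mg := fun w hw => (him ▸ hw).2
      gf := fun z hz => mob_neg_mob ha (hVn z hz).le
      fg := fun w hw => hinv w (by simpa using Metric.ball_subset_closedBall (hsub hw)) }

theorem hasDerivAt_of_sq_eq {s : ℂ → ℂ} {V : Set ℂ} (hV : IsOpen V) (hs : ContinuousOn s V)
    (hsq : ∀ z ∈ V, s z ^ 2 = z) {z : ℂ} (hz : z ∈ V) (hz0 : z ≠ 0) :
    HasDerivAt s (2 * s z)⁻¹ z := by
  have h0 : s z ≠ 0 := fun h => hz0 (by rw [← hsq z hz, h]; simp)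
  refine HasDerivAt.of_local_left_inverse (f := fun w => w ^ 2)
    (hs.continuousAt (hV.mem_nhds hz)) ?_ (by simpa using h0) ?_
  · simpa using hasDerivAt_pow 2 (s z)
  · filter_upwards [hV.mem_nhds hz] with y hy using hsq y hy

theorem DiscDomain.exists_sqrt {V : Set ℂ} (hV : DiscDomain V) (h0 : (0 : ℂ) ∉ V) :
    ∃ s : ℂ → ℂ, DiscDomain (s '' V) ∧ Biholo V (s '' V) s (fun w => w ^ 2) := by
  rcases V.eq_empty_or_nonempty with rfl | hVne
  · exact ⟨id, by simpa using hV, by constructor <;> simp [DifferentiableOn, MapsTo]⟩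
  have hcl : IsClosed (Metric.closedBall 0 1 \ V) := Metric.isClosed_closedBall.sdiff hV.isOpen
  have h1V : (1 : ℂ) ∉ V := fun h => by simpa using hV.sub h
  obtain ⟨L, hL, hLe⟩ := exists_log_div hV.compl hcl hV.isOpen hV.isPreconnected
    (fun z hz h => h.2 hz) (a := 0) (b := 1) ⟨by simp, h0⟩ ⟨by simp, h1V⟩
  have hVn : ∀ z ∈ V, ‖z‖ < 1 := fun z hz => by simpa using hV.sub hz
  have hslit : ∀ z ∈ V, 1 - z ∈ Complex.slitPlane := fun z hz => by
    rw [sub_eq_add_neg]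
    exact Complex.mem_slitPlane_of_norm_lt_one (by simpa using hVn z hz)
  set s : ℂ → ℂ := fun z =>
    Complex.exp ((L z + Complex.log (1 - z) + Real.pi * Complex.I) / 2) with hs
  have hsc : ContinuousOn s V := by
    refine ContinuousOn.cexp (ContinuousOn.div_const (ContinuousOn.add (hL.add ?_)
      continuousOn_const) _)
    exact ContinuousOn.clog (by fun_prop) hslit
  have hsq : ∀ z ∈ V, s z ^ 2 = z := by
    intro z hz
    have h1 : z - 1 ≠ 0 := sub_ne_zero.2 fun h => h1V (h ▸ hz)
    have h2 : 1 - z ≠ 0 := fun h => h1 (by linear_combination -h)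
    rw [hs, ← Complex.exp_nat_mul]
    push_cast
    rw [mul_div_cancel₀ _ (two_ne_zero), Complex.exp_add, Complex.exp_add, hLe z hz,
      Complex.exp_log h2, Complex.exp_pi_mul_I]
    field_simp
    ring
  have hVz : ∀ z ∈ V, z ≠ 0 := fun z hz h => h0 (h ▸ hz)
  have hsn : ∀ z ∈ V, ‖s z‖ < 1 := fun z hz => by
    have := hVn z hz
    rw [← hsq z hz, norm_pow] at this
    exact (pow_lt_one_iff_of_nonneg (norm_nonneg _) two_ne_zero).1 this
  have hsne : ∀ z ∈ V, ∀ z' ∈ V, s z ≠ -s z' := by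
    intro z hz z' hz' h
    have e : z = z' := by rw [← hsq z hz, h, neg_sq, hsq z' hz']
    subst e
    have : s z = 0 := by linear_combination h / 2
    exact hVz z hz (by rw [← hsq z hz, this]; simp)
  have him : s '' V = (fun w => w ^ 2) ⁻¹' V ∩
      (fun w : ℂ => (w ^ 2, s (w ^ 2) + w)) ⁻¹' (univ ×ˢ {0}ᶜ) := by
    ext w
    constructor
    · rintro ⟨z, hz, rfl⟩
      refine ⟨by simpa [hsq z hz] using hz, mem_univ _, ?_⟩
      simp only [hsq z hz, mem_compl_iff, mem_singleton_iff]
      exact fun h => hsne z hz z hz (by linear_combination h)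
    · rintro ⟨hw, -, hw'⟩
      refine ⟨w ^ 2, hw, ?_⟩
      rcases sq_eq_sq_iff_eq_or_eq_neg.1 (hsq _ hw) with h | h
      · exact h
      · refine absurd ?_ hw'
        change s (w ^ 2) + w = 0
        rw [h, neg_add_cancel]
  have hsq_open : IsOpen ((fun w : ℂ => w ^ 2) ⁻¹' V) := hV.isOpen.preimage (by fun_prop)
  have hopen : IsOpen (s '' V) := by
    rw [him]
    refine ContinuousOn.isOpen_inter_preimage ?_ hsq_open (isOpen_univ.prod isOpen_compl_singleton)
    exact ContinuousOn.prodMk (by fun_prop) ((hsc.comp (f := fun w : ℂ => w ^ 2) (by fun_prop)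
      fun w hw => hw).add (g := fun w : ℂ => w) (by fun_prop))
  have hpre : IsPreconnected (s '' V) := hV.isPreconnected.image _ hsc
  have hsub : s '' V ⊆ Metric.ball 0 1 := by
    rintro _ ⟨z, hz, rfl⟩; simpa using hsn z hz
  refine ⟨s, ⟨hopen, hpre, hsub, ?_⟩, ?_⟩
  · set Q : Set ℂ := Metric.closedBall 0 1 ∩ (fun w => w ^ 2) ⁻¹' (Metric.closedBall 0 1 \ V)
      with hQ
    have hQc : IsCompact Q := (isCompact_closedBall 0 1).inter_right (hcl.preimage (by fun_prop))
    have hQimg : (fun w : ℂ => w ^ 2) '' Q = Metric.closedBall 0 1 \ V := by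
      refine Subset.antisymm ?_ fun z hz => ?_
      · rintro _ ⟨w, hw, rfl⟩; exact hw.2
      · obtain ⟨w, hw⟩ := IsSquare.exists_sq z (by
          exact ⟨z ^ (1 / 2 : ℂ), by rw [← sq, ← Complex.cpow_nat_mul]; simp⟩)
        refine ⟨w, ⟨?_, ?_⟩, hw.symm⟩
        · have : ‖z‖ ≤ 1 := by simpa using hz.1
          rw [hw, norm_pow] at this
          simpa using (pow_le_one_iff_of_nonneg (norm_nonneg w) two_ne_zero).1 this
        · show w ^ 2 ∈ Metric.closedBall 0 1 \ V
          rw [← hw]; exact hz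
    have hQp : IsPreconnected Q := by
      refine hQc.isPreconnected_of_involution (j := fun w => w ^ 2) (ι := fun w => -w) (x0 := 0)
        (by fun_prop) (by fun_prop) (fun w hw => ⟨by simpa using hw.1, ?_⟩) (by simp)
        (fun x _ y _ h => ?_) ⟨by simp, ?_⟩ (by simp) (hQimg ▸ hV.compl)
      · have := hw.2
        simpa using this
      · rcases sq_eq_sq_iff_eq_or_eq_neg.1 h with h | h
        · exact Or.inl h.symm
        · exact Or.inr (by rw [h, neg_neg])
      · simpa using h0
    have hnV : IsPreconnected (Neg.neg '' (s '' V)) := hpre.image _ continuousOn_neg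
    have hnVo : IsOpen (Neg.neg '' (s '' V)) := by
      rw [image_neg_eq_neg]; exact hopen.neg
    have hdisj : ∀ y, y ∈ Neg.neg '' (s '' V) → y ∉ s '' V := by
      rintro _ ⟨_, ⟨z, hz, rfl⟩, rfl⟩ ⟨z', hz', h⟩
      exact hsne z' hz' z hz h
    have hnsub : Neg.neg '' (s '' V) ⊆ Metric.ball 0 1 := by
      rintro _ ⟨w, hw, rfl⟩
      simpa using hsub hw
    have hfr : frontier (Neg.neg '' (s '' V)) ⊆ Q := by
      intro y hy
      rw [hnVo.frontier_eq] at hy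
      have hy1 : y ∈ Metric.closedBall (0 : ℂ) 1 :=
        closure_minimal (hnsub.trans Metric.ball_subset_closedBall) Metric.isClosed_closedBall hy.1
      refine ⟨hy1, ?_, fun hyV => ?_⟩
      · have : ‖y‖ ≤ 1 := by simpa using hy1
        rw [mem_closedBall_zero_iff, norm_pow]
        exact pow_le_one₀ (norm_nonneg y) this
      · have hyV' : y ^ 2 ∈ V := hyV
        rcases sq_eq_sq_iff_eq_or_eq_neg.1 (hsq _ hyV') with h | h
        · obtain ⟨w, hw1, hw2⟩ := mem_closure_iff.1 hy.1 _ hopen ⟨_, hyV', h⟩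
          exact hdisj w hw2 hw1
        · exact hy.2 ⟨s (y ^ 2), mem_image_of_mem _ hyV', by rw [h, neg_neg]⟩
    have : Metric.closedBall 0 1 \ s '' V = Q ∪ Neg.neg '' (s '' V) := by
      ext w
      constructor
      · rintro ⟨hw, hw'⟩
        by_cases hwV : w ^ 2 ∈ V
        · right
          rcases sq_eq_sq_iff_eq_or_eq_neg.1 (hsq _ hwV) with h | h
          · exact absurd ⟨_, hwV, h⟩ hw'
          · exact ⟨s (w ^ 2), mem_image_of_mem _ hwV, by rw [h, neg_neg]⟩
        · left
          have : ‖w‖ ≤ 1 := by simpa using hw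
          exact ⟨hw, by rw [mem_closedBall_zero_iff, norm_pow]; exact pow_le_one₀ (norm_nonneg w) this,
            hwV⟩
      · rintro (hw | hw)
        · refine ⟨hw.1, ?_⟩
          rintro ⟨z, hz, rfl⟩
          have := hw.2.2
          simp only [hsq z hz] at this
          exact this hz
        · exact ⟨Metric.ball_subset_closedBall (hnsub hw), hdisj w hw⟩
    rw [this]
    refine hQp.union_of_frontier_subset hnV ((hVne.image _).image _) ?_ hfr
    intro h
    have := hnsub (h ▸ mem_univ (2 : ℂ))
    simp at this
  · exact {
      df := fun z hz => (hasDerivAt_of_sq_eq hV.isOpen hsc hsq hz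
        (hVz z hz)).differentiableAt.differentiableWithinAt
      dg := by fun_prop
      mf := mapsTo_image _ _
      mg := by rintro _ ⟨z, hz, rfl⟩; simpa [hsq z hz] using hz
      gf := hsq
      fg := by rintro _ ⟨z, hz, rfl⟩; simp only [hsq z hz] }

theorem DiscDomain.exists_enlargement {V : Set ℂ} (hV : DiscDomain V) (h0 : (0 : ℂ) ∈ V) {a : ℂ}
    (ha : ‖a‖ < 1) (haV : a ∉ V) :
    ∃ (W : Set ℂ) (f g : ℂ → ℂ), DiscDomain W ∧ 0 ∈ W ∧ Biholo V W f g ∧ f 0 = 0 ∧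
      ∃ d : ℂ, HasDerivAt f d 0 ∧ ‖d‖ * (2 * √‖a‖) = 1 + ‖a‖ := by
  obtain ⟨h1, h2⟩ := hV.mob ha
  have hVn : ∀ z ∈ V, ‖z‖ < 1 := fun z hz => by simpa using hV.sub hz
  have h01 : (0 : ℂ) ∉ _root_.mob a '' V := by
    rintro ⟨z, hz, h⟩
    rw [_root_.mob, div_eq_zero_iff] at h
    rcases h with h | h
    · exact haV (sub_eq_zero.1 h ▸ hz)
    · exact mob_denom_ne_zero ha (hVn z hz).le h
  obtain ⟨s, h3, h4⟩ := h1.exists_sqrt h01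
  have hm0 : _root_.mob a 0 = -a := by simp [_root_.mob]
  have hna : -a ∈ _root_.mob a '' V := ⟨0, h0, hm0⟩
  set b := s (-a) with hb
  have hbW : b ∈ s '' (_root_.mob a '' V) := mem_image_of_mem _ hna
  have hb2 : b ^ 2 = -a := h4.gf _ hna
  have hb1 : ‖b‖ < 1 := by simpa using h3.sub hbW
  have hnb : ‖b‖ ^ 2 = ‖a‖ := by rw [← norm_pow, hb2, norm_neg]
  have hna0 : -a ≠ 0 := fun h => h01 (h ▸ hna)
  have hb0 : 0 < ‖b‖ := norm_pos_iff.2 fun h => hna0 (by rw [← hb2, h]; simp)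
  obtain ⟨h5, h6⟩ := h3.mob hb1
  have hbb : _root_.mob b b = 0 := by simp [_root_.mob]
  refine ⟨_, _, _, h5, ⟨b, hbW, hbb⟩, (h2.trans h4).trans h6, by simp [hm0, ← hb, hbb], ?_⟩
  have d1 := hasDerivAt_mob ha (z := 0) (by simp)
  have d2 : HasDerivAt s (2 * s (_root_.mob a 0))⁻¹ (_root_.mob a 0) := by
    rw [hm0]
    exact hasDerivAt_of_sq_eq h1.isOpen h4.df.continuousOn h4.gf hna hna0
  have d3 : HasDerivAt (_root_.mob b) ((1 - ‖b‖ ^ 2) / (1 - (starRingEnd ℂ) b * b) ^ 2) ((s ∘ _root_.mob a) 0) := by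
    rw [Function.comp_apply, hm0]
    exact hasDerivAt_mob hb1 hb1.le
  refine ⟨_, d3.comp 0 (d2.comp 0 d1), ?_⟩
  have e1 : (1 : ℂ) - (starRingEnd ℂ) b * b = ((1 - ‖b‖ ^ 2 : ℝ) : ℂ) := by
    rw [Complex.conj_mul']; push_cast; ring
  have e2 : (1 : ℂ) - (‖a‖ : ℂ) ^ 2 = ((1 - ‖a‖ ^ 2 : ℝ) : ℂ) := by push_cast; ring
  have e3 : (1 : ℂ) - (‖b‖ : ℂ) ^ 2 = ((1 - ‖b‖ ^ 2 : ℝ) : ℂ) := by push_cast; ring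
  have p1 : 0 < 1 - ‖b‖ ^ 2 := by nlinarith
  have p2 : 0 < 1 - ‖a‖ ^ 2 := by nlinarith [norm_nonneg a]
  have hsq : √‖a‖ = ‖b‖ := by rw [← hnb, Real.sqrt_sq hb0.le]
  rw [hm0, ← hb, e1, e2, e3, mul_zero, sub_zero, one_pow, div_one, norm_mul, norm_mul, norm_div,
    norm_pow, norm_inv, norm_mul, Complex.norm_real, Complex.norm_real, Complex.norm_two,
    Real.norm_of_nonneg p1.le, Real.norm_of_nonneg p2.le, hsq, ← hnb]
  field_simp
  ring

theorem tendstoLocallyUniformlyOn_of_norm_le_one {ι : Type*} {p : Filter ι} [p.NeBot]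
    {F : ι → ℂ → ℂ} {G : ℂ → ℂ} {U : Set ℂ}
    (hF : ∀ z ∈ U, ∃ ρ > 0, Metric.ball z ρ ⊆ U ∧ ∀ᶠ n in p,
      DifferentiableOn ℂ (F n) (Metric.ball z ρ) ∧ ∀ w ∈ Metric.ball z ρ, ‖F n w‖ ≤ 1)
    (hlim : ∀ z ∈ U, Tendsto (fun n => F n z) p (𝓝 (G z))) :
    TendstoLocallyUniformlyOn F G p U := by
  rw [Metric.tendstoLocallyUniformlyOn_iff]
  intro ε hε z hz
  obtain ⟨ρ, hρ, hρU, hev⟩ := hF z hz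
  have hlip : ∀ᶠ n in p, ∀ w ∈ Metric.ball z ρ, dist (F n w) (F n z) ≤ 3 / ρ * dist w z := by
    filter_upwards [hev] with n hn w hw
    refine Complex.dist_le_div_mul_dist_of_mapsTo_ball hn.1 (fun y hy => ?_) hw
    rw [Metric.mem_closedBall, dist_eq_norm]
    have h1 := hn.2 y hy
    have h2 := hn.2 z (Metric.mem_ball_self hρ)
    have := norm_sub_le (F n y) (F n z)
    linarith
  have hlipG : ∀ w ∈ Metric.ball z ρ, dist (G w) (G z) ≤ 3 / ρ * dist w z := fun w hw =>
    le_of_tendsto ((hlim w (hρU hw)).dist (hlim z hz)) (hlip.mono fun n hn => hn w hw)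
  refine ⟨Metric.ball z (min ρ (ε * ρ / 9)), mem_nhdsWithin_of_mem_nhds
    (Metric.ball_mem_nhds z (by positivity)), ?_⟩
  filter_upwards [hlip, (Metric.tendsto_nhds.1 (hlim z hz)) (ε / 3) (by positivity)] with n hn hnz
  intro w hw
  have hwρ : w ∈ Metric.ball z ρ := Metric.ball_subset_ball (min_le_left _ _) hw
  have hwd : dist w z < ε * ρ / 9 := (Metric.mem_ball.1 hw).trans_le (min_le_right _ _)
  have h3 : 3 / ρ * dist w z < ε / 3 := by
    calc 3 / ρ * dist w z < 3 / ρ * (ε * ρ / 9) := by gcongr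
      _ = ε / 3 := by field_simp; norm_num
  have h1 := hn w hwρ
  have h2 := hlipG w hwρ
  rw [dist_comm] at hnz
  calc dist (G w) (F n w) ≤ dist (G w) (G z) + dist (G z) (F n z) + dist (F n z) (F n w) :=
        dist_triangle4 _ _ _ _
    _ < ε := by rw [dist_comm (F n z)]; linarith

theorem eqOn_of_tendstoLocallyUniformlyOn_of_omits {ι : Type*} {p : Filter ι} [p.NeBot]
    {F : ι → ℂ → ℂ} {G : ℂ → ℂ} {U : Set ℂ} (hU : IsOpen U) (hUc : IsPreconnected U) {b : ℂ}
    (hF : ∀ z ∈ U, ∃ ρ > 0, Metric.ball z ρ ⊆ U ∧ ∀ᶠ n in p,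
      DifferentiableOn ℂ (F n) (Metric.ball z ρ) ∧ ∀ w ∈ Metric.ball z ρ, F n w ≠ b)
    (hlim : TendstoLocallyUniformlyOn F G p U) (hG : DifferentiableOn ℂ G U) {z : ℂ} (hz : z ∈ U)
    (hGz : G z = b) : ∀ w ∈ U, G w = b := by
  have hA : AnalyticOnNhd ℂ (fun w => G w - b) U :=
    (hG.sub_const b).analyticOnNhd hU
  rcases (hA z hz).eventually_eq_zero_or_eventually_ne_zero with h | h
  · intro w hw
    exact sub_eq_zero.1 (hA.eqOn_zero_of_preconnected_of_eventuallyEq_zero hUc hz h hw)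
  exfalso
  obtain ⟨ρ, hρ, hρU, hev⟩ := hF z hz
  rw [eventually_nhdsWithin_iff, Metric.eventually_nhds_iff_ball] at h
  obtain ⟨ε, hε, hεb⟩ := h
  set d := min ε ρ / 2 with hd
  have hd0 : 0 < d := by positivity
  have hdε : d < ε := by have := min_le_left ε ρ; have : 0 < min ε ρ := by positivity
                         linarith
  have hdρ : d < ρ := by have := min_le_right ε ρ; have : 0 < min ε ρ := by positivity
                         linarith
  have hsub : Metric.sphere z d ⊆ U := (Metric.sphere_subset_closedBall.trans
    (Metric.closedBall_subset_ball hdρ)).trans hρU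
  obtain ⟨m, hm, hmb⟩ : ∃ m > 0, ∀ w ∈ Metric.sphere z d, m ≤ ‖G w - b‖ := by
    have hc : IsCompact (Metric.sphere z d) := isCompact_sphere z d
    have hne : (Metric.sphere z d).Nonempty := NormedSpace.sphere_nonempty.2 hd0.le
    obtain ⟨w, hw, hmin⟩ := hc.exists_isMinOn hne
      (f := fun w => ‖G w - b‖) ((hA.continuousOn.mono hsub).norm)
    refine ⟨‖G w - b‖, norm_pos_iff.2 (hεb w ?_ ?_), fun y hy => hmin hy⟩
    · rw [Metric.mem_ball, Metric.mem_sphere.1 hw]; exact hdε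
    · rintro rfl
      rw [Metric.mem_sphere, dist_self] at hw
      exact hd0.ne hw
  have hunif := (tendstoLocallyUniformlyOn_iff_forall_isCompact hU).1 hlim _ hsub
    (isCompact_sphere z d)
  have hpt := hlim.tendsto_at hz
  obtain ⟨n, hn1, hn2, hn3⟩ := (hev.and ((Metric.tendstoUniformlyOn_iff.1 hunif (m / 2)
    (by positivity)).and ((Metric.tendsto_nhds.1 hpt) (m / 2) (by positivity)))).exists
  have hcb : Metric.closedBall z d ⊆ Metric.ball z ρ := Metric.closedBall_subset_ball hdρ
  have hne : ∀ w ∈ Metric.ball z ρ, F n w - b ≠ 0 := fun w hw => sub_ne_zero.2 (hn1.2 w hw)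
  have hdiff : DifferentiableOn ℂ (fun w => (F n w - b)⁻¹) (Metric.ball z ρ) :=
    (hn1.1.sub_const b).fun_inv hne
  have hbd : ‖(F n z - b)⁻¹‖ ≤ (m / 2)⁻¹ := by
    refine Complex.norm_le_of_forall_mem_frontier_norm_le (U := Metric.ball z d)
      (f := fun w => (F n w - b)⁻¹) Metric.isBounded_ball
      (DifferentiableOn.diffContOnCl (hdiff.mono ?_)) (fun w hw => ?_)
      (subset_closure (Metric.mem_ball_self hd0))
    · exact Metric.closure_ball_subset_closedBall.trans hcb
    · have hw' : w ∈ Metric.sphere z d := Metric.frontier_ball_subset_sphere hw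
      rw [norm_inv]
      have h1 := hmb w hw'
      have h2 := hn2 w hw'
      rw [dist_eq_norm] at h2
      have h3 := norm_sub_norm_le (G w - b) (G w - F n w)
      have e : G w - b - (G w - F n w) = F n w - b := by ring
      rw [e] at h3
      gcongr
      linarith
  rw [norm_inv] at hbd
  have h0 := norm_pos_iff.2 (hne z (Metric.mem_ball_self hρ))
  have := (inv_le_inv₀ h0 (by positivity)).1 hbd
  rw [dist_eq_norm, hGz] at hn3
  linarith

theorem DiscDomain.exists_biholo_ball_subset {U : Set ℂ} (hU : DiscDomain U) (h0 : (0 : ℂ) ∈ U)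
    {r : ℝ} (hr : r < 1) :
    ∃ (V : Set ℂ) (f g : ℂ → ℂ), DiscDomain V ∧ Biholo U V f g ∧ f 0 = 0 ∧
      Metric.ball 0 r ⊆ V := by
  set S : Set ℝ := {x | ∃ (V : Set ℂ) (f g : ℂ → ℂ), DiscDomain V ∧ Biholo U V f g ∧ f 0 = 0 ∧
    x = ‖deriv f 0‖} with hS
  obtain ⟨ρ, hρ, hρU⟩ := Metric.isOpen_iff.1 hU.isOpen 0 h0
  have hbdd : BddAbove S := by
    refine ⟨1 / ρ, ?_⟩
    rintro _ ⟨V, f, g, hV, hb, hf0, rfl⟩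
    refine Complex.norm_deriv_le_div_of_mapsTo_ball (hb.df.mono hρU) (fun z hz => ?_) hρ
    rw [hf0]
    exact Metric.ball_subset_closedBall (hV.sub (hb.mf (hρU hz)))
  have h1S : (1 : ℝ) ∈ S :=
    ⟨U, id, id, hU, ⟨differentiableOn_id, differentiableOn_id, mapsTo_id _, mapsTo_id _,
      fun _ _ => rfl, fun _ _ => rfl⟩, rfl, by simp⟩
  have hM : 1 ≤ sSup S := le_csSup hbdd h1S
  set k : ℝ := 1 + (1 - √r) ^ 2 / 2 with hk
  have hq1 : √r < 1 := by rw [Real.sqrt_lt' one_pos]; simpa using hr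
  have hk1 : 1 < k := by have : 0 < (1 - √r) ^ 2 := by have : 0 < 1 - √r := by linarith
                                                       positivity
                         linarith
  obtain ⟨_, ⟨V, f, g, hV, hb, hf0, rfl⟩, hx⟩ := exists_lt_of_lt_csSup ⟨1, h1S⟩
    (div_lt_self (by linarith) hk1 : sSup S / k < sSup S)
  refine ⟨V, f, g, hV, hb, hf0, fun a ha => ?_⟩
  by_contra haV
  have har : ‖a‖ < r := by simpa using ha
  have h0V : (0 : ℂ) ∈ V := hf0 ▸ hb.mf h0
  obtain ⟨W, f', g', hW, -, hb', hf0', d, hd, hde⟩ := hV.exists_enlargement h0V (har.trans hr) haV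
  have ha0 : 0 < ‖a‖ := norm_pos_iff.2 fun h => haV (h ▸ h0V)
  have hfd : HasDerivAt f (deriv f 0) 0 :=
    ((hb.df 0 h0).differentiableAt (hU.isOpen.mem_nhds h0)).hasDerivAt
  have hcomp : HasDerivAt (f' ∘ f) (d * deriv f 0) 0 :=
    HasDerivAt.comp 0 (by rw [hf0]; exact hd) hfd
  have hmem : ‖d * deriv f 0‖ ∈ S :=
    ⟨W, _, _, hW, hb.trans hb', by simp [hf0, hf0'], by rw [hcomp.deriv]⟩
  have hle := le_csSup hbdd hmem
  have hdk : k ≤ ‖d‖ := by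
    set t := √‖a‖ with ht
    have ht0 : 0 < t := Real.sqrt_pos.2 ha0
    have htq : t ≤ √r := Real.sqrt_le_sqrt har.le
    have hta : ‖a‖ = t ^ 2 := (Real.sq_sqrt ha0.le).symm
    rw [hta] at hde
    have h2 : k * (2 * t) ≤ ‖d‖ * (2 * t) := by
      rw [hde, hk]
      have h3 : (1 - √r) ^ 2 ≤ (1 - t) ^ 2 := by
        apply pow_le_pow_left₀ <;> linarith
      nlinarith [mul_le_mul_of_nonneg_left h3 ht0.le, sq_nonneg (1 - t)]
    exact le_of_mul_le_mul_right h2 (by positivity)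
  rw [norm_mul] at hle
  rw [div_lt_iff₀ (by linarith)] at hx
  nlinarith [norm_nonneg (deriv f 0)]

theorem Ultrafilter.exists_tendsto_of_norm_le {ι : Type*} (p : Ultrafilter ι) {u : ι → ℂ}
    (hu : ∀ᶠ n in p, ‖u n‖ ≤ 1) : ∃ l, Tendsto u p (𝓝 l) := by
  obtain ⟨l, -, hl⟩ := (isCompact_closedBall (0 : ℂ) 1).ultrafilter_le_nhds (p.map u) (by
    rw [le_principal_iff]
    exact hu.mono fun n hn => mem_closedBall_zero_iff.2 hn)
  exact ⟨l, hl⟩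

/-- The Riemann mapping theorem for disc domains. -/
theorem DiscDomain.exists_biholo_ball {U : Set ℂ} (hU : DiscDomain U) (h0 : (0 : ℂ) ∈ U) :
    ∃ f g : ℂ → ℂ, Biholo U (Metric.ball 0 1) f g ∧ f 0 = 0 := by
  have hr : ∀ n : ℕ, 1 - 1 / ((n : ℝ) + 1) < 1 := fun n => by
    have := one_div_pos.2 (by positivity : (0 : ℝ) < (n : ℝ) + 1)
    linarith
  choose V f g hV hb hf0 hrV using fun n : ℕ =>
    hU.exists_biholo_ball_subset h0 (hr n)
  set p : Ultrafilter ℕ := hyperfilter ℕ with hp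
  have hpt : (p : Filter ℕ) ≤ atTop := Nat.hyperfilter_le_atTop
  have hVev : ∀ r < 1, ∀ᶠ n in p, Metric.ball (0 : ℂ) r ⊆ V n := by
    intro r hr
    have : ∀ᶠ n : ℕ in atTop, r < 1 - 1 / ((n : ℝ) + 1) := by
      have h := tendsto_one_div_add_atTop_nhds_zero_nat (𝕜 := ℝ)
      have h' : Tendsto (fun n : ℕ => 1 - 1 / ((n : ℝ) + 1)) atTop (𝓝 1) := by
        simpa using h.const_sub 1
      exact h'.eventually_const_lt hr
    filter_upwards [hpt this] with n hn
    exact (Metric.ball_subset_ball hn.le).trans (hrV n)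
  have hUn : ∀ z ∈ U, ‖z‖ < 1 := fun z hz => by simpa using hU.sub hz
  have hVn : ∀ n, ∀ z ∈ V n, ‖z‖ < 1 := fun n z hz => by simpa using (hV n).sub hz
  have hballV : ∀ z ∈ Metric.ball (0 : ℂ) 1, ∃ ρ > 0, Metric.ball z ρ ⊆ Metric.ball 0 1 ∧
      ∀ᶠ n in p, Metric.ball z ρ ⊆ V n := by
    intro z hz
    have hz1 : ‖z‖ < 1 := by simpa using hz
    have hsub : Metric.ball z ((1 - ‖z‖) / 2) ⊆ Metric.ball 0 ((1 + ‖z‖) / 2) :=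
      Metric.ball_subset_ball' (by rw [dist_zero_right]; linarith)
    refine ⟨(1 - ‖z‖) / 2, by linarith, hsub.trans (Metric.ball_subset_ball (by linarith)), ?_⟩
    filter_upwards [hVev ((1 + ‖z‖) / 2) (by linarith)] with n hn using hsub.trans hn
  have hFex : ∀ z, ∃ l, z ∈ U → Tendsto (fun n => f n z) p (𝓝 l) := fun z => by
    by_cases hz : z ∈ U
    · obtain ⟨l, hl⟩ := p.exists_tendsto_of_norm_le (u := fun n => f n z)
        (Eventually.of_forall fun n => (hVn n _ ((hb n).mf hz)).le)
      exact ⟨l, fun _ => hl⟩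
    · exact ⟨0, fun h => absurd h hz⟩
  choose F hF using hFex
  have hGex : ∀ z, ∃ l, z ∈ Metric.ball (0 : ℂ) 1 → Tendsto (fun n => g n z) p (𝓝 l) := fun z => by
    by_cases hz : z ∈ Metric.ball (0 : ℂ) 1
    · obtain ⟨ρ, hρ, -, hev⟩ := hballV z hz
      obtain ⟨l, hl⟩ := p.exists_tendsto_of_norm_le (u := fun n => g n z) (by
        filter_upwards [hev] with n hn using (hUn _ ((hb n).mg (hn (Metric.mem_ball_self hρ)))).le)
      exact ⟨l, fun _ => hl⟩
    · exact ⟨0, fun h => absurd h hz⟩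
  choose G hG using hGex
  have hUball : ∀ z ∈ U, ∃ ρ > 0, Metric.ball z ρ ⊆ U := Metric.isOpen_iff.1 hU.isOpen
  have hFl : TendstoLocallyUniformlyOn f F p U := by
    refine tendstoLocallyUniformlyOn_of_norm_le_one (fun z hz => ?_) hF
    obtain ⟨ρ, hρ, hρU⟩ := hUball z hz
    exact ⟨ρ, hρ, hρU, Eventually.of_forall fun n => ⟨(hb n).df.mono hρU,
      fun w hw => (hVn n _ ((hb n).mf (hρU hw))).le⟩⟩
  have hGl : TendstoLocallyUniformlyOn g G p (Metric.ball 0 1) := by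
    refine tendstoLocallyUniformlyOn_of_norm_le_one (fun z hz => ?_) hG
    obtain ⟨ρ, hρ, hρU, hev⟩ := hballV z hz
    refine ⟨ρ, hρ, hρU, ?_⟩
    filter_upwards [hev] with n hn
    exact ⟨(hb n).dg.mono hn, fun w hw => (hUn _ ((hb n).mg (hn hw))).le⟩
  have hFd : DifferentiableOn ℂ F U :=
    hFl.differentiableOn (Eventually.of_forall fun n => (hb n).df) hU.isOpen
  have hGd : DifferentiableOn ℂ G (Metric.ball 0 1) := by
    intro z hz
    obtain ⟨ρ, hρ, hρU, hev⟩ := hballV z hz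
    refine (((hGl.mono hρU).differentiableOn ?_ Metric.isOpen_ball).differentiableAt
      (Metric.ball_mem_nhds z hρ)).differentiableWithinAt
    filter_upwards [hev] with n hn using (hb n).dg.mono hn
  have hF0 : F 0 = 0 :=
    tendsto_nhds_unique (hF 0 h0) (by simp [hf0])
  have h0b : (0 : ℂ) ∈ Metric.ball (0 : ℂ) 1 := by simp
  have hG0 : G 0 = 0 := by
    refine tendsto_nhds_unique (hG 0 h0b) ?_
    have : ∀ n, g n 0 = 0 := fun n => by
      have := (hb n).gf 0 h0
      rwa [hf0 n] at this
    simp [this]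
  have hFm : MapsTo F U (Metric.ball 0 1) := by
    intro z hz
    by_contra hcon
    have := eqOn_of_tendstoLocallyUniformlyOn_of_omits hU.isOpen hU.isPreconnected (b := F z)
      (fun y hy => ?_) hFl hFd hz rfl 0 h0
    · exact hcon (by rw [← this, hF0]; simp)
    · obtain ⟨ρ, hρ, hρU⟩ := hUball y hy
      exact ⟨ρ, hρ, hρU, Eventually.of_forall fun n => ⟨(hb n).df.mono hρU,
        fun w hw h => hcon (h ▸ (hV n).sub ((hb n).mf (hρU hw)))⟩⟩
  have hGm : MapsTo G (Metric.ball 0 1) U := by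
    intro z hz
    by_contra hcon
    have := eqOn_of_tendstoLocallyUniformlyOn_of_omits Metric.isOpen_ball
      (convex_ball (0 : ℂ) 1).isPreconnected (b := G z) (fun y hy => ?_) hGl hGd hz rfl 0 h0b
    · exact hcon (by rw [← this, hG0]; exact h0)
    · obtain ⟨ρ, hρ, hρU, hev⟩ := hballV y hy
      refine ⟨ρ, hρ, hρU, ?_⟩
      filter_upwards [hev] with n hn
      exact ⟨(hb n).dg.mono hn, fun w hw h => hcon (h ▸ (hb n).mg (hn hw))⟩
  refine ⟨F, G, ⟨hFd, hGd, hFm, hGm, fun z hz => ?_, fun w hw => ?_⟩, hF0⟩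
  · have := hGl.tendsto_comp (hGd.continuousOn _ (hFm hz)) (hFm hz)
      (tendsto_nhdsWithin_iff.2 ⟨hF z hz, Eventually.of_forall fun n => (hV n).sub ((hb n).mf hz)⟩)
    exact tendsto_nhds_unique this (tendsto_const_nhds.congr fun n => ((hb n).gf z hz).symm)
  · obtain ⟨ρ, hρ, -, hev⟩ := hballV w hw
    have hev' : ∀ᶠ n in p, w ∈ V n := hev.mono fun n hn => hn (Metric.mem_ball_self hρ)
    have := hFl.tendsto_comp (hFd.continuousOn _ (hGm hw)) (hGm hw)
      (tendsto_nhdsWithin_iff.2 ⟨hG w hw, hev'.mono fun n hn => (hb n).mg hn⟩)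
    refine tendsto_nhds_unique this (tendsto_const_nhds.congr' ?_)
    filter_upwards [hev'] with n hn using ((hb n).fg w hn).symm

/-- A conformal parametrisation of the complement of `X` by the punctured unit disc. -/
structure ExteriorMap (X : Set ℂ) (ψ g : ℂ → ℂ) : Prop where
  dψ : DifferentiableOn ℂ ψ (Metric.ball 0 1 \ {0})
  cg : ContinuousOn g Xᶜ
  mψ : MapsTo ψ (Metric.ball 0 1 \ {0}) Xᶜ
  mg : MapsTo g Xᶜ (Metric.ball 0 1 \ {0})
  gψ : ∀ ζ ∈ Metric.ball (0 : ℂ) 1 \ {0}, g (ψ ζ) = ζ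
  ψg : ∀ z ∈ Xᶜ, ψ (g z) = z
  bdd : ∃ M, ∀ ζ ∈ Metric.ball (0 : ℂ) 1, 1 / 2 ≤ ‖ζ‖ → ‖ψ ζ‖ ≤ M
  lim : Tendsto (fun ζ => ‖ψ ζ‖) (𝓝[≠] 0) atTop

/-- The Joukowski map. -/
def jouk (v : ℂ) : ℂ := v + v⁻¹

theorem jouk_inv (v : ℂ) : jouk v⁻¹ = jouk v := by
  rw [jouk, jouk, inv_inv, add_comm]

theorem eq_or_eq_inv_of_jouk_eq {v w : ℂ} (hv : v ≠ 0) (hw : w ≠ 0) (h : jouk v = jouk w) :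
    v = w ∨ v = w⁻¹ := by
  have : (v - w) * (v - w⁻¹) = 0 := by
    have e : v * v⁻¹ = 1 := mul_inv_cancel₀ hv
    have e' : w * w⁻¹ = 1 := mul_inv_cancel₀ hw
    rw [jouk, jouk] at h
    linear_combination v * h - e + e'
  rcases mul_eq_zero.1 this with h | h
  · exact Or.inl (sub_eq_zero.1 h)
  · exact Or.inr (sub_eq_zero.1 h)

theorem continuousOn_jouk : ContinuousOn jouk {0}ᶜ :=
  continuousOn_id.add (continuousOn_id.inv₀ fun _ h => h)

theorem lt_norm_jouk {v : ℂ} {c : ℝ} (hc : 0 < c) (hv : v ≠ 0) (h : ‖v‖ < 1 / (c + 1)) :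
    c < ‖jouk v‖ := by
  have hv0 := norm_pos_iff.2 hv
  have h1 : c + 1 < ‖v‖⁻¹ := by rwa [lt_inv_comm₀ (by linarith) hv0, ← one_div]
  have h2 : ‖v‖ < 1 := h.trans (by rw [div_lt_one] <;> linarith)
  have h3 := norm_sub_norm_le v⁻¹ (-v)
  rw [norm_neg, norm_inv, sub_neg_eq_add, add_comm v⁻¹] at h3
  rw [jouk]
  linarith

theorem norm_le_of_norm_jouk_le {v : ℂ} {R : ℝ} (hR : 0 ≤ R) (h : ‖jouk v‖ ≤ R) : ‖v‖ ≤ R + 1 := by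
  rcases le_total ‖v‖ 1 with h1 | h1
  · linarith
  · have h2 : ‖v⁻¹‖ ≤ 1 := by rw [norm_inv]; exact inv_le_one_of_one_le₀ h1
    have h3 := norm_sub_le (jouk v) v⁻¹
    have e : jouk v - v⁻¹ = v := by rw [jouk]; ring
    rw [e] at h3
    linarith

/-- A branch of the inverse of the Joukowski map off a continuum containing `2` and `-2`. -/
theorem exists_jouk_inverse {X : Set ℂ} (hX : IsCompact X) (hXc : IsPreconnected X)
    (hlog : HasLogs X) (h2 : (2 : ℂ) ∈ X) (hm2 : (-2 : ℂ) ∈ X) {R : ℝ} (hR : 2 ≤ R)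
    (hXR : X ⊆ Metric.closedBall 0 R) :
    ∃ u : ℂ → ℂ, ContinuousOn u Xᶜ ∧ (∀ z ∈ Xᶜ, u z ≠ 0 ∧ jouk (u z) = z) ∧
      ∀ z, R < ‖z‖ → ‖u z‖ < 1 := by
  have hU := hX.isClosed.isOpen_compl
  obtain ⟨L, hL, hLe⟩ := exists_log_div hXc hX.isClosed hU (HasLogs.isPreconnected_compl hX hlog)
    Subset.rfl hm2 h2
  set s : ℂ → ℂ := fun z => (z - 2) * Complex.exp (L z / 2) with hs
  have hsc : ContinuousOn s Xᶜ := ContinuousOn.mul (by fun_prop)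
    (ContinuousOn.cexp (hL.div_const _))
  have hsq : ∀ z ∈ Xᶜ, s z ^ 2 = z ^ 2 - 4 := by
    intro z hz
    have hz2 : z - 2 ≠ 0 := sub_ne_zero.2 fun h => hz (h ▸ h2)
    have e : Complex.exp (L z / 2) ^ 2 = (z - -2) / (z - 2) := by
      rw [← hLe z hz, ← Complex.exp_nat_mul]
      congr 1
      push_cast
      ring
    rw [hs]
    simp only
    rw [mul_pow, e]
    field_simp
    ring
  set u : ℂ → ℂ := fun z => (z + s z) / 2 with hu
  have huc : ContinuousOn u Xᶜ := (continuousOn_id.add hsc).div_const 2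
  have hu1 : ∀ z ∈ Xᶜ, u z * (z - u z) = 1 := fun z hz => by
    have := hsq z hz
    simp only [hu]
    linear_combination -this / 4
  have hu0 : ∀ z ∈ Xᶜ, u z ≠ 0 := fun z hz h => by
    have := hu1 z hz
    simp [h] at this
  have huj : ∀ z ∈ Xᶜ, jouk (u z) = z := fun z hz => by
    have : (u z)⁻¹ = z - u z := inv_eq_of_mul_eq_one_right (hu1 z hz)
    rw [jouk, this]
    ring
  have hE : (Metric.closedBall (0 : ℂ) R)ᶜ ⊆ Xᶜ := compl_subset_compl.2 hXR
  have hne : ∀ z ∈ (Metric.closedBall (0 : ℂ) R)ᶜ, ‖u z‖ ≠ 1 := by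
    intro z hz h
    apply hz
    have h3 := norm_add_le (u z) (u z)⁻¹
    rw [show u z + (u z)⁻¹ = z from huj z (hE hz), norm_inv, h] at h3
    rw [mem_closedBall_zero_iff]
    linarith
  have hEp : IsPreconnected ((fun z => ‖u z‖) '' (Metric.closedBall (0 : ℂ) R)ᶜ) :=
    (isPreconnected_compl_closedBall R).image _ (huc.mono hE).norm
  by_cases hcase : ∀ z, R < ‖z‖ → ‖u z‖ < 1
  · exact ⟨u, huc, fun z hz => ⟨hu0 z hz, huj z hz⟩, hcase⟩
  push Not at hcase
  obtain ⟨z0, hz0, hz1⟩ := hcase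
  have hz0E : z0 ∈ (Metric.closedBall (0 : ℂ) R)ᶜ := by
    rw [mem_compl_iff, mem_closedBall_zero_iff]; exact not_le.2 hz0
  refine ⟨fun z => (u z)⁻¹, huc.inv₀ hu0, fun z hz => ⟨inv_ne_zero (hu0 z hz), by
    rw [jouk_inv, huj z hz]⟩, fun z hz => ?_⟩
  have hzE : z ∈ (Metric.closedBall (0 : ℂ) R)ᶜ := by
    rw [mem_compl_iff, mem_closedBall_zero_iff]; exact not_le.2 hz
  rw [norm_inv]
  refine inv_lt_one_of_one_lt₀ (not_le.1 fun hcon => ?_)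
  obtain ⟨y, hy, hy1⟩ := hEp.Icc_subset (mem_image_of_mem _ hzE) (mem_image_of_mem _ hz0E)
    ⟨hcon, hz1⟩
  exact hne y hy hy1

theorem exists_exteriorMap_of_two_mem {X : Set ℂ} (hX : IsCompact X) (hXc : IsPreconnected X)
    (hlog : HasLogs X) (h2 : (2 : ℂ) ∈ X) (hm2 : (-2 : ℂ) ∈ X) :
    ∃ ψ g, ExteriorMap X ψ g := by
  obtain ⟨R, hR, hXR⟩ : ∃ R : ℝ, 2 ≤ R ∧ X ⊆ Metric.closedBall 0 R := by
    obtain ⟨R, hR⟩ := hX.isBounded.subset_closedBall 0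
    exact ⟨max 2 R, le_max_left _ _, hR.trans (Metric.closedBall_subset_closedBall
      (le_max_right _ _))⟩
  obtain ⟨u, huc, hu, hu1⟩ := exists_jouk_inverse hX hXc hlog h2 hm2 hR hXR
  have hXo := hX.isClosed.isOpen_compl
  have hXn : ∀ x ∈ X, ‖x‖ ≤ R := fun x hx => by simpa using hXR hx
  have hXcc := HasLogs.isPreconnected_compl hX hlog
  have hfix : ∀ v : ℂ, v ≠ 0 → jouk v ∉ X → v ≠ v⁻¹ := by
    intro v hv hj h
    have h1 : v * v = 1 := by nth_rw 2 [h]; exact mul_inv_cancel₀ hv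
    rcases mul_self_eq_one_iff.1 h1 with rfl | rfl
    · exact hj (by rw [jouk]; norm_num; exact h2)
    · exact hj (by rw [jouk]; norm_num; exact hm2)
  have huor : ∀ v : ℂ, v ≠ 0 → jouk v ∉ X → u (jouk v) = v ∨ u (jouk v) = v⁻¹ := fun v hv hj =>
    eq_or_eq_inv_of_jouk_eq (hu _ hj).1 hv (hu _ hj).2
  have hub : ∀ z ∈ Xᶜ, ‖u z‖ ≤ R + 1 := by
    intro z hz
    rcases lt_or_ge R ‖z‖ with h | h
    · linarith [hu1 z h]
    · exact norm_le_of_norm_jouk_le (by linarith) (by rwa [(hu z hz).2])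
  set P : Set ℂ := u '' Xᶜ with hP
  have hPiff : ∀ v, v ∈ P ↔ v ≠ 0 ∧ jouk v ∉ X ∧ u (jouk v) ≠ v⁻¹ := by
    intro v
    constructor
    · rintro ⟨z, hz, rfl⟩
      have hj := (hu z hz).2
      refine ⟨(hu z hz).1, by rw [hj]; exact hz, ?_⟩
      rw [hj]
      exact hfix _ (hu z hz).1 (by rw [hj]; exact hz)
    · rintro ⟨hv, hj, hne⟩
      exact ⟨jouk v, hj, (huor v hv hj).resolve_right hne⟩
  have hPo : IsOpen P := by
    have h1 : IsOpen ({0}ᶜ ∩ jouk ⁻¹' Xᶜ) :=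
      continuousOn_jouk.isOpen_inter_preimage isOpen_compl_singleton hXo
    have h3 : ContinuousOn (fun v => u (jouk v) - v⁻¹) ({0}ᶜ ∩ jouk ⁻¹' Xᶜ) := by
      refine ContinuousOn.sub (huc.comp (continuousOn_jouk.mono inter_subset_left)
        fun v hv => hv.2) (continuousOn_id.inv₀ fun v hv => hv.1)
    convert h3.isOpen_inter_preimage h1 isOpen_compl_singleton (t := {0}ᶜ) using 1
    ext v
    rw [hPiff]
    simp only [mem_inter_iff, mem_compl_iff, mem_singleton_iff, mem_preimage, sub_eq_zero]
    tauto
  have hsmall : ∀ v : ℂ, v ≠ 0 → ‖v‖ < 1 / (R + 1) → v ∈ P := by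
    intro v hv hvR
    have h1 : R < ‖jouk v‖ := lt_norm_jouk (by linarith) hv hvR
    have h3 : jouk v ∉ X := fun h => by linarith [hXn _ h]
    refine (hPiff v).2 ⟨hv, h3, fun h => ?_⟩
    have h4 := hu1 _ h1
    rw [h, norm_inv] at h4
    have h5 : ‖v‖ < 1 := hvR.trans (by rw [div_lt_one] <;> linarith)
    have := (inv_lt_one_iff₀.1 h4).resolve_left (not_le.2 (norm_pos_iff.2 hv))
    linarith
  have hc0 : 0 < 1 / (R + 1) := by apply one_div_pos.2; linarith
  have hP0 : (0 : ℂ) ∉ P := fun h => ((hPiff 0).1 h).1 rfl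
  have hV1eq : insert 0 P = Metric.ball 0 (1 / (R + 1)) ∪ P := by
    ext v
    constructor
    · rintro (rfl | h)
      · exact Or.inl (Metric.mem_ball_self hc0)
      · exact Or.inr h
    · rintro (h | h)
      · by_cases hv : v = 0
        · exact Or.inl hv
        · exact Or.inr (hsmall v hv (by simpa using h))
      · exact Or.inr h
  have hV1o : IsOpen (insert 0 P) := by
    rw [hV1eq]; exact Metric.isOpen_ball.union hPo
  have hPpre : IsPreconnected P := hXcc.image _ huc
  have h0cl : (0 : ℂ) ∈ closure P := by
    rw [Metric.mem_closure_iff]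
    intro ε hε
    set t : ℝ := min ε (1 / (R + 1)) / 2 with ht
    have hm : 0 < min ε (1 / (R + 1)) := lt_min hε hc0
    have ht0 : 0 < t := by positivity
    have htn : ‖(t : ℂ)‖ = t := by rw [Complex.norm_real, Real.norm_of_nonneg ht0.le]
    refine ⟨(t : ℂ), hsmall _ (by exact_mod_cast ht0.ne') ?_, ?_⟩
    · rw [htn]; linarith [min_le_right ε (1 / (R + 1))]
    · rw [dist_zero_left, htn]; linarith [min_le_left ε (1 / (R + 1))]
  have hV1p : IsPreconnected (insert 0 P) :=
    hPpre.subset_closure (subset_insert _ _) (insert_subset h0cl subset_closure)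
  have hPR : ∀ v ∈ P, ‖v‖ ≤ R + 1 := by
    rintro _ ⟨z, hz, rfl⟩; exact hub z hz
  -- the complement
  set K : Set ℂ := {v | v ≠ 0 ∧ jouk v ∈ X} with hK
  set O : Set ℂ := {v | v ≠ 0 ∧ v⁻¹ ∈ P} with hO
  have hlow : ∀ v : ℂ, ‖v⁻¹‖ ≤ R + 1 → v ≠ 0 → 1 / (R + 1) ≤ ‖v‖ := by
    intro v hv hv0
    rw [norm_inv] at hv
    rw [one_div]
    exact inv_le_of_inv_le₀ (norm_pos_iff.2 hv0) hv
  have hKc : IsCompact K := by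
    have hA : IsCompact (Metric.closedBall (0 : ℂ) (R + 1) ∩ {v | 1 / (R + 1) ≤ ‖v‖}) :=
      (isCompact_closedBall _ _).inter_right (isClosed_le continuous_const continuous_norm)
    have hjA : ContinuousOn jouk (Metric.closedBall (0 : ℂ) (R + 1) ∩ {v | 1 / (R + 1) ≤ ‖v‖}) :=
      continuousOn_jouk.mono fun v hv (h : v = 0) => by
        have : 1 / (R + 1) ≤ ‖v‖ := hv.2
        rw [h, norm_zero] at this
        linarith
    have : K = (Metric.closedBall (0 : ℂ) (R + 1) ∩ {v | 1 / (R + 1) ≤ ‖v‖}) ∩ jouk ⁻¹' X := by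
      ext v
      constructor
      · rintro ⟨hv, hj⟩
        refine ⟨⟨?_, ?_⟩, hj⟩
        · rw [mem_closedBall_zero_iff]
          exact norm_le_of_norm_jouk_le (by linarith) (hXn _ hj)
        · exact hlow v (norm_le_of_norm_jouk_le (by linarith) (by
            rw [jouk_inv]; exact hXn _ hj)) hv
      · rintro ⟨⟨-, hv⟩, hj⟩
        refine ⟨fun h => ?_, hj⟩
        have : 1 / (R + 1) ≤ ‖v‖ := hv
        rw [h, norm_zero] at this
        linarith
    rw [this]
    exact hA.of_isClosed_subset (hjA.preimage_isClosed_of_isClosed hA.isClosed hX.isClosed)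
      inter_subset_left
  have hKp : IsPreconnected K := by
    refine hKc.isPreconnected_of_involution (j := jouk) (ι := fun v => v⁻¹) (x0 := 1)
      (continuousOn_jouk.mono fun v hv => hv.1) (continuousOn_id.inv₀ fun v hv => hv.1)
      (fun v hv => ⟨inv_ne_zero hv.1, by rw [jouk_inv]; exact hv.2⟩) (by simp)
      (fun x hx y hy h => eq_or_eq_inv_of_jouk_eq hy.1 hx.1 h.symm)
      ⟨one_ne_zero, by rw [jouk]; norm_num; exact h2⟩ (by simp) ?_
    convert hXc using 1
    refine Subset.antisymm (by rintro _ ⟨v, hv, rfl⟩; exact hv.2) fun z hz => ?_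
    obtain ⟨s, hs⟩ := IsSquare.exists_sq (z ^ 2 - 4) ⟨(z ^ 2 - 4) ^ (1 / 2 : ℂ), by
      rw [← sq, ← Complex.cpow_nat_mul]; simp⟩
    have h1 : ((z + s) / 2) * ((z - s) / 2) = 1 := by linear_combination hs / 4
    have h3 : ((z + s) / 2)⁻¹ = (z - s) / 2 := (eq_inv_of_mul_eq_one_right h1).symm
    have hj : jouk ((z + s) / 2) = z := by rw [jouk, h3]; ring
    exact ⟨(z + s) / 2, ⟨left_ne_zero_of_mul_eq_one h1, by rw [hj]; exact hz⟩, hj⟩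
  have hOo : IsOpen O :=
    (continuousOn_id.inv₀ fun (v : ℂ) (hv : v ∈ ({0}ᶜ : Set ℂ)) => hv).isOpen_inter_preimage
      isOpen_compl_singleton hPo
  have hOim : O = (fun v => v⁻¹) '' P := by
    ext v
    constructor
    · rintro ⟨hv, hvP⟩; exact ⟨_, hvP, inv_inv v⟩
    · rintro ⟨w, hw, rfl⟩
      exact ⟨inv_ne_zero ((hPiff w).1 hw).1, by rw [inv_inv]; exact hw⟩
  have hOp : IsPreconnected O := by
    rw [hOim]
    exact hPpre.image _ (continuousOn_id.inv₀ fun v hv => ((hPiff v).1 hv).1)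
  have hOP : ∀ v, v ∈ O → v ∉ P := by
    intro v hv hvP
    have h1 := (hPiff v).1 hvP
    have h3 := (hPiff _).1 hv.2
    rw [jouk_inv, inv_inv] at h3
    rcases huor v h1.1 h1.2.1 with h | h
    · exact h3.2.2 h
    · exact h1.2.2 h
  have hOlow : O ⊆ {v | 1 / (R + 1) ≤ ‖v‖} := fun v hv => hlow v (hPR _ hv.2) hv.1
  have htri : ∀ v : ℂ, v ≠ 0 → v ∈ K ∨ v ∈ P ∨ v ∈ O := by
    intro v hv
    by_cases hj : jouk v ∈ X
    · exact Or.inl ⟨hv, hj⟩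
    · rcases huor v hv hj with h | h
      · exact Or.inr (Or.inl ⟨_, hj, h⟩)
      · exact Or.inr (Or.inr ⟨hv, _, hj, h⟩)
  have hfr : frontier O ⊆ K := by
    intro y hy
    rw [hOo.frontier_eq] at hy
    have hy1 : 1 / (R + 1) ≤ ‖y‖ := closure_minimal hOlow
      (isClosed_le continuous_const continuous_norm) hy.1
    have hy0 : y ≠ 0 := fun h => by rw [h, norm_zero] at hy1; linarith
    rcases htri y hy0 with h | h | h
    · exact h
    · obtain ⟨w, hw1, hw2⟩ := mem_closure_iff.1 hy.1 _ hPo h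
      exact absurd hw1 (hOP w hw2)
    · exact absurd h hy.2
  have hcomp : (insert 0 P)ᶜ = K ∪ O := by
    ext v
    constructor
    · intro hv
      have hv0 : v ≠ 0 := fun h => hv (Or.inl h)
      rcases htri v hv0 with h | h | h
      · exact Or.inl h
      · exact absurd (Or.inr h) hv
      · exact Or.inr h
    · rintro (h | h) (h' | h')
      · exact h.1 h'
      · exact ((hPiff v).1 h').2.1 h.2
      · exact h.1 h'
      · exact hOP v h h'
  have hcompp : IsPreconnected (insert 0 P)ᶜ := by
    rw [hcomp]
    refine hKp.union_of_frontier_subset hOp ?_ ?_ hfr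
    · rw [hOim]
      refine Nonempty.image _ ?_
      by_contra hne
      rw [not_nonempty_iff_eq_empty] at hne
      rw [hne] at h0cl
      simp at h0cl
    · intro h
      exact ((h ▸ mem_univ (0 : ℂ) : (0 : ℂ) ∈ O)).1 rfl
  -- scaling
  set c : ℂ := ((R + 2 : ℝ) : ℂ) with hc
  have hR2 : 0 < R + 2 := by linarith
  have hcn : ‖c‖ = R + 2 := by rw [hc, Complex.norm_real, Real.norm_of_nonneg hR2.le]
  have hcne : c ≠ 0 := norm_pos_iff.1 (hcn ▸ hR2)
  set U0 : Set ℂ := (fun w => c * w) ⁻¹' (insert 0 P) with hU0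
  have hU0sub : U0 ⊆ Metric.ball 0 1 := by
    intro w hw
    rw [mem_ball_zero_iff]
    have h1 : ‖c * w‖ ≤ R + 1 := by
      rcases hw with h | h
      · have h : c * w = 0 := h
        rw [h, norm_zero]; linarith
      · exact hPR _ h
    rw [norm_mul, hcn] at h1
    by_contra hcon
    rw [not_lt] at hcon
    nlinarith
  have hU0im : U0 = (fun v => v / c) '' (insert 0 P) := by
    ext w
    constructor
    · intro hw; exact ⟨_, hw, mul_div_cancel_left₀ _ hcne⟩
    · rintro ⟨v, hv, rfl⟩
      show c * (v / c) ∈ insert 0 P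
      rwa [mul_div_cancel₀ _ hcne]
  have hD : DiscDomain U0 := by
    refine ⟨hV1o.preimage (by fun_prop), ?_, hU0sub, ?_⟩
    · rw [hU0im]
      exact hV1p.image _ (by fun_prop)
    · set ρ : ℂ → ℂ := fun v => (v / c) / ((max 1 ‖v / c‖ : ℝ) : ℂ) with hρ
      have hm : ∀ v : ℂ, ((max 1 ‖v / c‖ : ℝ) : ℂ) ≠ 0 := fun v => by
        have : (0 : ℝ) < max 1 ‖v / c‖ := lt_max_of_lt_left one_pos
        exact_mod_cast this.ne'
      have hρc : Continuous ρ := by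
        refine Continuous.div (by fun_prop) ?_ hm
        exact Complex.continuous_ofReal.comp (by fun_prop)
      have : Metric.closedBall 0 1 \ U0 = ρ '' (insert 0 P)ᶜ := by
        ext w
        constructor
        · rintro ⟨hw, hw'⟩
          refine ⟨c * w, hw', ?_⟩
          have h1 : ‖w‖ ≤ 1 := by simpa using hw
          simp only [hρ]
          rw [mul_div_cancel_left₀ _ hcne, max_eq_left h1]
          simp
        · rintro ⟨v, hv, rfl⟩
          simp only [hρ]
          rcases le_or_gt ‖v / c‖ 1 with h | h
          · rw [max_eq_left h, Complex.ofReal_one, div_one]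
            refine ⟨by simpa using h, fun h' => hv ?_⟩
            have : c * (v / c) ∈ insert 0 P := h'
            rwa [mul_div_cancel₀ _ hcne] at this
          · have e : ‖(v / c) / ((max 1 ‖v / c‖ : ℝ) : ℂ)‖ = 1 := by
              rw [max_eq_right h.le, norm_div _ (Complex.ofReal _), Complex.norm_real, norm_norm,
                div_self (by linarith)]
            refine ⟨by rw [mem_closedBall_zero_iff, e], fun h' => ?_⟩
            have := hU0sub h'
            rw [mem_ball_zero_iff, e] at this
            exact lt_irrefl _ this
      rw [this]
      exact hcompp.image _ hρc.continuousOn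
  have h0U : (0 : ℂ) ∈ U0 := by
    show c * 0 ∈ insert 0 P
    rw [mul_zero]; exact Or.inl rfl
  obtain ⟨f, φ, hb, hf0⟩ := hD.exists_biholo_ball h0U
  have hφ0 : φ 0 = 0 := by have := hb.gf 0 h0U; rwa [hf0] at this
  have hφne : ∀ ζ ∈ Metric.ball (0 : ℂ) 1 \ {0}, φ ζ ≠ 0 := fun ζ hζ h => hζ.2 (by
    have := hb.fg ζ hζ.1
    rw [h, hf0] at this
    exact this.symm)
  have hφP : ∀ ζ ∈ Metric.ball (0 : ℂ) 1 \ {0}, c * φ ζ ∈ P := fun ζ hζ =>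
    (show c * φ ζ ∈ insert 0 P from hb.mg hζ.1).resolve_left (mul_ne_zero hcne (hφne ζ hζ))
  have huU : ∀ z ∈ Xᶜ, u z / c ∈ U0 := fun z hz => by
    rw [hU0im]; exact mem_image_of_mem _ (Or.inr (mem_image_of_mem _ hz))
  have hφcont : ContinuousAt φ 0 :=
    (hb.dg.continuousOn 0 (by simp)).continuousAt (Metric.ball_mem_nhds _ one_pos)
  refine ⟨fun ζ => jouk (c * φ ζ), fun z => f (u z / c), ?_, ?_, ?_, ?_, ?_, ?_, ?_, ?_⟩
  · have h1 : DifferentiableOn ℂ (fun ζ => c * φ ζ) (Metric.ball 0 1 \ {0}) :=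
      (hb.dg.mono sdiff_subset).const_mul c
    exact h1.fun_add (h1.fun_inv fun ζ hζ => mul_ne_zero hcne (hφne ζ hζ))
  · exact hb.df.continuousOn.comp (huc.div_const c) huU
  · exact fun ζ hζ => ((hPiff _).1 (hφP ζ hζ)).2.1
  · intro z hz
    refine ⟨hb.mf (huU z hz), fun h => ?_⟩
    have h1 := hb.gf _ (huU z hz)
    rw [show f (u z / c) = 0 from h, hφ0] at h1
    exact (div_ne_zero (hu z hz).1 hcne) h1.symm
  · intro ζ hζ
    obtain ⟨z, hz, hzu⟩ := hφP ζ hζ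
    rw [← hzu, (hu z hz).2, hzu, mul_div_cancel_left₀ _ hcne, hb.fg ζ hζ.1]
  · intro z hz
    rw [hb.gf _ (huU z hz), mul_div_cancel₀ _ hcne, (hu z hz).2]
  · have hfc : ContinuousAt f 0 :=
      (hb.df.continuousOn 0 h0U).continuousAt (hD.isOpen.mem_nhds h0U)
    obtain ⟨d, hd, hdf⟩ := Metric.continuousAt_iff.1 hfc (1 / 2) (by norm_num)
    refine ⟨(R + 1) + 1 / ((R + 2) * d), fun ζ hζ hζ2 => ?_⟩
    have hζ0 : ζ ∈ Metric.ball (0 : ℂ) 1 \ {0} := ⟨hζ, fun h => by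
      rw [mem_singleton_iff] at h
      rw [h, norm_zero] at hζ2
      norm_num at hζ2⟩
    have h1 : d ≤ ‖φ ζ‖ := by
      by_contra hcon
      have := hdf (x := φ ζ) (by rw [dist_zero_right]; exact not_le.1 hcon)
      rw [hf0, dist_zero_right, hb.fg ζ hζ] at this
      linarith
    refine (norm_add_le _ _).trans (_root_.add_le_add (hPR _ (hφP ζ hζ0)) ?_)
    rw [norm_inv, norm_mul, hcn, one_div]
    gcongr
  · rw [tendsto_atTop]
    intro M
    have h1 : Tendsto (fun ζ => ‖c * φ ζ‖) (𝓝[≠] 0) (𝓝 0) := by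
      have : Tendsto (fun ζ => ‖c * φ ζ‖) (𝓝 0) (𝓝 ‖c * φ 0‖) :=
        (hφcont.const_mul c).norm
      rw [hφ0, mul_zero, norm_zero] at this
      exact this.mono_left nhdsWithin_le_nhds
    have hM : 0 < |M| + 1 := by positivity
    filter_upwards [h1.eventually_lt_const (show 0 < 1 / (|M| + 1 + 1) by positivity),
      self_mem_nhdsWithin, mem_nhdsWithin_of_mem_nhds (Metric.ball_mem_nhds (0 : ℂ) one_pos)]
      with ζ h3 h4 h5
    have := lt_norm_jouk hM (mul_ne_zero hcne (hφne ζ ⟨h5, h4⟩)) h3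
    linarith [le_abs_self M]

theorem exists_isPreconnected_small {X : Set ℂ} (hX : IsCompact X) [LocallyConnectedSpace X]
    {ε : ℝ} (hε : 0 < ε) : ∃ δ > 0, ∀ E ⊆ X, (∀ x ∈ E, ∀ y ∈ E, dist x y < δ) →
      ∃ κ ⊆ X, IsPreconnected κ ∧ IsClosed κ ∧ E ⊆ κ ∧ ∀ x ∈ κ, ∃ e ∈ E, dist x e ≤ ε := by
  have := isCompact_iff_compactSpace.1 hX
  obtain ⟨δ, hδ, h⟩ := exists_isPreconnected_subset_ball (M := X) hε
  refine ⟨δ, hδ, fun E hE hEd => ?_⟩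
  rcases E.eq_empty_or_nonempty with rfl | ⟨e, he⟩
  · exact ⟨∅, empty_subset _, isPreconnected_empty, isClosed_empty, Subset.rfl, by simp⟩
  choose K hK1 hK2 hK3 hK4 using fun y : E =>
    h ⟨e, hE he⟩ ⟨y.1, hE y.2⟩ (hEd e he y.1 y.2)
  set κ : Set ℂ := ⋃ y : E, Subtype.val '' K y with hκ
  have hκp : IsPreconnected κ := isPreconnected_iUnion
    ⟨e, mem_iInter.2 fun y => ⟨_, hK2 y, rfl⟩⟩
    fun y => (hK1 y).image _ continuous_subtype_val.continuousOn
  have hκX : κ ⊆ X := iUnion_subset fun y => by rintro _ ⟨z, -, rfl⟩; exact z.2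
  have hκb : κ ⊆ Metric.closedBall e ε := iUnion_subset fun y => by
    rintro _ ⟨z, hz, rfl⟩
    exact Metric.ball_subset_closedBall (hK4 y hz)
  refine ⟨closure κ, closure_minimal hκX hX.isClosed, hκp.closure, isClosed_closure,
    fun y hy => subset_closure (mem_iUnion.2 ⟨⟨y, hy⟩, _, hK3 ⟨y, hy⟩, rfl⟩), fun x hx => ⟨e, he, ?_⟩⟩
  exact closure_minimal hκb Metric.isClosed_closedBall hx

/-- A bounded region cut off from the complement of `X` by a set `S` meeting `X` in a
connected set is no larger than `S`. -/
theorem HasLogs.subset_closedBall_of_frontier_subset {X S κ B : Set ℂ} {p : ℂ} {r : ℝ}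
    (hlog : HasLogs X) (hX : IsClosed X) (hS : IsClosed S) (hSp : S ⊆ Metric.closedBall p r)
    (hSX : S ∩ X ⊆ κ) (hκ : IsPreconnected κ) (hκX : κ ⊆ X) (hκS : κ ⊆ S)
    (hBb : Bornology.IsBounded B) (hBX : Disjoint B X) (hfr : frontier B ⊆ X ∪ S) :
    B ⊆ Metric.closedBall p r := by
  intro q hq
  by_contra hqp
  have hqX : q ∉ X := fun h => Set.disjoint_left.1 hBX hq h
  obtain ⟨L, hL, hLe⟩ := hlog (fun z => z - q) (by fun_prop) fun x hx h =>
    hqX (sub_eq_zero.1 h ▸ hx)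
  have hr : 0 ≤ r ∨ S = ∅ := by
    by_cases hr : 0 ≤ r
    · exact Or.inl hr
    · right
      rw [Metric.closedBall_eq_empty.2 (not_le.1 hr)] at hSp
      exact subset_empty_iff.1 hSp
  obtain ⟨L', hL', hLe'⟩ : ∃ L' : ℂ → ℂ, ContinuousOn L' S ∧
      ∀ z ∈ S, Complex.exp (L' z) = z - q := by
    rcases hr with hr | hr
    · have hp : p ∈ Metric.closedBall p r := Metric.mem_closedBall_self hr
      obtain ⟨L', hL', hLe'⟩ := ((convex_closedBall p r).starConvex hp).hasLogs hp
        (fun z => z - q) (by fun_prop) fun x hx h => hqp (sub_eq_zero.1 h ▸ hx)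
      exact ⟨L', hL'.mono hSp, fun z hz => hLe' z (hSp hz)⟩
    · exact ⟨0, continuousOn_const, by simp [hr]⟩
  obtain ⟨c, hc1, hc⟩ : ∃ c : ℂ, Complex.exp c = 1 ∧ ∀ z ∈ κ, L z = L' z + c := by
    rcases κ.eq_empty_or_nonempty with h | ⟨z0, hz0⟩
    · exact ⟨0, Complex.exp_zero, by simp [h]⟩
    · refine ⟨L z0 - L' z0, ?_, fun z hz => ?_⟩
      · have hne : z0 - q ≠ 0 := fun h => hqX (sub_eq_zero.1 h ▸ hκX hz0)
        rw [Complex.exp_sub, hLe z0 (hκX hz0), hLe' z0 (hκS hz0), div_self hne]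
      · have := hκ.sub_eq_sub_of_exp_eq (hL.mono hκX) (hL'.mono hκS) (fun x hx => by
          rw [hLe x (hκX hx), hLe' x (hκS hx)]) hz hz0
        linear_combination this
  classical
  set F : ℂ → ℂ := fun z => if z ∈ X then L z else L' z + c with hF
  have hF1 : ∀ z ∈ X, F z = L z := fun z hz => if_pos hz
  have hF2 : ∀ z ∈ S, F z = L' z + c := fun z hz => by
    by_cases h : z ∈ X
    · rw [hF1 z h, hc z (hSX ⟨hz, h⟩)]
    · exact if_neg h
  refine false_of_log_of_frontier_subset hBb hq hfr (L := F)
    (ContinuousOn.union_of_isClosed (hL.congr hF1)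
      ((hL'.add continuousOn_const).congr hF2) hX hS) ?_
  rintro z (hz | hz)
  · rw [hF1 z hz, hLe z hz]
  · rw [hF2 z hz, Complex.exp_add, hc1, mul_one, hLe' z hz]

section

open MeasureTheory

theorem setLIntegral_normSq_deriv_le {H : ℂ → ℂ} {S : Set ℂ} (hSo : IsOpen S)
    (hd : DifferentiableOn ℂ H S) (hi : InjOn H S) {A : Set ℂ} (hA : MapsTo H S A) :
    ∫⁻ w in S, ENNReal.ofReal (‖deriv H w‖ ^ 2) ≤ volume A := by
  have h1 : ∀ w ∈ S, HasFDerivWithinAt H ((fderiv ℂ H w).restrictScalars ℝ) S w := fun w hw =>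
    (((hd w hw).differentiableAt (hSo.mem_nhds hw)).hasFDerivAt.restrictScalars
      ℝ).hasFDerivWithinAt
  have h2 := lintegral_abs_det_fderiv_eq_addHaar_image volume hSo.measurableSet h1 hi
  have h3 : ∀ w, |((fderiv ℂ H w).restrictScalars ℝ).det| = ‖deriv H w‖ ^ 2 := by
    intro w
    have e : ((fderiv ℂ H w).restrictScalars ℝ).det =
        Algebra.norm ℝ (LinearMap.det (fderiv ℂ H w : ℂ →ₗ[ℂ] ℂ)) :=
      LinearMap.det_restrictScalars
    rw [e, Algebra.norm_complex_apply, LinearMap.det_ring, abs_of_nonneg (Complex.normSq_nonneg _),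
      Complex.normSq_eq_norm_sq]
    rfl
  simp only [h3] at h2
  rw [h2]
  exact measure_mono hA.image_subset

theorem exists_setLIntegral_le {H : ℂ → ℂ} {a b c d : ℝ} (hab : a < b)
    (hdf : DifferentiableOn ℂ H (Ioo a b ×ℂ Ioo c d)) (hi : InjOn H (Ioo a b ×ℂ Ioo c d))
    {A : Set ℂ} (hA : MapsTo H (Ioo a b ×ℂ Ioo c d) A) (hAv : volume A ≠ ⊤) :
    ∃ τ ∈ Ioo a b, ∫⁻ φ in Ioo c d, ENNReal.ofReal (‖deriv H (τ + φ * Complex.I)‖ ^ 2) ≤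
      (volume A + 1) / ENNReal.ofReal (b - a) := by
  by_contra! hcon
  set k : ℂ → ENNReal := fun w => ENNReal.ofReal (‖deriv H w‖ ^ 2) with hk
  have hkm : Measurable k := ((measurable_deriv H).norm.pow_const 2).ennreal_ofReal
  have h1 := setLIntegral_normSq_deriv_le (isOpen_Ioo.reProdIm isOpen_Ioo) hdf hi hA
  have h2 : ∫⁻ w in Ioo a b ×ℂ Ioo c d, k w =
      ∫⁻ p in Ioo a b ×ˢ Ioo c d, k (Complex.measurableEquivRealProd.symm p) := by
    have := (Complex.volume_preserving_equiv_real_prod.symm).setLIntegral_comp_preimage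
      (s := Ioo a b ×ℂ Ioo c d) (isOpen_Ioo.reProdIm isOpen_Ioo).measurableSet hkm
    rw [← this]
    rfl
  have h3 : ∫⁻ p in Ioo a b ×ˢ Ioo c d, k (Complex.measurableEquivRealProd.symm p) =
      ∫⁻ τ in Ioo a b, ∫⁻ φ in Ioo c d, k (τ + φ * Complex.I) := by
    rw [Measure.volume_eq_prod, ← Measure.prod_restrict, lintegral_prod]
    · refine lintegral_congr fun τ => lintegral_congr fun φ => ?_
      congr 1
      apply Complex.ext <;> simp [Complex.measurableEquivRealProd]
    · exact (hkm.comp Complex.measurableEquivRealProd.symm.measurable).aemeasurable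
  have h4 : ∫⁻ τ in Ioo a b, (volume A + 1) / ENNReal.ofReal (b - a) ≤
      ∫⁻ τ in Ioo a b, ∫⁻ φ in Ioo c d, k (τ + φ * Complex.I) :=
    setLIntegral_mono' measurableSet_Ioo fun τ hτ => (hcon τ hτ).le
  have hba : ENNReal.ofReal (b - a) ≠ 0 := by simpa using hab
  rw [setLIntegral_const, Real.volume_Ioo, ENNReal.div_mul_cancel hba ENNReal.ofReal_ne_top,
    ← h3, ← h2] at h4
  exact absurd (h4.trans h1) (not_le.2 (ENNReal.lt_add_right hAv one_ne_zero))

theorem dist_le_of_setLIntegral_le {H : ℂ → ℂ} {τ c d ε : ℝ} (hε : 0 < ε)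
    (hd : ∀ φ ∈ Ioo c d, AnalyticAt ℂ H (τ + φ * Complex.I))
    (hI : ∫⁻ φ in Ioo c d, ENNReal.ofReal (‖deriv H (τ + φ * Complex.I)‖ ^ 2) ≤
      ENNReal.ofReal (ε ^ 2)) {x y : ℝ} (hx : x ∈ Ioo c d) (hy : y ∈ Ioo c d) (hxy : x ≤ y) :
    dist (H (τ + y * Complex.I)) (H (τ + x * Complex.I)) ≤ ε * (1 + (y - x)) := by
  have hsub : Icc x y ⊆ Ioo c d := fun t ht => ⟨hx.1.trans_le ht.1, ht.2.trans_lt hy.2⟩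
  set l : ℝ → ℂ := fun t => τ + t * Complex.I with hl
  have hlc : Continuous l := by fun_prop
  have hder : ∀ t ∈ uIcc x y, HasDerivAt (fun t : ℝ => H (l t)) (deriv H (l t) * Complex.I) t := by
    intro t ht
    rw [uIcc_of_le hxy] at ht
    have h1 : HasDerivAt l Complex.I t := by
      have h2 := ((Complex.ofRealCLM.hasDerivAt (x := t)).mul_const Complex.I).const_add (τ : ℂ)
      rwa [Complex.ofRealCLM_apply, Complex.ofReal_one, one_mul] at h2
    exact (hd t (hsub ht)).differentiableAt.hasDerivAt.comp t h1
  have hdc : ContinuousOn (fun t : ℝ => deriv H (l t)) (uIcc x y) := by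
    rw [uIcc_of_le hxy]
    intro t ht
    have h1 : ContinuousAt (deriv H) (l t) := (hd t (hsub ht)).deriv.continuousAt
    exact (h1.comp (f := l) hlc.continuousAt).continuousWithinAt
  have hFTC := intervalIntegral.integral_eq_sub_of_hasDerivAt hder
    (hdc.mul continuousOn_const).intervalIntegrable
  rw [dist_eq_norm]
  change ‖(fun t : ℝ => H (l t)) y - (fun t : ℝ => H (l t)) x‖ ≤ _
  rw [← hFTC]
  have hpt : ∀ t, ‖deriv H (l t) * Complex.I‖ ≤ (1 / ε) * ‖deriv H (l t)‖ ^ 2 + ε := by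
    intro t
    rw [norm_mul, Complex.norm_I, mul_one]
    set n := ‖deriv H (l t)‖
    have : n * ε ≤ n ^ 2 + ε ^ 2 := by nlinarith [sq_nonneg (n - ε), sq_nonneg n, sq_nonneg ε]
    rw [← mul_le_mul_iff_left₀ hε]
    calc n * ε ≤ n ^ 2 + ε ^ 2 := this
      _ = (1 / ε * n ^ 2 + ε) * ε := by field_simp
  have hsqi : IntervalIntegrable (fun t => ‖deriv H (l t)‖ ^ 2) volume x y :=
    (hdc.norm.pow 2).intervalIntegrable
  have hJ : ∫ t in x..y, ‖deriv H (l t)‖ ^ 2 ≤ ε ^ 2 := by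
    rw [intervalIntegral.integral_of_le hxy]
    have hsq := (intervalIntegrable_iff_integrableOn_Ioc_of_le hxy).1 hsqi
    rw [← ENNReal.ofReal_le_ofReal_iff (by positivity), ofReal_integral_eq_lintegral_ofReal hsq
      (Eventually.of_forall fun t => by positivity)]
    exact (lintegral_mono_set (Ioc_subset_Icc_self.trans hsub)).trans hI
  calc ‖∫ t in x..y, deriv H (l t) * Complex.I‖
      ≤ ∫ t in x..y, ((1 / ε) * ‖deriv H (l t)‖ ^ 2 + ε) :=
        intervalIntegral.norm_integral_le_of_norm_le hxy (Eventually.of_forall fun t _ => hpt t)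
          ((hsqi.const_mul _).add intervalIntegrable_const)
    _ = (1 / ε) * (∫ t in x..y, ‖deriv H (l t)‖ ^ 2) + (y - x) * ε := by
        rw [intervalIntegral.integral_add (hsqi.const_mul _) intervalIntegrable_const,
          intervalIntegral.integral_const_mul, intervalIntegral.integral_const, smul_eq_mul]
    _ ≤ (1 / ε) * ε ^ 2 + (y - x) * ε := by gcongr
    _ = ε * (1 + (y - x)) := by field_simp

/-- The length–area estimate: a bounded injective holomorphic map of a half strip has short
vertical crosscuts, in a range of positions depending only on the bound. -/
theorem exists_short_crosscut (M : ℝ) {ε : ℝ} (hε : 0 < ε) :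
    ∃ T > 0, ∀ (H : ℂ → ℂ) (a : ℝ), DifferentiableOn ℂ H (Iio a ×ℂ Ioo (-1) 1) →
      InjOn H (Iio a ×ℂ Ioo (-1) 1) →
      MapsTo H (Iio a ×ℂ Ioo (-1) 1) (Metric.closedBall 0 M) →
      ∃ τ ∈ Ioo (a - T) a, ∀ x ∈ Ioo (-1 : ℝ) 1, ∀ y ∈ Ioo (-1 : ℝ) 1,
        dist (H (τ + x * Complex.I)) (H (τ + y * Complex.I)) ≤ ε := by
  set A : Set ℂ := Metric.closedBall 0 M
  have hA : volume A ≠ ⊤ := measure_closedBall_lt_top.ne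
  set V : ℝ := (volume A + 1).toReal with hV
  have hVA : ENNReal.ofReal V = volume A + 1 :=
    ENNReal.ofReal_toReal (ENNReal.add_ne_top.2 ⟨hA, ENNReal.one_ne_top⟩)
  have hV0 : 0 < V := by
    rw [← ENNReal.ofReal_pos, hVA]; exact lt_of_lt_of_le one_pos le_add_self
  set T : ℝ := V / (ε / 3) ^ 2 with hT
  have hT0 : 0 < T := by positivity
  refine ⟨T, hT0, fun H a hd hi hm => ?_⟩
  have hsub : Ioo (a - T) a ×ℂ Ioo (-1) 1 ⊆ Iio a ×ℂ Ioo (-1) 1 := fun w hw => ⟨hw.1.2, hw.2⟩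
  obtain ⟨τ, hτ, hτI⟩ := exists_setLIntegral_le (sub_lt_self a hT0) (hd.mono hsub) (hi.mono hsub)
    (hm.mono_left hsub) hA
  have hE : (volume A + 1) / ENNReal.ofReal (a - (a - T)) = ENNReal.ofReal ((ε / 3) ^ 2) := by
    rw [sub_sub_cancel, ← hVA, ← ENNReal.ofReal_div_of_pos hT0, hT]
    congr 1
    field_simp
  rw [hE] at hτI
  have han : ∀ φ ∈ Ioo (-1 : ℝ) 1, AnalyticAt ℂ H (τ + φ * Complex.I) := by
    intro φ hφ
    refine hd.analyticAt ((isOpen_Iio.reProdIm isOpen_Ioo).mem_nhds ⟨?_, ?_⟩)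
    · simpa using hτ.2
    · simpa using hφ
  have key : ∀ x ∈ Ioo (-1 : ℝ) 1, ∀ y ∈ Ioo (-1 : ℝ) 1, x ≤ y →
      dist (H (τ + y * Complex.I)) (H (τ + x * Complex.I)) ≤ ε := fun x hx y hy hxy => by
    refine (dist_le_of_setLIntegral_le (by positivity) han hτI hx hy hxy).trans ?_
    have : 1 + (y - x) ≤ 3 := by linarith [hx.1, hy.2]
    nlinarith
  refine ⟨τ, hτ, fun x hx y hy => ?_⟩
  rcases le_total x y with h | h
  · rw [dist_comm]; exact key x hx y hy h
  · exact key y hy x hx h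

end

/-- The half disc of radius `t` in the right half plane. -/
def halfDisc (t : ℝ) : Set ℂ := {v | 0 < v.re ∧ ‖v‖ < t}

theorem isOpen_halfDisc (t : ℝ) : IsOpen (halfDisc t) :=
  (isOpen_lt continuous_const Complex.continuous_re).inter
    (isOpen_lt continuous_norm continuous_const)

theorem norm_mul_exp_neg {u : ℂ} (hu : ‖u‖ = 1) (v : ℂ) :
    ‖u * Complex.exp (-v)‖ = Real.exp (-v.re) := by
  rw [norm_mul, hu, one_mul, Complex.norm_exp, Complex.neg_re]

theorem half_le_norm_mul_exp_neg {u : ℂ} (hu : ‖u‖ = 1) {v : ℂ} (hv : ‖v‖ ≤ 1 / 2) :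
    1 / 2 ≤ ‖u * Complex.exp (-v)‖ := by
  rw [norm_mul_exp_neg hu]
  have h1 := Real.add_one_le_exp (-v.re)
  have h2 := (Complex.abs_re_le_norm v).trans hv
  have h3 := (abs_le.1 h2).2
  linarith

theorem mul_exp_neg_mem {u : ℂ} (hu : ‖u‖ = 1) {v : ℂ} (hv : v ∈ halfDisc (1 / 2)) :
    u * Complex.exp (-v) ∈ Metric.ball (0 : ℂ) 1 \ {0} := by
  refine ⟨?_, ?_⟩
  · rw [mem_ball_zero_iff, norm_mul_exp_neg hu, Real.exp_lt_one_iff]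
    linarith [hv.1]
  · have := half_le_norm_mul_exp_neg hu hv.2.le
    rintro h
    rw [mem_singleton_iff.1 h] at this
    norm_num at this

theorem injOn_mul_exp_neg {u : ℂ} (hu : ‖u‖ = 1) :
    InjOn (fun v => u * Complex.exp (-v)) (halfDisc (1 / 2)) := by
  intro v hv w hw h
  have hu0 : u ≠ 0 := fun h => by simp [h] at hu
  have h1 := mul_left_cancel₀ hu0 h
  have h2 := exp_eq_exp_of_norm_sub_lt h1 (by
    have e : -v - -w = w - v := by ring
    rw [e]
    calc ‖w - v‖ ≤ ‖w‖ + ‖v‖ := norm_sub_le _ _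
      _ < 1 := by linarith [hv.2, hw.2]
      _ < 2 * Real.pi := by linarith [Real.pi_gt_three])
  exact neg_injective h2

theorem exp_half_pi_mul_mem {t : ℝ} {w : ℂ}
    (hw : w ∈ Iio (2 / Real.pi * Real.log t) ×ℂ Ioo (-1) 1) (ht : 0 < t) :
    Complex.exp ((Real.pi / 2 : ℝ) * w) ∈ halfDisc t := by
  have hpi := Real.pi_pos
  obtain ⟨h1, h2⟩ := hw
  simp only [mem_preimage, mem_Iio, mem_Ioo] at h1 h2
  refine ⟨?_, ?_⟩
  · rw [Complex.exp_re, Complex.re_ofReal_mul, Complex.im_ofReal_mul]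
    refine mul_pos (Real.exp_pos _) (Real.cos_pos_of_mem_Ioo ⟨?_, ?_⟩) <;> nlinarith
  · rw [Complex.norm_exp, Complex.re_ofReal_mul, ← Real.lt_log_iff_exp_lt ht]
    calc Real.pi / 2 * w.re < Real.pi / 2 * (2 / Real.pi * Real.log t) := by gcongr
      _ = Real.log t := by field_simp

theorem injOn_exp_half_pi_mul {S : Set ℝ} :
    InjOn (fun w => Complex.exp ((Real.pi / 2 : ℝ) * w)) (S ×ℂ Ioo (-1) 1) := by
  have hpi := Real.pi_pos
  rintro v ⟨-, hv⟩ w ⟨-, hw⟩ h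
  simp only [mem_preimage, mem_Ioo] at hv hw
  have := Complex.exp_inj_of_neg_pi_lt_of_le_pi (x := (Real.pi / 2 : ℝ) * v)
    (y := (Real.pi / 2 : ℝ) * w) ?_ ?_ ?_ ?_ h
  · exact mul_left_cancel₀ (by exact_mod_cast (by positivity : Real.pi / 2 ≠ 0)) this
  all_goals rw [Complex.im_ofReal_mul]; nlinarith

theorem exists_exp_half_pi_mul_eq {τ : ℝ} {v : ℂ} (hv : 0 < v.re)
    (h : ‖v‖ = Real.exp (Real.pi / 2 * τ)) :
    ∃ φ ∈ Ioo (-1 : ℝ) 1, Complex.exp ((Real.pi / 2 : ℝ) * (τ + φ * Complex.I)) = v := by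
  have hpi := Real.pi_pos
  have h1 := Complex.abs_arg_lt_pi_div_two_iff.2 (Or.inl hv)
  rw [abs_lt] at h1
  refine ⟨2 / Real.pi * v.arg, ⟨?_, ?_⟩, ?_⟩
  · have : -1 = 2 / Real.pi * (-(Real.pi / 2)) := by field_simp
    rw [this]; gcongr; exact h1.1
  · have : 1 = 2 / Real.pi * (Real.pi / 2) := by field_simp
    rw [this]; gcongr; exact h1.2
  · conv_rhs => rw [← Complex.norm_mul_exp_arg_mul_I v, h, Complex.ofReal_exp, ← Complex.exp_add]
    congr 1
    push_cast
    have : (Real.pi : ℂ) ≠ 0 := by exact_mod_cast hpi.ne'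
    field_simp

theorem ExteriorMap.frontier_subset {X : Set ℂ} {ψ g : ℂ → ℂ} (E : ExteriorMap X ψ g)
    (hX : IsClosed X) {u : ℂ} (hu : ‖u‖ = 1) {t : ℝ} (ht : t ≤ 1 / 2) :
    frontier ((fun v => ψ (u * Complex.exp (-v))) '' halfDisc t) ⊆
      X ∪ (fun v => ψ (u * Complex.exp (-v))) '' {v | 0 < v.re ∧ ‖v‖ = t} := by
  set e : ℂ → ℂ := fun v => u * Complex.exp (-v) with he
  have hec : Continuous e := by fun_prop
  have hu0 : u ≠ 0 := fun h => by simp [h] at hu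
  have heo : IsOpenMap e := by
    have h1 : IsOpenMap fun v : ℂ => u * v := (Homeomorph.mulLeft₀ u hu0).isOpenMap
    exact h1.comp (Complex.isOpenMap_exp.comp (Homeomorph.neg ℂ).isOpenMap)
  have hsub : halfDisc t ⊆ halfDisc (1 / 2) := fun v hv => ⟨hv.1, hv.2.trans_le ht⟩
  have hem : ∀ v ∈ halfDisc t, e v ∈ Metric.ball (0 : ℂ) 1 \ {0} := fun v hv =>
    mul_exp_neg_mem hu (hsub hv)
  set B := (fun v => ψ (e v)) '' halfDisc t with hB
  have hBX : B ⊆ Xᶜ := by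
    rintro _ ⟨v, hv, rfl⟩
    exact E.mψ (hem v hv)
  have hBo : IsOpen B := by
    have : B = Xᶜ ∩ g ⁻¹' (e '' halfDisc t) := by
      ext z
      constructor
      · rintro ⟨v, hv, rfl⟩
        exact ⟨E.mψ (hem v hv), v, hv, (E.gψ _ (hem v hv)).symm⟩
      · rintro ⟨hz, v, hv, hvz⟩
        exact ⟨v, hv, (congrArg ψ hvz).trans (E.ψg z hz)⟩
    rw [this]
    exact E.cg.isOpen_inter_preimage hX.isOpen_compl (heo _ (isOpen_halfDisc t))
  intro y hy
  by_cases hyX : y ∈ X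
  · exact Or.inl hyX
  right
  have hgc : ContinuousAt g y := E.cg.continuousAt (hX.isOpen_compl.mem_nhds hyX)
  have h1 : g y ∈ closure (g '' B) := hgc.continuousWithinAt.mem_closure_image hy.1
  have h2 : g '' B ⊆ e '' {v | 0 ≤ v.re ∧ ‖v‖ ≤ t} := by
    rintro _ ⟨_, ⟨v, hv, rfl⟩, rfl⟩
    exact ⟨v, ⟨hv.1.le, hv.2.le⟩, (E.gψ _ (hem v hv)).symm⟩
  have hK : IsCompact {v : ℂ | 0 ≤ v.re ∧ ‖v‖ ≤ t} := by
    have : {v : ℂ | 0 ≤ v.re ∧ ‖v‖ ≤ t} = Metric.closedBall 0 t ∩ {v | 0 ≤ v.re} := by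
      ext v; simp [and_comm]
    rw [this]
    exact (isCompact_closedBall _ _).inter_right
      (isClosed_le continuous_const Complex.continuous_re)
  obtain ⟨v, ⟨hv1, hv2⟩, hvy⟩ := closure_minimal h2 (hK.image hec).isClosed h1
  have hgy := mem_ball_zero_iff.1 (E.mg hyX).1
  rw [← hvy, norm_mul_exp_neg hu, Real.exp_lt_one_iff] at hgy
  have hv0 : 0 < v.re := by linarith
  have hy' : ψ (e v) = y := by rw [hvy, E.ψg y hyX]
  rcases hv2.lt_or_eq with hv2 | hv2
  · exact absurd ⟨v, ⟨hv0, hv2⟩, hy'⟩ (hBo.frontier_eq ▸ hy).2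
  · exact ⟨v, ⟨hv0, hv2⟩, hy'⟩

/-- Small half discs at a boundary point of the unit disc have small images. -/
theorem ExteriorMap.exists_image_halfDisc_subset {X : Set ℂ} {ψ g : ℂ → ℂ}
    (E : ExteriorMap X ψ g) (hX : IsCompact X) [LocallyConnectedSpace X] (hlog : HasLogs X)
    {u : ℂ} (hu : ‖u‖ = 1) {ε : ℝ} (hε : 0 < ε) :
    ∃ t > 0, ∃ p, ∀ v ∈ halfDisc t, ψ (u * Complex.exp (-v)) ∈ Metric.closedBall p ε := by
  obtain ⟨δ, hδ, hsmall⟩ := exists_isPreconnected_small hX (half_pos hε)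
  obtain ⟨M, hM⟩ := E.bdd
  set ε₁ := min (δ / 3) (ε / 2) with hε₁
  have hε₁0 : 0 < ε₁ := by positivity
  obtain ⟨T, -, hT⟩ := exists_short_crosscut M hε₁0
  set e : ℂ → ℂ := fun v => u * Complex.exp (-v) with he
  set pol : ℂ → ℂ := fun w => Complex.exp ((Real.pi / 2 : ℝ) * w) with hpol
  set a := 2 / Real.pi * Real.log (1 / 2) with ha
  have hpolm : ∀ w ∈ Iio a ×ℂ Ioo (-1) 1, pol w ∈ halfDisc (1 / 2) := fun w hw =>
    exp_half_pi_mul_mem hw (by norm_num)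
  have hem : ∀ v ∈ halfDisc (1 / 2), e v ∈ Metric.ball (0 : ℂ) 1 \ {0} := fun v hv =>
    mul_exp_neg_mem hu hv
  have hψi : InjOn ψ (Metric.ball 0 1 \ {0}) := fun x hx y hy h => by
    rw [← E.gψ x hx, h, E.gψ y hy]
  have hψb : ∀ v ∈ halfDisc (1 / 2), ψ (e v) ∈ Metric.closedBall 0 M := fun v hv =>
    mem_closedBall_zero_iff.2 (hM _ (hem v hv).1 (half_le_norm_mul_exp_neg hu hv.2.le))
  have hed : Differentiable ℂ fun w => e (pol w) := by fun_prop
  obtain ⟨τ, hτ, hτd⟩ := hT (fun w => ψ (e (pol w))) a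
    (E.dψ.comp hed.differentiableOn fun w hw => hem _ (hpolm w hw))
    (fun x hx y hy h => injOn_exp_half_pi_mul hx hy (injOn_mul_exp_neg hu (hpolm x hx) (hpolm y hy)
      (hψi (hem _ (hpolm x hx)) (hem _ (hpolm y hy)) h)))
    fun w hw => hψb _ (hpolm w hw)
  set t := Real.exp (Real.pi / 2 * τ) with ht
  have ht2 : t < 1 / 2 := by
    rw [ht, ← Real.lt_log_iff_exp_lt (by norm_num)]
    calc Real.pi / 2 * τ < Real.pi / 2 * a := by
          have := Real.pi_pos
          gcongr
          exact hτ.2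
      _ = _ := by rw [ha]; field_simp
  set γ := (fun φ : ℝ => ψ (e (pol (τ + φ * Complex.I)))) '' Ioo (-1 : ℝ) 1 with hγ
  set p := ψ (e (pol τ)) with hp
  have hγp : γ ⊆ Metric.closedBall p ε₁ := by
    rintro _ ⟨φ, hφ, rfl⟩
    have := hτd φ hφ 0 (by norm_num)
    rwa [Complex.ofReal_zero, zero_mul, add_zero] at this
  have hγp' : closure γ ⊆ Metric.closedBall p ε₁ := closure_minimal hγp Metric.isClosed_closedBall
  obtain ⟨κ, hκX, hκ, hκc, hEκ, hκE⟩ := hsmall (closure γ ∩ X) inter_subset_right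
    fun x hx y hy => by
      have h1 := dist_triangle_right x y p
      have h2 := Metric.mem_closedBall.1 (hγp' hx.1)
      have h3 := Metric.mem_closedBall.1 (hγp' hy.1)
      have h4 : ε₁ ≤ δ / 3 := min_le_left _ _
      linarith
  have hε₁2 : ε₁ ≤ ε / 2 := min_le_right _ _
  have hsub : halfDisc t ⊆ halfDisc (1 / 2) := fun v hv => ⟨hv.1, hv.2.trans ht2⟩
  refine ⟨t, Real.exp_pos _, p, fun v hv => ?_⟩
  have key := hlog.subset_closedBall_of_frontier_subset (S := closure γ ∪ κ) (κ := κ)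
    (B := (fun v => ψ (e v)) '' halfDisc t) (p := p) (r := ε) hX.isClosed
    (isClosed_closure.union hκc) ?_ ?_ hκ hκX subset_union_right ?_ ?_ ?_
  · exact key ⟨v, hv, rfl⟩
  · refine union_subset (hγp'.trans (Metric.closedBall_subset_closedBall (by linarith)))
      fun x hx => ?_
    obtain ⟨y, hy, hxy⟩ := hκE x hx
    have := Metric.mem_closedBall.1 (hγp' hy.1)
    exact (dist_triangle x y p).trans (by linarith)
  · rintro x ⟨hx | hx, hxX⟩
    exacts [hEκ ⟨hx, hxX⟩, hx]
  · refine Metric.isBounded_closedBall.subset (t := Metric.closedBall 0 M) ?_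
    rintro _ ⟨v, hv, rfl⟩
    exact hψb v (hsub hv)
  · rw [Set.disjoint_left]
    rintro _ ⟨v, hv, rfl⟩
    exact E.mψ (hem v (hsub hv))
  · refine (E.frontier_subset hX.isClosed hu ht2.le).trans (union_subset_union_right _ ?_)
    rintro _ ⟨v, ⟨hv0, hvt⟩, rfl⟩
    obtain ⟨φ, hφ, rfl⟩ := exists_exp_half_pi_mul_eq hv0 hvt
    exact Or.inl (subset_closure ⟨φ, hφ, rfl⟩)

/-- The parametrisation of the exterior extends continuously to the unit circle. -/
theorem ExteriorMap.exists_tendsto {X : Set ℂ} {ψ g : ℂ → ℂ}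
    (E : ExteriorMap X ψ g) (hX : IsCompact X) [LocallyConnectedSpace X] (hlog : HasLogs X)
    {u : ℂ} (hu : ‖u‖ = 1) : ∃ y, Tendsto ψ (𝓝[Metric.ball 0 1 \ {0}] u) (𝓝 y) := by
  have hu0 : u ≠ 0 := fun h => by simp [h] at hu
  have hne : (𝓝[Metric.ball 0 1 \ {0}] u).NeBot := by
    have h1 : 𝓝[Metric.ball (0 : ℂ) 1 \ {0}] u = 𝓝[Metric.ball 0 1] u := by
      rw [sdiff_eq]
      exact nhdsWithin_inter_of_mem' (mem_nhdsWithin_of_mem_nhds (isOpen_ne.mem_nhds hu0))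
    rw [h1, ← mem_closure_iff_nhdsWithin_neBot, closure_ball _ one_ne_zero]
    simp [hu]
  rw [← cauchy_map_iff_exists_tendsto, Metric.cauchy_iff]
  refine ⟨hne.map ψ, fun ε hε => ?_⟩
  obtain ⟨t, ht, p, hp⟩ := E.exists_image_halfDisc_subset hX hlog hu (ε := ε / 3) (by positivity)
  refine ⟨Metric.closedBall p (ε / 3), ?_, fun x hx y hy => ?_⟩
  · have heo : IsOpenMap fun v => u * Complex.exp (-v) := by
      have h1 : IsOpenMap fun v : ℂ => u * v := (Homeomorph.mulLeft₀ u hu0).isOpenMap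
      exact h1.comp (Complex.isOpenMap_exp.comp (Homeomorph.neg ℂ).isOpenMap)
    have h2 := heo.image_mem_nhds (Metric.ball_mem_nhds (0 : ℂ) ht)
    rw [neg_zero, Complex.exp_zero, mul_one] at h2
    rw [mem_map]
    filter_upwards [mem_nhdsWithin_of_mem_nhds h2, self_mem_nhdsWithin]
    rintro _ ⟨v, hv, rfl⟩ ⟨h3, -⟩
    rw [mem_ball_zero_iff, norm_mul_exp_neg hu, Real.exp_lt_one_iff] at h3
    exact hp v ⟨by linarith, mem_ball_zero_iff.1 hv⟩
  · have h1 := dist_triangle_right x y p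
    have h2 := Metric.mem_closedBall.1 hx
    have h3 := Metric.mem_closedBall.1 hy
    linarith

section

/-- Radial push towards the unit circle. -/
def rad (s : ℝ) (ζ : ℂ) : ℂ := ((1 - s + s / ‖ζ‖ : ℝ) : ℂ) * ζ

theorem norm_rad {s : ℝ} (hs : s ∈ Icc (0 : ℝ) 1) {ζ : ℂ} (hζ : ζ ≠ 0) :
    ‖rad s ζ‖ = (1 - s) * ‖ζ‖ + s := by
  have h : 0 < ‖ζ‖ := norm_pos_iff.2 hζ
  have h1 : 0 ≤ 1 - s + s / ‖ζ‖ := add_nonneg (by linarith [hs.2]) (div_nonneg hs.1 h.le)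
  rw [rad, norm_mul, Complex.norm_real, Real.norm_of_nonneg h1]
  field_simp

theorem rad_zero (ζ : ℂ) : rad 0 ζ = ζ := by simp [rad]

theorem rad_rad_one {s : ℝ} (hs : s ∈ Icc (0 : ℝ) 1) {ζ : ℂ} (hζ : ζ ≠ 0) :
    rad 1 (rad s ζ) = rad 1 ζ := by
  have h : 0 < ‖ζ‖ := norm_pos_iff.2 hζ
  have h2 : 0 < (1 - s) * ‖ζ‖ + s := by
    rcases hs.1.eq_or_lt with h0 | h0
    · rw [← h0]; simpa using hζ
    · nlinarith [hs.2, mul_nonneg (sub_nonneg.2 hs.2) h.le]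
  rw [rad, norm_rad hs hζ, rad, rad, ← mul_assoc, ← Complex.ofReal_mul]
  congr 2
  field_simp
  ring

theorem norm_rad_sub_le {s : ℝ} (hs : s ∈ Icc (0 : ℝ) 1) {ζ : ℂ} (hζ : ζ ≠ 0) (h1 : ‖ζ‖ ≤ 1) :
    ‖rad s ζ - ζ‖ ≤ 1 - ‖ζ‖ := by
  have h : 0 < ‖ζ‖ := norm_pos_iff.2 hζ
  have e : rad s ζ - ζ = ((s * (1 - ‖ζ‖) / ‖ζ‖ : ℝ) : ℂ) * ζ := by
    rw [rad, ← sub_one_mul, ← Complex.ofReal_one, ← Complex.ofReal_sub]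
    congr 2
    field_simp
    ring
  rw [e, norm_mul, Complex.norm_real, Real.norm_of_nonneg
    (div_nonneg (mul_nonneg hs.1 (sub_nonneg.2 h1)) h.le), div_mul_cancel₀ _ h.ne']
  nlinarith [hs.2]

theorem continuousOn_rad : ContinuousOn (fun p : ℝ × ℂ => rad p.1 p.2) (univ ×ˢ {0}ᶜ) := by
  unfold rad
  refine ContinuousOn.mul (Complex.continuous_ofReal.comp_continuousOn
    (ContinuousOn.add (by fun_prop) (ContinuousOn.div (by fun_prop) (by fun_prop) ?_)))
    (by fun_prop)
  rintro p ⟨-, hp⟩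
  exact norm_ne_zero_iff.2 hp

variable {X : Set ℂ} {ψ g : ℂ → ℂ}

theorem ExteriorMap.isOpen_union (E : ExteriorMap X ψ g) {η : ℝ} (hη : η ∈ Ioo (0 : ℝ) 1) :
    IsOpen (X ∪ {w ∈ Xᶜ | 1 - η < ‖g w‖}) := by
  rw [← isClosed_compl_iff, ← closure_subset_iff_isClosed]
  have hC : (X ∪ {w ∈ Xᶜ | 1 - η < ‖g w‖})ᶜ = {w ∈ Xᶜ | ‖g w‖ ≤ 1 - η} := by
    ext w
    simp only [mem_compl_iff, mem_union, not_or, mem_ofPred_eq, not_and, not_lt]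
    exact ⟨fun h => ⟨h.1, h.2 h.1⟩, fun h => ⟨h.1, fun _ => h.2⟩⟩
  rw [hC]
  intro y hy
  obtain ⟨ρ, hρ, hρy⟩ := Metric.mem_nhdsWithin_iff.1
    (E.lim.eventually (eventually_ge_atTop (‖y‖ + 1)))
  have hK : IsCompact {ζ : ℂ | ρ ≤ ‖ζ‖ ∧ ‖ζ‖ ≤ 1 - η} := by
    have : {ζ : ℂ | ρ ≤ ‖ζ‖ ∧ ‖ζ‖ ≤ 1 - η} = Metric.closedBall 0 (1 - η) ∩ {ζ | ρ ≤ ‖ζ‖} := by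
      ext v; simp [and_comm]
    rw [this]
    exact (isCompact_closedBall _ _).inter_right (isClosed_le continuous_const continuous_norm)
  have hKA : {ζ : ℂ | ρ ≤ ‖ζ‖ ∧ ‖ζ‖ ≤ 1 - η} ⊆ Metric.ball 0 1 \ {0} := fun ζ hζ =>
    ⟨mem_ball_zero_iff.2 (by linarith [hζ.2, hη.1]), norm_pos_iff.1 (hρ.trans_le hζ.1)⟩
  have hsub : {w ∈ Xᶜ | ‖g w‖ ≤ 1 - η} ⊆
      {w | ‖y‖ + 1 ≤ ‖w‖} ∪ ψ '' {ζ | ρ ≤ ‖ζ‖ ∧ ‖ζ‖ ≤ 1 - η} := by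
    rintro w ⟨hw, hgw⟩
    rcases lt_or_ge ‖g w‖ ρ with h | h
    · left
      have := hρy ⟨mem_ball_zero_iff.2 h, (E.mg hw).2⟩
      rw [mem_ofPred_eq, E.ψg w hw] at this
      exact this
    · exact Or.inr ⟨g w, ⟨h, hgw⟩, E.ψg w hw⟩
  have hcl := closure_minimal hsub ((isClosed_le continuous_const continuous_norm).union
    (hK.image_of_continuousOn (E.dψ.continuousOn.mono hKA)).isClosed) hy
  rcases hcl with h | ⟨ζ, hζ, rfl⟩
  · have h' : ‖y‖ + 1 ≤ ‖y‖ := h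
    linarith
  · exact ⟨E.mψ (hKA hζ), by rw [E.gψ _ (hKA hζ)]; exact hζ.2⟩

/-- The exterior of a locally connected continuum without holes carries a radial collar. -/
theorem ExteriorMap.exists_collar (E : ExteriorMap X ψ g) (hX : IsCompact X)
    [LocallyConnectedSpace X] (hlog : HasLogs X) : ∃ N r R, Collar X N r R := by
  classical
  set A : Set ℂ := Metric.ball 0 1 \ {0} with hA
  have hAcl : Metric.closedBall (0 : ℂ) 1 \ {0} ⊆ closure A := by
    rintro ζ ⟨h1, h0⟩
    have h2 : A = {0}ᶜ ∩ Metric.ball 0 1 := by rw [hA, sdiff_eq, inter_comm]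
    rw [h2]
    refine (isOpen_compl_singleton.inter_closure ⟨h0, ?_⟩)
    rwa [closure_ball _ one_ne_zero]
  set Ψ := extendFrom A ψ with hΨ
  have hΨc : ContinuousOn Ψ (Metric.closedBall 0 1 \ {0}) := by
    refine continuousOn_extendFrom hAcl fun ζ hζ => ?_
    rcases (mem_closedBall_zero_iff.1 hζ.1).lt_or_eq with h | h
    · exact ⟨ψ ζ, E.dψ.continuousOn ζ ⟨mem_ball_zero_iff.2 h, hζ.2⟩⟩
    · exact E.exists_tendsto hX hlog h
  have hΨA : ∀ ζ ∈ A, Ψ ζ = ψ ζ := fun ζ hζ =>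
    extendFrom_extends E.dψ.continuousOn ζ hζ
  have hne1 : ∀ u : ℂ, ‖u‖ = 1 → u ≠ 0 := fun u hu h => by simp [h] at hu
  have hΨ1 : ∀ u : ℂ, ‖u‖ = 1 → Ψ u ∈ X := by
    intro u hu
    by_contra hcon
    have hgc : ContinuousAt g (Ψ u) := E.cg.continuousAt (hX.isClosed.isOpen_compl.mem_nhds hcon)
    have hu' : u ∈ Metric.closedBall (0 : ℂ) 1 \ {0} := ⟨by simp [hu], hne1 u hu⟩
    have h1 : Tendsto Ψ (𝓝[A] u) (𝓝 (Ψ u)) := (hΨc u hu').mono_left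
      (nhdsWithin_mono _ fun ζ hζ => ⟨Metric.ball_subset_closedBall hζ.1, hζ.2⟩)
    have h2 : Tendsto (fun ζ => g (Ψ ζ)) (𝓝[A] u) (𝓝 (g (Ψ u))) := hgc.tendsto.comp h1
    have h3 : Tendsto (fun ζ => g (Ψ ζ)) (𝓝[A] u) (𝓝 u) :=
      (tendsto_id.mono_left nhdsWithin_le_nhds).congr' <| by
        filter_upwards [self_mem_nhdsWithin] with ζ hζ
        rw [hΨA ζ hζ, E.gψ ζ hζ, id]
    have : (𝓝[A] u).NeBot := mem_closure_iff_nhdsWithin_neBot.1 (hAcl hu')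
    have h4 := (E.mg hcon).1
    rw [tendsto_nhds_unique h2 h3, mem_ball_zero_iff, hu] at h4
    exact lt_irrefl _ h4
  have hg0 : ∀ w ∉ X, g w ≠ 0 := fun w hw => (E.mg hw).2
  have hg1 : ∀ w ∉ X, ‖g w‖ < 1 := fun w hw => mem_ball_zero_iff.1 (E.mg hw).1
  have hgp : ∀ w ∉ X, 0 < ‖g w‖ := fun w hw => norm_pos_iff.2 (hg0 w hw)
  have hΨg : ∀ w ∉ X, Ψ (g w) = w := fun w hw => by rw [hΨA _ (E.mg hw), E.ψg w hw]
  set R : ℝ → ℂ → ℂ := fun s w => if w ∈ X then w else Ψ (rad s (g w)) with hR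
  have hRX : ∀ s, ∀ x ∈ X, R s x = x := fun s x hx => if_pos hx
  have hRc : ∀ s, ∀ w ∉ X, R s w = Ψ (rad s (g w)) := fun s w hw => if_neg hw
  set N : ℝ → Set ℂ := fun η => X ∪ {w ∈ Xᶜ | 1 - η < ‖g w‖} with hN
  have hNo : ∀ η ∈ Ioo (0 : ℝ) 1, IsOpen (N η) := fun η hη => E.isOpen_union hη
  have hradge : ∀ s ∈ Icc (0 : ℝ) 1, ∀ w ∉ X, ‖g w‖ ≤ ‖rad s (g w)‖ := fun s hs w hw => by
    rw [norm_rad hs (hg0 w hw)]; nlinarith [hg1 w hw, hs.1]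
  have hradle : ∀ s ∈ Icc (0 : ℝ) 1, ∀ w ∉ X, ‖rad s (g w)‖ ≤ 1 := fun s hs w hw => by
    rw [norm_rad hs (hg0 w hw)]; nlinarith [hg1 w hw, hs.2]
  have hradm : ∀ s ∈ Icc (0 : ℝ) 1, ∀ w ∉ X, rad s (g w) ∈ Metric.closedBall (0 : ℂ) 1 \ {0} :=
    fun s hs w hw => ⟨mem_closedBall_zero_iff.2 (hradle s hs w hw),
      norm_pos_iff.1 ((hgp w hw).trans_le (hradge s hs w hw))⟩
  have hK : IsCompact {ζ : ℂ | 1 / 2 ≤ ‖ζ‖ ∧ ‖ζ‖ ≤ 1} := by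
    have : {ζ : ℂ | 1 / 2 ≤ ‖ζ‖ ∧ ‖ζ‖ ≤ 1} = Metric.closedBall 0 1 ∩ {ζ | 1 / 2 ≤ ‖ζ‖} := by
      ext v; simp [and_comm]
    rw [this]
    exact (isCompact_closedBall _ _).inter_right (isClosed_le continuous_const continuous_norm)
  have hKs : {ζ : ℂ | 1 / 2 ≤ ‖ζ‖ ∧ ‖ζ‖ ≤ 1} ⊆ Metric.closedBall 0 1 \ {0} := fun ζ hζ =>
    ⟨mem_closedBall_zero_iff.2 hζ.2, norm_pos_iff.1 (by linarith [hζ.1])⟩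
  have hunif : ∀ ε > 0, ∃ η ∈ Ioo (0 : ℝ) 1, ∀ s ∈ Icc (0 : ℝ) 1, ∀ w ∈ N η,
      dist (R s w) w < ε := by
    intro ε hε
    obtain ⟨δ, hδ, h⟩ := Metric.uniformContinuousOn_iff.1
      (hK.uniformContinuousOn_of_continuous (hΨc.mono hKs)) ε hε
    refine ⟨min δ (1 / 2), ⟨by positivity, (min_le_right _ _).trans_lt (by norm_num)⟩,
      fun s hs w hw => ?_⟩
    by_cases hwX : w ∈ X
    · rw [hRX s w hwX, dist_self]; exact hε
    have hw' : 1 - min δ (1 / 2) < ‖g w‖ := (hw.resolve_left hwX).2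
    have hm1 := min_le_left δ (1 / 2)
    have hm2 := min_le_right δ (1 / 2)
    have hd : dist (rad s (g w)) (g w) < δ := by
      rw [dist_eq_norm]
      exact (norm_rad_sub_le hs (hg0 w hwX) (hg1 w hwX).le).trans_lt (by linarith)
    have := h (rad s (g w)) ⟨le_trans (by linarith) (hradge s hs w hwX), hradle s hs w hwX⟩ (g w)
      ⟨by linarith, (hg1 w hwX).le⟩ hd
    rwa [hΨg w hwX, ← hRc s w hwX] at this
  have hcontR : ∀ η ∈ Ioo (0 : ℝ) 1,
      ContinuousOn (fun p : ℝ × ℂ => R p.1 p.2) (Icc 0 1 ×ˢ N η) := by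
    rintro η hη ⟨s, w⟩ ⟨hs, hw⟩
    by_cases hwX : w ∈ X
    · rw [Metric.continuousWithinAt_iff']
      intro ε hε
      obtain ⟨η', hη', h⟩ := hunif (ε / 2) (half_pos hε)
      have h1 : {p : ℝ × ℂ | p.2 ∈ N η' ∩ Metric.ball w (ε / 2)} ∈ 𝓝 (s, w) :=
        (((hNo η' hη').inter Metric.isOpen_ball).preimage continuous_snd).mem_nhds
          ⟨Or.inl hwX, Metric.mem_ball_self (half_pos hε)⟩
      filter_upwards [mem_nhdsWithin_of_mem_nhds h1, self_mem_nhdsWithin]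
      rintro ⟨s', w'⟩ ⟨h2, h3⟩ ⟨h4, -⟩
      have h5 := h s' h4 w' h2
      have h6 := Metric.mem_ball.1 h3
      have h7 := dist_triangle (R s' w') w' w
      simp only [hRX s w hwX]
      simp only at h6
      linarith
    · have h1 : ContinuousOn (fun p : ℝ × ℂ => Ψ (rad p.1 (g p.2))) (Icc 0 1 ×ˢ Xᶜ) := by
        refine hΨc.comp ?_ fun p hp => hradm p.1 hp.1 p.2 hp.2
        refine continuousOn_rad.comp (f := fun p : ℝ × ℂ => (p.1, g p.2))
          (continuousOn_fst.prodMk (E.cg.comp continuousOn_snd fun p hp => hp.2)) ?_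
        exact fun p hp => ⟨mem_univ _, hg0 _ hp.2⟩
      have h2 : ContinuousWithinAt (fun p : ℝ × ℂ => R p.1 p.2) (Icc 0 1 ×ˢ Xᶜ) (s, w) :=
        (h1.congr fun p hp => hRc p.1 p.2 hp.2) (s, w) ⟨hs, hwX⟩
      refine h2.mono_of_mem_nhdsWithin ?_
      have h3 : {p : ℝ × ℂ | p.2 ∈ Xᶜ} ∈ 𝓝 (s, w) :=
        (hX.isClosed.isOpen_compl.preimage continuous_snd).mem_nhds hwX
      filter_upwards [mem_nhdsWithin_of_mem_nhds h3, self_mem_nhdsWithin] with p hp hp'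
      exact ⟨hp'.1, hp⟩
  have h1I : (1 : ℝ) ∈ Icc (0 : ℝ) 1 := ⟨zero_le_one, le_rfl⟩
  refine ⟨N, R 1, R, ⟨hNo, fun η _ => subset_union_left, ?_, fun η hη => ?_, fun η _ w hw => ?_,
    hRX 1, hcontR, fun η _ w hw => ?_, fun η _ w _ => rfl, fun η hη s hs w hw => ?_,
    fun η hη s hs w hw => ?_, fun s _ => hRX s⟩⟩
  · intro U hU hXU
    have hKU : IsCompact ({ζ : ℂ | 1 / 2 ≤ ‖ζ‖ ∧ ‖ζ‖ ≤ 1} ∩ Ψ ⁻¹' Uᶜ) :=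
      hK.of_isClosed_subset ((hΨc.mono hKs).preimage_isClosed_of_isClosed hK.isClosed
        hU.isClosed_compl) inter_subset_left
    obtain ⟨m, hm1, hm2, hm⟩ : ∃ m < (1 : ℝ), 1 / 2 ≤ m ∧
        ∀ ζ ∈ {ζ : ℂ | 1 / 2 ≤ ‖ζ‖ ∧ ‖ζ‖ ≤ 1} ∩ Ψ ⁻¹' Uᶜ, ‖ζ‖ ≤ m := by
      rcases eq_empty_or_nonempty ({ζ : ℂ | 1 / 2 ≤ ‖ζ‖ ∧ ‖ζ‖ ≤ 1} ∩ Ψ ⁻¹' Uᶜ) with h | h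
      · exact ⟨1 / 2, by norm_num, le_rfl, by rw [h]; simp⟩
      · obtain ⟨ζ, hζ, hmax⟩ := hKU.exists_isMaxOn h continuous_norm.continuousOn
        exact ⟨‖ζ‖, lt_of_le_of_ne hζ.1.2 fun h => hζ.2 (hXU (hΨ1 ζ h)), hζ.1.1,
          fun ξ hξ => hmax hξ⟩
    refine ⟨1 - m, ⟨by linarith, by linarith⟩, ?_⟩
    rintro w (hw | ⟨hw, hwm⟩)
    · exact hXU hw
    · by_contra hwU
      have := hm (g w) ⟨⟨by linarith, (hg1 w hw).le⟩, by rw [mem_preimage, hΨg w hw]; exact hwU⟩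
      linarith
  · exact (hcontR η hη).comp (f := fun w : ℂ => ((1 : ℝ), w))
      (continuousOn_const.prodMk continuousOn_id) fun w hw => ⟨h1I, hw⟩
  · by_cases hwX : w ∈ X
    · rwa [hRX 1 w hwX]
    · rw [hRc 1 w hwX]
      refine hΨ1 _ ?_
      rw [norm_rad h1I (hg0 w hwX)]; ring
  · by_cases hwX : w ∈ X
    · exact hRX 0 w hwX
    · rw [hRc 0 w hwX, rad_zero, hΨg w hwX]
  · by_cases hwX : w ∈ X
    · rw [hRX s w hwX]
    have e := rad_rad_one hs (hg0 w hwX)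
    rw [hRc s w hwX, hRc 1 w hwX, ← e]
    rcases (hradle s hs w hwX).lt_or_eq with h | h
    · have hmA : rad s (g w) ∈ A := ⟨mem_ball_zero_iff.2 h, (hradm s hs w hwX).2⟩
      rw [hΨA _ hmA, hRc 1 _ (E.mψ hmA), E.gψ _ hmA]
    · rw [hRX 1 _ (hΨ1 _ h)]
      congr 1
      conv_rhs => rw [rad, h]
      simp
  · by_cases hwX : w ∈ X
    · rw [hRX s w hwX]; exact Or.inl hwX
    rw [hRc s w hwX]
    rcases (hradle s hs w hwX).lt_or_eq with h | h
    · have hmA : rad s (g w) ∈ A := ⟨mem_ball_zero_iff.2 h, (hradm s hs w hwX).2⟩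
      rw [hΨA _ hmA]
      refine Or.inr ⟨E.mψ hmA, ?_⟩
      rw [E.gψ _ hmA]
      exact (hw.resolve_left hwX).2.trans_le (hradge s hs w hwX)
    · exact Or.inl (hΨ1 _ h)

end

theorem exists_homeomorph_plane {a b : EuclideanSpace ℝ (Fin 2)} (hab : a ≠ b) :
    ∃ Φ : EuclideanSpace ℝ (Fin 2) ≃ₜ ℂ, Φ a = -2 ∧ Φ b = 2 := by
  set Φ₀ := Complex.orthonormalBasisOneI.repr.symm.toHomeomorph
  have h : Φ₀ b - Φ₀ a ≠ 0 := sub_ne_zero.2 fun h => hab (Φ₀.injective h).symm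
  refine ⟨Φ₀.trans ((Homeomorph.subRight (Φ₀ a)).trans ((Homeomorph.mulLeft₀ (4 / (Φ₀ b - Φ₀ a))
    (div_ne_zero (by norm_num) h)).trans (Homeomorph.subRight 2))), ?_, ?_⟩
  · simp
  · simp only [Homeomorph.trans_apply, Homeomorph.coe_subRight, Homeomorph.coe_mulLeft₀]
    rw [div_mul_cancel₀ _ h]
    norm_num

theorem nonescaping_false_of_two_mem {X : Set ℂ} {f : ℂ → ℂ} {H : ℝ → ℂ → ℂ} (hX : IsCompact X)
    [SimplyConnectedSpace X] [LocallyConnectedSpace X] (h2 : (2 : ℂ) ∈ X) (hm2 : (-2 : ℂ) ∈ X)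
    (hf : ContinuousOn f X) (hfi : InjOn f X)
    (hH : ContinuousOn (fun p : ℝ × ℂ => H p.1 p.2) (Icc 0 1 ×ˢ X))
    (hH0 : ∀ x ∈ X, H 0 x = x) (hH1 : ∀ x ∈ X, H 1 x = f x)
    (hHi : ∀ t ∈ Icc (0 : ℝ) 1, InjOn (H t) X) (hconn : IsPreconnected (X ∩ f '' X))
    (hfix : ∀ x ∈ X, f x ≠ x) {x : ℂ} (hx : ∀ n, f^[n] x ∈ X) : False := by
  have := isCompact_iff_compactSpace.1 hX
  have := LocallyConnectedSpace.locallyPathConnectedSpace (M := X)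
  have hlog : HasLogs X := hasLogs_of_simplyConnectedSpace
  have hXp : IsPreconnected X := isPreconnected_iff_preconnectedSpace.2 inferInstance
  obtain ⟨ψ, g, E⟩ := exists_exteriorMap_of_two_mem hX hXp hlog h2 hm2
  obtain ⟨N, r, R, C⟩ := E.exists_collar hX hlog
  exact nonescaping_of_collar hX hlog C hf hfi hH hH0 hH1 hHi hconn hfix hx

/-- If `X ∩ Y` is connected and `f` has no fixed points,
then the non-escaping set of `f` is empty. -/
theorem nonescaping_set_empty (X Y : Set Plane) (f : Plane → Plane)
    (hXcomp : IsCompact X)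
    (hXsc : SimplyConnectedSpace ↥X)
    (hXlc : LocallyConnectedSpace ↥X)
    (hf : IsHomeoOnto f X Y)
    (hiso : IsotopicToIdOn f X)
    (hconn : IsConnected (X ∩ Y))
    (hfix : ∀ p ∈ X, f p ≠ p) :
    {x : Plane | x ∈ X ∧ ∀ n : ℕ, f^[n] x ∈ X ∩ Y} = ∅ := by
  rw [eq_empty_iff_forall_notMem]
  rintro x ⟨hx, hxn⟩
  obtain ⟨hfc, hfi, rfl⟩ := hf
  obtain ⟨H, hH, hH0, hH1, hHi⟩ := hiso
  obtain ⟨Φ, hΦa, hΦb⟩ := exists_homeomorph_plane (hfix x hx).symm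
  have hsymm : MapsTo Φ.symm (Φ '' X) X := by
    rintro _ ⟨y, hy, rfl⟩
    rwa [Φ.symm_apply_apply]
  have e : X ≃ₜ Φ '' X := Φ.image X
  have : SimplyConnectedSpace (Φ '' X) := e.symm.toHomotopyEquiv.simplyConnectedSpace
  have : LocallyConnectedSpace (Φ '' X) := e.symm.locallyConnectedSpace
  have himg : (fun z => Φ (f (Φ.symm z))) '' (Φ '' X) = Φ '' (f '' X) := by
    rw [image_image, image_image]
    simp
  refine nonescaping_false_of_two_mem (X := Φ '' X) (f := fun z => Φ (f (Φ.symm z)))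
    (H := fun t z => Φ (H t (Φ.symm z))) (x := Φ x) (hXcomp.image Φ.continuous)
    ⟨f x, (hxn 1).1, hΦb⟩ ⟨x, hx, hΦa⟩ ?_ ?_ ?_ ?_ ?_ ?_ ?_ ?_ fun n => ?_
  · exact Φ.continuous.comp_continuousOn (hfc.comp Φ.symm.continuous.continuousOn hsymm)
  · exact Φ.injective.injOn.comp (hfi.comp Φ.symm.injective.injOn hsymm) (mapsTo_univ _ _)
  · exact Φ.continuous.comp_continuousOn (hH.comp (f := fun p : ℝ × ℂ => (p.1, Φ.symm p.2))
      (by fun_prop) fun p hp => ⟨hp.1, hsymm hp.2⟩)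
  · intro z hz
    simp [hH0 _ (hsymm hz)]
  · intro z hz
    simp [hH1 _ (hsymm hz)]
  · exact fun t ht => Φ.injective.injOn.comp ((hHi t ht).comp Φ.symm.injective.injOn hsymm)
      (mapsTo_univ _ _)
  · rw [himg, ← image_inter Φ.injective]
    exact hconn.isPreconnected.image _ Φ.continuous.continuousOn
  · intro z hz h
    exact hfix _ (hsymm hz) (by rw [← Φ.symm_apply_apply (f (Φ.symm z)), h])
  · have hsc : Function.Semiconj Φ f (fun z => Φ (f (Φ.symm z))) := fun y => by simp
    rw [← hsc.iterate_right n x]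
    exact ⟨_, (hxn n).1, rfl⟩
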